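/- arXiv:0806.4561 — 2 statements merged into one kernel-verified Lean document; each statement's English description precedes it below -/
import Mathlib

section
/- Suppose (A1), (A2) and (sub2) hold, and let α ∈ (0,π]. If 0 ≤ s < π/(4α), then for every x ∈ W(α), E[τ_α^s | ξ₀ = x] < ∞. -/
open MeasureTheory
open scoped ENNReal

noncomputable section

/-- Euclidean norm of a lattice point in `ℤ²`. -/
def znorm (x : ℤ × ℤ) : ℝ := Real.sqrt ((x.1 : ℝ) ^ 2 + (x.2 : ℝ) ^ 2)

/-- Polar angle in `(-π, π]` of a lattice point. -/
def ang (x : ℤ × ℤ) : ℝ := Complex.arg ⟨(x.1 : ℝ), (x.2 : ℝ)⟩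

/-- The harmonic function `f_w(x) = r^w cos(w φ)` in polar coordinates. -/
def fw (w : ℝ) (x : ℤ × ℤ) : ℝ := znorm x ^ w * Real.cos (w * ang x)

/-- First component of the mean drift at `x` given jump pmf `p`. -/
def mu1 (p : ℤ × ℤ → ℤ × ℤ → ℝ) (x : ℤ × ℤ) : ℝ := ∑' y : ℤ × ℤ, p x y * (y.1 : ℝ)

/-- Second component of the mean drift at `x`. -/
def mu2 (p : ℤ × ℤ → ℤ × ℤ → ℝ) (x : ℤ × ℤ) : ℝ := ∑' y : ℤ × ℤ, p x y * (y.2 : ℝ)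

/-- Euclidean norm of the mean drift at `x`. -/
def muNorm (p : ℤ × ℤ → ℤ × ℤ → ℝ) (x : ℤ × ℤ) : ℝ :=
  Real.sqrt (mu1 p x ^ 2 + mu2 p x ^ 2)

/-- Second moment `M₁₁(x)`. -/
def M11 (p : ℤ × ℤ → ℤ × ℤ → ℝ) (x : ℤ × ℤ) : ℝ := ∑' y : ℤ × ℤ, p x y * (y.1 : ℝ) ^ 2

/-- Second moment `M₂₂(x)`. -/
def M22 (p : ℤ × ℤ → ℤ × ℤ → ℝ) (x : ℤ × ℤ) : ℝ := ∑' y : ℤ × ℤ, p x y * (y.2 : ℝ) ^ 2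

/-- Mixed second moment `M₁₂(x)`. -/
def M12 (p : ℤ × ℤ → ℤ × ℤ → ℝ) (x : ℤ × ℤ) : ℝ :=
  ∑' y : ℤ × ℤ, p x y * ((y.1 : ℝ) * (y.2 : ℝ))

/-- `p` is a family of probability mass functions on `ℤ²` (the jump laws `θ(x)`). -/
def IsJumpPMF (p : ℤ × ℤ → ℤ × ℤ → ℝ) : Prop :=
  (∀ x y, 0 ≤ p x y) ∧ ∀ x, HasSum (p x) 1

/-- (A2): jumps are uniformly bounded by `b`: `P[‖θ(x)‖ > b] = 0` for all `x`. -/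
def A2 (p : ℤ × ℤ → ℤ × ℤ → ℝ) (b : ℝ) : Prop :=
  ∀ x y, b < znorm y → p x y = 0

section walk

variable {Ω : Type*} [MeasurableSpace Ω]

/-- `ξ` is a time-homogeneous Markov chain with one-step jump law `p`:
conditionally on the past and on `ξ_t = x`, the law of `ξ_{t+1} - ξ_t` is `p x`. -/
def IsMarkovWith (P : Measure Ω) (ξ : ℕ → Ω → ℤ × ℤ) (p : ℤ × ℤ → ℤ × ℤ → ℝ) : Prop :=
  ∀ (t : ℕ) (x y : ℤ × ℤ) (A : Set Ω),
    MeasurableSet[⨆ s ∈ Finset.range (t + 1), MeasurableSpace.comap (ξ s) ⊤] A →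
    P (A ∩ {ω | ξ t ω = x} ∩ {ω | ξ (t + 1) ω = x + y}) =
      ENNReal.ofReal (p x y) * P (A ∩ {ω | ξ t ω = x})

/-- (A1): uniform weak isotropy: from any `x ∈ S`, in `n₀` steps the walk moves by
each of `±k e₁, ±k e₂` with conditional probability at least `κ`. -/
def A1 (P : Measure Ω) (S : Set (ℤ × ℤ)) (ξ : ℕ → Ω → ℤ × ℤ)
    (κ : ℝ) (k n₀ : ℕ) : Prop :=
  ∀ (t : ℕ), ∀ x ∈ S,
    ∀ y ∈ ({((k : ℤ), (0 : ℤ)), (-(k : ℤ), 0), (0, (k : ℤ)), (0, -(k : ℤ))} : Set (ℤ × ℤ)),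
      ENNReal.ofReal κ * P {ω | ξ t ω = x} ≤
        P ({ω | ξ t ω = x} ∩ {ω | ξ (t + n₀) ω = x + y})

/-- First exit time from a region `Wm`, with value `∞` if the walk never leaves. -/
def exitTime (Wm : Set (ℤ × ℤ)) (ξ : ℕ → Ω → ℤ × ℤ) (ω : Ω) : ℝ≥0∞ :=
  ⨅ (t : ℕ) (_ : ξ t ω ∉ Wm), (t : ℝ≥0∞)

end walk

/-- The wedge `W(α)` for `α ∈ (0,π)`, together with the `α = π` case, where
`W(π) = ℝ² \ H_b` is the complement of the thickened half-line of half-width `b`. -/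
def Wset (b α : ℝ) : Set (ℤ × ℤ) :=
  {x | (α < Real.pi ∧ znorm x * Real.cos α < (x.1 : ℝ)) ∨
       (α = Real.pi ∧ ¬ ((x.1 : ℝ) ≤ 0 ∧ |(x.2 : ℝ)| ≤ b))}

/-- The wedge `W(α) = {x : r > 0, -α < φ < α}` in polar form, for `α ∈ (0,π]`. -/
def WsetArg (α : ℝ) : Set (ℤ × ℤ) :=
  {x | 0 < znorm x ∧ -α < ang x ∧ ang x < α}

end

namespace WedgeExit

open Filter Topology Asymptotics ComplexConjugate

/-- `|1 + ζ|^(a + c) * exp (i (a - c) arg (1 + ζ))`, the factor by which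
`|z|^(a + c) * exp (i (a - c) arg z)` changes when `z` is multiplied by `1 + ζ`. -/
noncomputable def growth (a c : ℝ) (ζ : ℂ) : ℂ :=
  Complex.exp (a * Complex.log (1 + ζ) + c * conj (Complex.log (1 + ζ)))

/-- The second order Taylor polynomial of `growth a c` at `0`. -/
noncomputable def growthTaylor (a c : ℝ) (ζ : ℂ) : ℂ :=
  1 + a * ζ + c * conj ζ + a * (a - 1) / 2 * ζ ^ 2 + a * c * (ζ * conj ζ)
    + c * (c - 1) / 2 * conj ζ ^ 2

lemma isBigO_conj {f g : ℂ → ℂ} {l : Filter ℂ} (h : f =O[l] g) :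
    (fun z => conj (f z)) =O[l] g :=
  IsBigO.of_norm_left (by simpa using h.norm_left)

lemma log_one_add_isBigO (n : ℕ) :
    (fun ζ : ℂ => Complex.log (1 + ζ) - Complex.logTaylor (n + 1) ζ) =O[𝓝 0]
      (fun ζ => ζ ^ (n + 1)) := by
  refine IsBigO.of_bound 2 ?_
  filter_upwards [Metric.ball_mem_nhds (0 : ℂ) (by norm_num : (0 : ℝ) < 1 / 2)] with ζ hζ
  rw [mem_ball_zero_iff] at hζ
  refine (Complex.norm_log_sub_logTaylor_le n (hζ.trans (by norm_num))).trans ?_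
  have h1 : (1 - ‖ζ‖)⁻¹ ≤ 2 := by
    rw [inv_le_comm₀ (by linarith) (by norm_num)]
    linarith
  have h2 : ‖ζ‖ ^ (n + 1) * (1 - ‖ζ‖)⁻¹ ≤ ‖ζ‖ ^ (n + 1) * 2 := by gcongr
  have h3 : 0 ≤ ‖ζ‖ ^ (n + 1) * (1 - ‖ζ‖)⁻¹ :=
    mul_nonneg (by positivity) (inv_nonneg.2 (by linarith))
  rw [norm_pow]
  have : (1 : ℝ) ≤ n + 1 := by linarith [Nat.cast_nonneg (α := ℝ) n]
  linarith [div_le_self h3 this]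

lemma growth_sub_growthTaylor_isBigO (a c : ℝ) :
    (fun ζ => growth a c ζ - growthTaylor a c ζ) =O[𝓝 0] (fun ζ => ζ ^ 3) := by
  set L : ℂ → ℂ := fun ζ => Complex.log (1 + ζ) with hL
  set U : ℂ → ℂ := fun ζ => a * L ζ + c * conj (L ζ) with hU
  have hid : (fun ζ : ℂ => ζ) =O[𝓝 0] (fun ζ : ℂ => ζ) := isBigO_refl _ _
  have hR : (fun ζ => L ζ - (ζ - ζ ^ 2 / 2)) =O[𝓝 0] (fun ζ => ζ ^ 3) := by
    refine (log_one_add_isBigO 2).congr_left fun ζ => ?_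
    simp [hL, Complex.logTaylor, Finset.sum_range_succ]
    ring
  have hL2 : (fun ζ => L ζ - ζ) =O[𝓝 0] (fun ζ => ζ ^ 2) := by
    refine (log_one_add_isBigO 1).congr_left fun ζ => ?_
    simp [hL, Complex.logTaylor, Finset.sum_range_succ]
  have hL1 : L =O[𝓝 0] (fun ζ => ζ) := by
    refine ((log_one_add_isBigO 0).congr_left fun ζ => ?_).congr_right fun ζ => ?_
    · simp [hL, Complex.logTaylor]
    · simp
  have hU1 : U =O[𝓝 0] (fun ζ => ζ) :=
    (hL1.const_mul_left _).add ((isBigO_conj hL1).const_mul_left _)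
  have hV1 : (fun ζ : ℂ => a * ζ + c * conj ζ) =O[𝓝 0] (fun ζ => ζ) :=
    (hid.const_mul_left _).add ((isBigO_conj hid).const_mul_left _)
  have hUV : (fun ζ => U ζ - (a * ζ + c * conj ζ)) =O[𝓝 0] (fun ζ => ζ ^ 2) := by
    refine ((hL2.const_mul_left (a : ℂ)).add
      ((isBigO_conj hL2).const_mul_left (c : ℂ))).congr_left fun ζ => ?_
    simp only [hU, map_sub]
    ring
  have hsq : (fun ζ => U ζ ^ 2 - (a * ζ + c * conj ζ) ^ 2) =O[𝓝 0] (fun ζ => ζ ^ 3) := by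
    refine ((hUV.mul (hU1.add hV1)).congr_left fun ζ => ?_).congr_right fun ζ => ?_
    · ring
    · ring
  have hUt : Tendsto U (𝓝 0) (𝓝 0) := hU1.trans_tendsto tendsto_id
  have hE : (fun ζ => Complex.exp (U ζ) - (1 + U ζ + U ζ ^ 2 / 2)) =O[𝓝 0]
      (fun ζ => ζ ^ 3) := by
    refine (((Complex.exp_sub_sum_range_isBigO_pow 3).comp_tendsto hUt).congr_left
      fun ζ => ?_).trans (hU1.pow 3)
    simp [Finset.sum_range_succ]
  refine ((hE.add ((hR.const_mul_left (a : ℂ)).add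
      ((isBigO_conj hR).const_mul_left (c : ℂ)))).add
    (hsq.const_mul_left (1 / 2 : ℂ))).congr_left fun ζ => ?_
  simp only [growth, growthTaylor, hU, hL, map_sub, map_div₀, map_pow, map_ofNat]
  ring

lemma exists_growth_bound (a c : ℝ) :
    ∃ η > 0, ∃ C ≥ 0, ∀ ζ : ℂ, ‖ζ‖ ≤ η →
      ‖growth a c ζ - growthTaylor a c ζ‖ ≤ C * ‖ζ‖ ^ 3 := by
  obtain ⟨C, hC, h⟩ := (growth_sub_growthTaylor_isBigO a c).exists_nonneg
  obtain ⟨η, hη, h⟩ := Metric.nhds_basis_closedBall.eventually_iff.1 h.bound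
  refine ⟨η, hη, C, hC, fun ζ hζ => ?_⟩
  simpa using h (mem_closedBall_zero_iff.2 hζ)

/-- A lattice point seen as a complex number. -/
def toC (x : ℤ × ℤ) : ℂ := ⟨(x.1 : ℝ), (x.2 : ℝ)⟩

lemma norm_toC (x : ℤ × ℤ) : ‖toC x‖ = znorm x := by
  rw [Complex.norm_eq_sqrt_sq_add_sq]
  rfl

lemma arg_toC (x : ℤ × ℤ) : (toC x).arg = ang x := rfl

lemma toC_add (x y : ℤ × ℤ) : toC (x + y) = toC x + toC y := by
  apply Complex.ext <;> simp [toC]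

lemma znorm_nonneg (x : ℤ × ℤ) : 0 ≤ znorm x := Real.sqrt_nonneg _

lemma znorm_add_le (x y : ℤ × ℤ) : znorm (x + y) ≤ znorm x + znorm y := by
  simp only [← norm_toC, toC_add]
  exact norm_add_le _ _

lemma abs_fst_le_znorm (x : ℤ × ℤ) : |(x.1 : ℝ)| ≤ znorm x := by
  rw [← norm_toC]
  exact Complex.abs_re_le_norm (toC x)

lemma abs_snd_le_znorm (x : ℤ × ℤ) : |(x.2 : ℝ)| ≤ znorm x := by
  rw [← norm_toC]
  exact Complex.abs_im_le_norm (toC x)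

lemma finite_znorm_le (R : ℝ) : {x : ℤ × ℤ | znorm x ≤ R}.Finite := by
  refine (Set.finite_Icc ((-⌈R⌉, -⌈R⌉) : ℤ × ℤ) (⌈R⌉, ⌈R⌉)).subset fun x hx => ?_
  have hx : znorm x ≤ R := hx
  have h1 := abs_le.1 ((abs_fst_le_znorm x).trans (hx.trans (Int.le_ceil R)))
  have h2 := abs_le.1 ((abs_snd_le_znorm x).trans (hx.trans (Int.le_ceil R)))
  exact ⟨⟨by exact_mod_cast h1.1, by exact_mod_cast h2.1⟩,
    ⟨by exact_mod_cast h1.2, by exact_mod_cast h2.2⟩⟩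

/-- The finite set of possible jumps. -/
noncomputable def jumps (b : ℝ) : Finset (ℤ × ℤ) := (finite_znorm_le b).toFinset

lemma mem_jumps {b : ℝ} {y : ℤ × ℤ} : y ∈ jumps b ↔ znorm y ≤ b := by simp [jumps]

lemma tsum_eq_sum_jumps {p : ℤ × ℤ → ℤ × ℤ → ℝ} {b : ℝ} (hA2 : A2 p b) (x : ℤ × ℤ)
    (g : ℤ × ℤ → ℝ) : ∑' y, p x y * g y = ∑ y ∈ jumps b, p x y * g y :=
  tsum_eq_sum fun y hy => by
    rw [mem_jumps, not_le] at hy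
    rw [hA2 x y hy, zero_mul]

lemma sum_jumps_eq_one {p : ℤ × ℤ → ℤ × ℤ → ℝ} {b : ℝ} (hpmf : IsJumpPMF p) (hA2 : A2 p b)
    (x : ℤ × ℤ) : ∑ y ∈ jumps b, p x y = 1 := by
  have := tsum_eq_sum_jumps hA2 x (fun _ => 1)
  simp only [mul_one] at this
  rw [← this, (hpmf.2 x).tsum_eq]

/-- One step of the transition operator with jumps in `jumps b`. -/
noncomputable def step (p : ℤ × ℤ → ℤ × ℤ → ℝ) (b : ℝ) (g : ℤ × ℤ → ℝ) (x : ℤ × ℤ) : ℝ :=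
  ∑ y ∈ jumps b, p x y * g (x + y)

section geometry

variable {b α : ℝ}

lemma toC_ne_zero (hb : 0 < b) {x : ℤ × ℤ} (hx : x ∈ Wset b α) : toC x ≠ 0 := by
  intro h
  have h1 : (x.1 : ℝ) = 0 := congrArg Complex.re h
  have h2 : (x.2 : ℝ) = 0 := congrArg Complex.im h
  rcases hx with ⟨-, hx⟩ | ⟨-, hx⟩
  · rw [← norm_toC, h, h1] at hx
    simp at hx
  · exact hx ⟨h1.le, by simpa [h2] using hb.le⟩

lemma znorm_pos (hb : 0 < b) {x : ℤ × ℤ} (hx : x ∈ Wset b α) : 0 < znorm x := by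
  rw [← norm_toC]
  exact norm_pos_iff.2 (toC_ne_zero hb hx)

lemma abs_ang_le (hb : 0 < b) (hα0 : 0 < α) {x : ℤ × ℤ} (hx : x ∈ Wset b α) :
    |ang x| ≤ α := by
  have h0 := toC_ne_zero hb hx
  rcases hx with ⟨hα, hx⟩ | ⟨hα, -⟩
  · by_contra! h
    have h1 : Real.cos |ang x| < Real.cos α :=
      Real.cos_lt_cos_of_nonneg_of_le_pi hα0.le (Complex.abs_arg_le_pi _) h
    rw [Real.cos_abs, ← arg_toC, Complex.cos_arg h0, norm_toC,
      div_lt_iff₀ (by rw [← norm_toC]; exact norm_pos_iff.2 h0)] at h1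
    have : (toC x).re = x.1 := rfl
    linarith
  · rw [hα]
    exact Complex.abs_arg_le_pi _

lemma exists_arg_one_add_le {ε : ℝ} (hε : 0 < ε) :
    ∃ η > 0, ∀ ζ : ℂ, ‖ζ‖ ≤ η → |(1 + ζ).arg| ≤ ε := by
  have h : ContinuousAt (fun ζ : ℂ => |(1 + ζ).arg|) 0 :=
    (ContinuousAt.comp (g := Complex.arg) (Complex.continuousAt_arg (by simp))
      (by fun_prop)).abs
  have h2 : ∀ᶠ ζ in 𝓝 (0 : ℂ), |(1 + ζ).arg| < ε :=
    h.eventually_lt continuousAt_const (by simpa using hε)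
  obtain ⟨η, hη, h⟩ := Metric.nhds_basis_closedBall.eventually_iff.1 h2
  exact ⟨η, hη, fun ζ hζ => (h (mem_closedBall_zero_iff.2 hζ)).le⟩

lemma arg_add_mem_Ioc_of_slit {z ζ : ℂ} (hz : z ≠ 0) (hz' : 0 < z.re ∨
      (0 < z.im ∧ 0 < (z * (1 + ζ)).im) ∨ (z.im < 0 ∧ (z * (1 + ζ)).im < 0))
    (h1 : 1 + ζ ≠ 0) (hζ : |(1 + ζ).arg| < Real.pi / 2) :
    z.arg + (1 + ζ).arg ∈ Set.Ioc (-Real.pi) Real.pi := by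
  obtain ⟨h2, h3⟩ := abs_lt.1 hζ
  have hpi := Real.pi_pos
  have him : (z * (1 + ζ)).im = ‖z‖ * ‖1 + ζ‖ * Real.sin (z.arg + (1 + ζ).arg) := by
    conv_lhs => rw [← Complex.norm_mul_exp_arg_mul_I z, ← Complex.norm_mul_exp_arg_mul_I (1 + ζ)]
    rw [mul_mul_mul_comm, ← Complex.exp_add, ← add_mul, ← Complex.ofReal_add,
      ← Complex.ofReal_mul, Complex.im_ofReal_mul, Complex.exp_ofReal_mul_I_im]
  have hpos : 0 < ‖z‖ * ‖1 + ζ‖ := mul_pos (norm_pos_iff.2 hz) (norm_pos_iff.2 h1)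
  rcases hz' with h | ⟨h, h'⟩ | ⟨h, h'⟩
  · obtain ⟨h4, h5⟩ := abs_lt.1 (Complex.abs_arg_lt_pi_div_two_iff.2 (Or.inl h))
    exact ⟨by linarith, by linarith⟩
  · have h4 : 0 ≤ z.arg := Complex.arg_nonneg_iff.2 h.le
    refine ⟨by linarith, ?_⟩
    by_contra! h5
    have h6 := Real.sin_nonneg_of_nonneg_of_le_pi
      (by linarith : 0 ≤ z.arg + (1 + ζ).arg - Real.pi) (by linarith [Complex.arg_le_pi z])
    rw [Real.sin_sub_pi] at h6
    rw [him] at h'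
    linarith [pos_of_mul_pos_right h' hpos.le]
  · have h4 : z.arg < 0 := Complex.arg_neg_iff.2 h
    refine ⟨?_, by linarith⟩
    by_contra! h5
    have h6 := Real.sin_nonneg_of_nonneg_of_le_pi
      (by linarith [Complex.neg_pi_lt_arg z] : 0 ≤ z.arg + (1 + ζ).arg + 2 * Real.pi)
      (by linarith)
    rw [Real.sin_add_two_pi] at h6
    rw [him] at h'
    linarith [mul_nonneg hpos.le h6]

lemma re_mul_growth {a c θ : ℝ} {ζ : ℂ} (h1 : 1 + ζ ≠ 0) :
    (Complex.exp (((a - c) * θ : ℝ) * Complex.I) * growth a c ζ).re =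
      ‖1 + ζ‖ ^ (a + c) * Real.cos ((a - c) * (θ + (1 + ζ).arg)) := by
  have : ((a - c) * θ : ℝ) * Complex.I + (a * Complex.log (1 + ζ)
      + c * conj (Complex.log (1 + ζ))) = (((a + c) * Real.log ‖1 + ζ‖ : ℝ) : ℂ)
      + (((a - c) * (θ + (1 + ζ).arg) : ℝ) : ℂ) * Complex.I := by
    apply Complex.ext
    · simp [Complex.log_re]
      ring
    · simp [Complex.log_im]
      ring
  rw [growth, ← Complex.exp_add, this, Complex.exp_add, ← Complex.ofReal_exp,
    Complex.re_ofReal_mul, Complex.exp_ofReal_mul_I_re, Real.rpow_def_of_pos (norm_pos_iff.2 h1),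
    mul_comm (a + c)]

/-- The function `r ^ w * cos (v φ)` in polar coordinates, restricted to the wedge. -/
noncomputable def wedgeFun (b α w v : ℝ) : ℤ × ℤ → ℝ :=
  (Wset b α).indicator fun x => znorm x ^ w * Real.cos (v * ang x)

lemma wedgeFun_le {w v : ℝ} (x : ℤ × ℤ) : wedgeFun b α w v x ≤ znorm x ^ w :=
  Set.indicator_apply_le' (fun _ => mul_le_of_le_one_right
    (Real.rpow_nonneg (znorm_nonneg x) w) (Real.cos_le_one _))
    fun _ => Real.rpow_nonneg (znorm_nonneg x) w

lemma le_wedgeFun {w v : ℝ} (hb : 0 < b) (hα0 : 0 < α) (hv : 0 ≤ v)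
    (hvα : v * α < Real.pi / 2) {x : ℤ × ℤ} (hx : x ∈ Wset b α) :
    Real.cos (v * α) * znorm x ^ w ≤ wedgeFun b α w v x := by
  rw [wedgeFun, Set.indicator_of_mem hx, mul_comm]
  refine mul_le_mul_of_nonneg_left ?_ (Real.rpow_nonneg (znorm_nonneg x) w)
  rw [← Real.cos_abs (v * ang x), abs_mul, abs_of_nonneg hv]
  exact Real.cos_le_cos_of_nonneg_of_le_pi (by positivity) (by linarith [Real.pi_pos])
    (mul_le_mul_of_nonneg_left (abs_ang_le hb hα0 hx) hv)

lemma wedgeFun_nonneg {w v : ℝ} (hb : 0 < b) (hα0 : 0 < α) (hv : 0 ≤ v)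
    (hvα : v * α < Real.pi / 2) (x : ℤ × ℤ) : 0 ≤ wedgeFun b α w v x := by
  by_cases hx : x ∈ Wset b α
  · refine le_trans ?_ (le_wedgeFun hb hα0 hv hvα hx)
    exact mul_nonneg (Real.cos_nonneg_of_mem_Icc ⟨by
      linarith [Real.pi_pos, mul_nonneg hv hα0.le], hvα.le⟩)
      (Real.rpow_nonneg (znorm_nonneg x) w)
  · rw [wedgeFun, Set.indicator_of_notMem hx]

lemma slit_of_mem_Wset_pi {x y : ℤ × ℤ} (hb : 0 < b)
    (hx : x ∈ Wset b Real.pi) (hy : znorm y ≤ b) :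
    0 < (toC x).re ∨ (0 < (toC x).im ∧ 0 < (toC x + toC y).im) ∨
      ((toC x).im < 0 ∧ (toC x + toC y).im < 0) := by
  have hx : ¬ ((x.1 : ℝ) ≤ 0 ∧ |(x.2 : ℝ)| ≤ b) := by
    rcases hx with ⟨h, -⟩ | ⟨-, h⟩
    · exact absurd h (lt_irrefl _)
    · exact h
  have hy2 := abs_le.1 ((abs_snd_le_znorm y).trans hy)
  by_cases h : (x.1 : ℝ) ≤ 0
  · right
    have h2 : b < |(x.2 : ℝ)| := lt_of_not_ge fun h' => hx ⟨h, h'⟩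
    simp only [toC, Complex.add_im]
    rcases lt_abs.1 h2 with h2 | h2
    · exact Or.inl ⟨by linarith, by linarith⟩
    · exact Or.inr ⟨by linarith, by linarith⟩
  · exact Or.inl (not_le.1 h)

lemma exists_wedgeFun_add_le {a c : ℝ} (hb : 0 < b) (hα0 : 0 < α) (hαπ : α ≤ Real.pi)
    (hv : 0 < a - c) (hvα : (a - c) * α < Real.pi / 2) :
    ∃ R > 0, ∀ x ∈ Wset b α, R ≤ znorm x → ∀ y, znorm y ≤ b →
      wedgeFun b α (a + c) (a - c) (x + y) ≤ znorm x ^ (a + c) *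
        (Complex.exp (((a - c) * ang x : ℝ) * Complex.I) * growth a c (toC y / toC x)).re := by
  set v := a - c with hvdef
  have hgap : 0 < if α < Real.pi then Real.pi - α else 1 := by
    split_ifs with h
    · linarith
    · norm_num
  set ε : ℝ := min (Real.pi / 4) (min ((Real.pi / 2 - v * α) / v)
    ((if α < Real.pi then Real.pi - α else 1) / 2)) with hε
  have hε0 : 0 < ε := lt_min (by positivity) (lt_min (div_pos (by linarith) hv) (by positivity))
  obtain ⟨η, hη, harg⟩ := exists_arg_one_add_le hε0
  refine ⟨b / min η (1 / 2), by positivity, fun x hx hxR y hy => ?_⟩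
  have hz := toC_ne_zero hb hx
  have hr := znorm_pos hb hx
  set ζ := toC y / toC x with hζdef
  have hζ : ‖ζ‖ ≤ min η (1 / 2) := by
    rw [hζdef, norm_div, norm_toC, norm_toC, div_le_iff₀ hr]
    rw [div_le_iff₀ (by positivity)] at hxR
    linarith
  have h1 : 1 + ζ ≠ 0 := by
    intro h
    have : ‖ζ‖ = 1 := by rw [← norm_neg, ← eq_neg_of_add_eq_zero_left h, norm_one]
    linarith [min_le_right η (1 / 2)]
  have hψ := harg ζ (hζ.trans (min_le_left _ _))
  have hψ1 : |(1 + ζ).arg| ≤ Real.pi / 4 := hψ.trans (min_le_left _ _)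
  have hψ2 : v * |(1 + ζ).arg| ≤ Real.pi / 2 - v * α := by
    have := hψ.trans ((min_le_right _ _).trans (min_le_left _ _))
    rwa [le_div_iff₀ hv, mul_comm] at this
  have hxy : toC (x + y) = toC x * (1 + ζ) := by
    rw [toC_add, hζdef]
    field_simp
  rw [re_mul_growth h1]
  by_cases hmem : x + y ∈ Wset b α
  · have hsum : (toC x).arg + (1 + ζ).arg ∈ Set.Ioc (-Real.pi) Real.pi := by
      rcases hαπ.lt_or_eq with h | h
      · have h2 : ε ≤ (Real.pi - α) / 2 := by
          refine (min_le_right _ _).trans ((min_le_right _ _).trans ?_)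
          rw [if_pos h]
        have h3 := abs_le.1 (hψ.trans h2)
        have h4 := abs_le.1 (abs_ang_le hb hα0 hx)
        rw [arg_toC]
        exact ⟨by linarith, by linarith⟩
      · subst h
        refine arg_add_mem_Ioc_of_slit hz ?_ h1 (by linarith [Real.pi_pos])
        rw [← hxy, toC_add]
        exact slit_of_mem_Wset_pi hb hx hy
    rw [wedgeFun, Set.indicator_of_mem hmem, ← norm_toC (x + y), ← arg_toC (x + y), hxy,
      Complex.arg_mul hz h1 hsum, norm_mul, Real.mul_rpow (norm_nonneg _) (norm_nonneg _),
      norm_toC, arg_toC, mul_assoc]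
  · rw [wedgeFun, Set.indicator_of_notMem hmem]
    refine mul_nonneg (Real.rpow_nonneg hr.le _) (mul_nonneg (Real.rpow_nonneg (norm_nonneg _) _)
      (Real.cos_nonneg_of_mem_Icc (abs_le.1 ?_)))
    rw [abs_mul, abs_of_pos hv]
    have h3 := abs_add_le (ang x) (1 + ζ).arg
    have h4 := abs_ang_le hb hα0 hx
    nlinarith

end geometry

section drift

variable {p : ℤ × ℤ → ℤ × ℤ → ℝ} {b : ℝ}

lemma sum_growthTaylor (hpmf : IsJumpPMF p) (hA2 : A2 p b) (a c : ℝ) (x : ℤ × ℤ) (z : ℂ) :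
    ∑ y ∈ jumps b, (p x y : ℂ) * growthTaylor a c (toC y / z) =
      ((1 + a * c * ((M11 p x + M22 p x) / ‖z‖ ^ 2) : ℝ) : ℂ)
      + (a * ((⟨mu1 p x, mu2 p x⟩ : ℂ) / z) + c * conj ((⟨mu1 p x, mu2 p x⟩ : ℂ) / z))
      + (((a * (a - 1) / 2 : ℝ) : ℂ) * ((⟨M11 p x - M22 p x, 2 * M12 p x⟩ : ℂ) / z ^ 2)
        + ((c * (c - 1) / 2 : ℝ) : ℂ) *
          conj ((⟨M11 p x - M22 p x, 2 * M12 p x⟩ : ℂ) / z ^ 2)) := by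
  have hm : (⟨mu1 p x, mu2 p x⟩ : ℂ) = ∑ y ∈ jumps b, (p x y : ℂ) * toC y := by
    apply Complex.ext
    · simp only [Complex.re_sum, Complex.re_ofReal_mul]
      exact tsum_eq_sum_jumps hA2 x fun y => (y.1 : ℝ)
    · simp only [Complex.im_sum, Complex.im_ofReal_mul]
      exact tsum_eq_sum_jumps hA2 x fun y => (y.2 : ℝ)
  have hs : (⟨M11 p x - M22 p x, 2 * M12 p x⟩ : ℂ) =
      ∑ y ∈ jumps b, (p x y : ℂ) * toC y ^ 2 := by
    apply Complex.ext
    · simp only [Complex.re_sum, Complex.re_ofReal_mul, M11, M22, tsum_eq_sum_jumps hA2]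
      rw [← Finset.sum_sub_distrib]
      refine Finset.sum_congr rfl fun y _ => ?_
      simp [toC, pow_two]
      ring
    · simp only [Complex.im_sum, Complex.im_ofReal_mul, M12, tsum_eq_sum_jumps hA2]
      rw [Finset.mul_sum]
      refine Finset.sum_congr rfl fun y _ => ?_
      simp [toC, pow_two]
      ring
  have hq : ((M11 p x + M22 p x : ℝ) : ℂ) =
      ∑ y ∈ jumps b, (p x y : ℂ) * (toC y * conj (toC y)) := by
    simp only [M11, M22, tsum_eq_sum_jumps hA2]
    rw [← Finset.sum_add_distrib, Complex.ofReal_sum]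
    refine Finset.sum_congr rfl fun y _ => ?_
    rw [Complex.mul_conj, ← Complex.ofReal_mul]
    congr 1
    simp [toC, Complex.normSq_apply]
    ring
  have h1 : (1 : ℂ) = ∑ y ∈ jumps b, (p x y : ℂ) := by
    rw [← Complex.ofReal_sum, sum_jumps_eq_one hpmf hA2, Complex.ofReal_one]
  have hz : ((‖z‖ ^ 2 : ℝ) : ℂ) = z * conj z := by
    rw [Complex.mul_conj, Complex.normSq_eq_norm_sq]
  rw [Complex.ofReal_add, Complex.ofReal_mul, Complex.ofReal_div, hq, hz, Complex.ofReal_one, h1,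
    hm, hs]
  simp only [map_div₀, map_sum, map_mul, map_pow, Complex.conj_ofReal, Finset.sum_div,
    Finset.mul_sum, ← Finset.sum_add_distrib]
  refine Finset.sum_congr rfl fun y _ => ?_
  simp only [growthTaylor, map_div₀]
  push_cast
  ring

lemma norm_mul_add_mul_conj_le (a c : ℝ) (u : ℂ) :
    ‖a * u + c * conj u‖ ≤ (|a| + |c|) * ‖u‖ := by
  refine (norm_add_le _ _).trans_eq ?_
  rw [norm_mul, norm_mul, RCLike.norm_conj, Complex.norm_real, Complex.norm_real,
    Real.norm_eq_abs, Real.norm_eq_abs, add_mul]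

lemma re_sum_growth_le (hpmf : IsJumpPMF p) (hA2 : A2 p b) {a c η C : ℝ} (hC0 : 0 ≤ C)
    (hC : ∀ ζ : ℂ, ‖ζ‖ ≤ η → ‖growth a c ζ - growthTaylor a c ζ‖ ≤ C * ‖ζ‖ ^ 3)
    {e z : ℂ} (he : ‖e‖ = 1) (hz : z ≠ 0) (hzη : b / ‖z‖ ≤ η) (x : ℤ × ℤ) :
    ∑ y ∈ jumps b, p x y * (e * growth a c (toC y / z)).re ≤
      e.re * (1 + a * c * ((M11 p x + M22 p x) / ‖z‖ ^ 2))
      + (|a| + |c|) * (muNorm p x / ‖z‖)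
      + (|a * (a - 1) / 2| + |c * (c - 1) / 2|) *
        ((|M11 p x - M22 p x| + 2 * |M12 p x|) / ‖z‖ ^ 2)
      + C * (b / ‖z‖) ^ 3 := by
  have hz0 : 0 < ‖z‖ := norm_pos_iff.2 hz
  have hrem : ∀ y ∈ jumps b, p x y * (e * growth a c (toC y / z)).re ≤
      p x y * (e * growthTaylor a c (toC y / z)).re + p x y * (C * (b / ‖z‖) ^ 3) := by
    intro y hy
    rw [← mul_add]
    refine mul_le_mul_of_nonneg_left ?_ (hpmf.1 x y)
    have h1 : ‖toC y / z‖ ≤ b / ‖z‖ := by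
      rw [norm_div, norm_toC]
      exact div_le_div_of_nonneg_right (mem_jumps.1 hy) hz0.le
    have h2 : C * ‖toC y / z‖ ^ 3 ≤ C * (b / ‖z‖) ^ 3 := by gcongr
    have h3 := Complex.re_le_norm (e * (growth a c (toC y / z) - growthTaylor a c (toC y / z)))
    rw [norm_mul, he, one_mul, mul_sub, Complex.sub_re] at h3
    linarith [hC _ (h1.trans hzη)]
  refine (Finset.sum_le_sum hrem).trans ?_
  rw [Finset.sum_add_distrib, ← Finset.sum_mul, sum_jumps_eq_one hpmf hA2, one_mul]
  refine add_le_add_left ?_ _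
  have h1 : ∑ y ∈ jumps b, p x y * (e * growthTaylor a c (toC y / z)).re =
      (e * ∑ y ∈ jumps b, (p x y : ℂ) * growthTaylor a c (toC y / z)).re := by
    rw [Finset.mul_sum, Complex.re_sum]
    refine Finset.sum_congr rfl fun y _ => ?_
    rw [mul_left_comm, Complex.re_ofReal_mul]
  rw [h1, sum_growthTaylor hpmf hA2, mul_add, mul_add, Complex.add_re, Complex.add_re,
    Complex.re_mul_ofReal]
  gcongr
  · refine (Complex.re_le_norm _).trans ?_
    rw [norm_mul, he, one_mul]
    refine (norm_mul_add_mul_conj_le a c _).trans_eq ?_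
    rw [norm_div, muNorm, Complex.norm_eq_sqrt_sq_add_sq]
  · refine (Complex.re_le_norm _).trans ?_
    rw [norm_mul, he, one_mul]
    refine (norm_mul_add_mul_conj_le _ _ _).trans ?_
    rw [norm_div, norm_pow]
    gcongr
    refine (Complex.norm_le_abs_re_add_abs_im _).trans_eq ?_
    rw [abs_mul, abs_two]

lemma wedgeFun_drift (hpmf : IsJumpPMF p) (hb : 0 < b) (hA2 : A2 p b) {S : Set (ℤ × ℤ)}
    {σ2 : ℝ} (hσ : 0 < σ2)
    (hsub2 : ∀ ε : ℝ, 0 < ε → ∃ r₁ : ℝ, ∀ x ∈ S, r₁ ≤ znorm x →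
      znorm x * muNorm p x ≤ ε ∧ |M11 p x - σ2| ≤ ε ∧ |M22 p x - σ2| ≤ ε ∧ |M12 p x| ≤ ε)
    {α : ℝ} (hα0 : 0 < α) (hαπ : α ≤ Real.pi) {w v : ℝ} (hw : 0 < w) (hwv : w < v)
    (hvα : v * α < Real.pi / 2) :
    ∃ R > 0, ∃ k > 0, ∀ x ∈ S, x ∈ Wset b α → R ≤ znorm x →
      step p b (wedgeFun b α w v) x ≤
        wedgeFun b α w v x - k * (znorm x ^ w / znorm x ^ 2) := by
  set a := (w + v) / 2 with ha
  set c := (w - v) / 2 with hc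
  have hw' : w = a + c := by ring
  have hv' : v = a - c := by ring
  have hv : 0 < v := hw.trans hwv
  clear_value a c
  subst hw' hv'
  have hac : 0 < -(a * c) := by nlinarith
  set c₀ := Real.cos ((a - c) * α) with hc₀
  have hc₀pos : 0 < c₀ := Real.cos_pos_of_mem_Ioo ⟨by nlinarith [Real.pi_pos], hvα⟩
  obtain ⟨R₁, hR₁, hle⟩ := exists_wedgeFun_add_le hb hα0 hαπ hv hvα
  obtain ⟨η, hη, C, hC0, hC⟩ := exists_growth_bound a c
  set K := (|a| + |c|) + (|a * (a - 1) / 2| + |c * (c - 1) / 2|) * 4 with hK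
  have hK0 : 0 ≤ K := by positivity
  set k := -(a * c) * σ2 * c₀ with hk
  have hk0 : 0 < k := by positivity
  set ε := min (σ2 / 2) (k / (4 * (K + 1))) with hε
  have hε0 : 0 < ε := by positivity
  have hεσ : ε ≤ σ2 / 2 := min_le_left _ _
  have hεK : K * ε ≤ k / 4 := by
    have h : ε ≤ k / (4 * (K + 1)) := min_le_right _ _
    rw [le_div_iff₀ (by positivity)] at h
    nlinarith
  obtain ⟨R₂, hR₂⟩ := hsub2 ε hε0
  refine ⟨max R₁ (max R₂ (max (b / η) (C * b ^ 3 / (k / 4)))), lt_max_of_lt_left hR₁, k / 2,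
    by positivity, fun x hxS hxW hxR => ?_⟩
  simp only [max_le_iff] at hxR
  obtain ⟨hx1, hx2, hx3, hx4⟩ := hxR
  obtain ⟨hμ, h11, h22, h12⟩ := hR₂ x hxS hx2
  have hr := znorm_pos hb hxW
  set r := znorm x with hrdef
  set e := Complex.exp (((a - c) * ang x : ℝ) * Complex.I) with he
  have hmain := re_sum_growth_le hpmf hA2 hC0 hC (e := e) (z := toC x)
    (Complex.norm_exp_ofReal_mul_I _) (toC_ne_zero hb hxW)
    (by rw [norm_toC, div_le_iff₀ hr]; rwa [div_le_iff₀ hη, mul_comm] at hx3) x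
  rw [norm_toC, ← hrdef] at hmain
  have hcos : e.re = Real.cos ((a - c) * ang x) := Complex.exp_ofReal_mul_I_re _
  have hf : wedgeFun b α (a + c) (a - c) x = r ^ (a + c) * e.re := by
    rw [wedgeFun, Set.indicator_of_mem hxW, hcos]
  have hrw : 0 < r ^ (a + c) := Real.rpow_pos_of_pos hr _
  have hec : c₀ ≤ e.re := by
    have := le_wedgeFun (w := a + c) hb hα0 hv.le hvα hxW
    rw [hf, mul_comm] at this
    exact le_of_mul_le_mul_left this hrw
  have hstep : step p b (wedgeFun b α (a + c) (a - c)) x ≤ r ^ (a + c) *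
      ∑ y ∈ jumps b, p x y * (e * growth a c (toC y / toC x)).re := by
    rw [step, Finset.mul_sum]
    refine Finset.sum_le_sum fun y hy => ?_
    rw [mul_left_comm]
    exact mul_le_mul_of_nonneg_left (hle x hxW hx1 y (mem_jumps.1 hy)) (hpmf.1 x y)
  have hbound : ∑ y ∈ jumps b, p x y * (e * growth a c (toC y / toC x)).re ≤
      e.re - k / 2 / r ^ 2 := by
    refine hmain.trans ?_
    have hr2 : 0 < r ^ 2 := by positivity
    have h1 : muNorm p x / r ≤ ε / r ^ 2 := by
      rw [div_le_div_iff₀ hr hr2, pow_two, ← mul_assoc]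
      exact mul_le_mul_of_nonneg_right (by linarith) hr.le
    have h2 : (|M11 p x - M22 p x| + 2 * |M12 p x|) / r ^ 2 ≤ 4 * ε / r ^ 2 := by
      have := abs_sub_le (M11 p x) σ2 (M22 p x)
      rw [abs_sub_comm σ2] at this
      gcongr
      linarith
    have h3 : C * (b / r) ^ 3 ≤ k / 4 / r ^ 2 := by
      rw [div_le_iff₀ (by positivity)] at hx4
      rw [div_pow, ← mul_div_assoc, div_le_div_iff₀ (by positivity) hr2,
        pow_succ r 2, mul_comm (r ^ 2) r, ← mul_assoc]
      exact mul_le_mul_of_nonneg_right (by linarith) hr2.le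
    have h4 : e.re * (a * c * ((M11 p x + M22 p x) / r ^ 2)) ≤ -(k / r ^ 2) := by
      have h5 : σ2 ≤ M11 p x + M22 p x := by
        linarith [(abs_le.1 h11).1, (abs_le.1 h22).1]
      have h6 : k ≤ e.re * (-(a * c) * (M11 p x + M22 p x)) := by
        have he0 : 0 ≤ e.re := hc₀pos.le.trans hec
        rw [hk, mul_comm (-(a * c) * σ2)]
        gcongr
      have h7 : k / r ^ 2 ≤ e.re * (-(a * c) * (M11 p x + M22 p x)) / r ^ 2 := by gcongr
      have h8 : e.re * (a * c * ((M11 p x + M22 p x) / r ^ 2)) =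
        -(e.re * (-(a * c) * (M11 p x + M22 p x)) / r ^ 2) := by ring
      linarith
    have h5 : (|a| + |c|) * (muNorm p x / r) ≤ (|a| + |c|) * (ε / r ^ 2) := by gcongr
    have h6 : (|a * (a - 1) / 2| + |c * (c - 1) / 2|) *
        ((|M11 p x - M22 p x| + 2 * |M12 p x|) / r ^ 2) ≤
        (|a * (a - 1) / 2| + |c * (c - 1) / 2|) * (4 * ε / r ^ 2) := by gcongr
    have h7 : (|a| + |c|) * (ε / r ^ 2) + (|a * (a - 1) / 2| + |c * (c - 1) / 2|) *
        (4 * ε / r ^ 2) = K * ε / r ^ 2 := by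
      rw [hK]
      ring
    have h8 : K * ε / r ^ 2 ≤ k / 4 / r ^ 2 := by gcongr
    have h9 : k / 4 / r ^ 2 + k / 4 / r ^ 2 - k / r ^ 2 = -(k / 2 / r ^ 2) := by ring
    linarith
  refine hstep.trans ((mul_le_mul_of_nonneg_left hbound hrw.le).trans_eq ?_)
  rw [hf]
  ring

end drift

section survival

variable {p : ℤ × ℤ → ℤ × ℤ → ℝ} {b : ℝ}

lemma step_const (hpmf : IsJumpPMF p) (hA2 : A2 p b) (r : ℝ) (x : ℤ × ℤ) :
    step p b (fun _ => r) x = r := by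
  rw [step, ← Finset.sum_mul, sum_jumps_eq_one hpmf hA2, one_mul]

lemma step_mono (hpmf : IsJumpPMF p) {f g : ℤ × ℤ → ℝ} {x : ℤ × ℤ}
    (h : ∀ y ∈ jumps b, 0 < p x y → f (x + y) ≤ g (x + y)) : step p b f x ≤ step p b g x := by
  refine Finset.sum_le_sum fun y hy => ?_
  rcases (hpmf.1 x y).eq_or_lt with h0 | h0
  · simp [← h0]
  · exact mul_le_mul_of_nonneg_left (h y hy h0) h0.le

lemma step_add (f g : ℤ × ℤ → ℝ) (x : ℤ × ℤ) :
    step p b (fun z => f z + g z) x = step p b f x + step p b g x := by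
  simp only [step, mul_add, Finset.sum_add_distrib]

lemma step_const_mul (r : ℝ) (f : ℤ × ℤ → ℝ) (x : ℤ × ℤ) :
    step p b (fun z => r * f z) x = r * step p b f x := by
  simp only [step, Finset.mul_sum, mul_left_comm]

lemma step_sum {ι : Type*} (s : Finset ι) (f : ι → ℤ × ℤ → ℝ) (x : ℤ × ℤ) :
    step p b (fun z => ∑ i ∈ s, f i z) x = ∑ i ∈ s, step p b (f i) x := by
  simp only [step, Finset.mul_sum]
  exact Finset.sum_comm

/-- The probability that the chain started at the given point is in `D` at times
`0, …, n - 1` and in `E` at time `n`. -/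
noncomputable def killed (p : ℤ × ℤ → ℤ × ℤ → ℝ) (b : ℝ) (D E : Set (ℤ × ℤ)) :
    ℕ → ℤ × ℤ → ℝ
  | 0 => E.indicator 1
  | n + 1 => D.indicator (step p b (killed p b D E n))

variable {D E : Set (ℤ × ℤ)}

lemma killed_zero (x : ℤ × ℤ) : killed p b D E 0 x = E.indicator 1 x := rfl

lemma killed_succ_of_mem (n : ℕ) {x : ℤ × ℤ} (hx : x ∈ D) :
    killed p b D E (n + 1) x = step p b (killed p b D E n) x :=
  Set.indicator_of_mem hx _

lemma killed_of_notMem (n : ℕ) {x : ℤ × ℤ} (hx : x ∉ D) : killed p b D D n x = 0 := by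
  cases n <;> exact Set.indicator_of_notMem hx _

lemma killed_nonneg (hpmf : IsJumpPMF p) (n : ℕ) (x : ℤ × ℤ) : 0 ≤ killed p b D E n x := by
  induction n generalizing x with
  | zero => exact Set.indicator_nonneg (fun _ _ => zero_le_one) x
  | succ n ih =>
    exact Set.indicator_nonneg
      (fun _ _ => Finset.sum_nonneg fun y _ => mul_nonneg (hpmf.1 _ _) (ih _)) x

lemma killed_le_one (hpmf : IsJumpPMF p) (hA2 : A2 p b) (n : ℕ) (x : ℤ × ℤ) :
    killed p b D E n x ≤ 1 := by
  induction n generalizing x with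
  | zero => exact Set.indicator_apply_le' (fun _ => le_rfl) fun _ => zero_le_one
  | succ n ih =>
    refine Set.indicator_apply_le' (fun _ => ?_) fun _ => zero_le_one
    exact (step_mono hpmf fun y _ _ => ih (x + y)).trans_eq (step_const hpmf hA2 1 x)

lemma killed_antitone (hpmf : IsJumpPMF p) (hA2 : A2 p b) (x : ℤ × ℤ) :
    Antitone fun n => killed p b D D n x := by
  refine antitone_nat_of_succ_le fun n => ?_
  induction n generalizing x with
  | zero =>
    by_cases hx : x ∈ D
    · rw [killed_zero, Set.indicator_of_mem hx]
      exact killed_le_one hpmf hA2 _ x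
    · simp only [killed_of_notMem _ hx, le_refl]
  | succ n ih =>
    by_cases hx : x ∈ D
    · rw [killed_succ_of_mem _ hx, killed_succ_of_mem _ hx]
      exact step_mono hpmf fun y _ _ => ih (x + y)
    · simp only [killed_of_notMem _ hx, le_refl]

/-- If `g` is a Lyapunov function whose mean decrease in one step from `D` is at least
`k * g ^ (1 - 1 / m)`, then the survival probability in `D` decays like `T ^ (-m)`. -/
lemma killed_tail (hpmf : IsJumpPMF p) {V : Set (ℤ × ℤ)} (hA2 : A2 p b)
    (hV : ∀ x ∈ V, ∀ y, 0 < p x y → x + y ∈ V) {g : ℤ × ℤ → ℝ} (hg0 : ∀ x, 0 ≤ g x)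
    (hg1 : ∀ x ∈ D, 1 ≤ g x) {m k : ℝ} (hm : 0 < m) (hk : 0 < k)
    (hdrift : ∀ x ∈ V, x ∈ D → step p b g x ≤ g x * (1 - k * g x ^ (-(1 / m)))) :
    ∃ A, ∀ T : ℕ, ∀ x ∈ V, (T : ℝ) ^ m * killed p b D D T x ≤ A * g x := by
  set A : ℝ := max 1 ((max 1 m / k) ^ m) with hA
  have hA1 : 1 ≤ A := le_max_left _ _
  have hkA : max 1 m ≤ k * A ^ (1 / m) := by
    have h0 : 0 ≤ max 1 m / k := div_nonneg (zero_le_one.trans (le_max_left _ _)) hk.le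
    have h : max 1 m / k ≤ A ^ (1 / m) := by
      calc max 1 m / k = ((max 1 m / k) ^ m) ^ (1 / m) := by
            rw [← Real.rpow_mul h0, mul_one_div_cancel hm.ne', Real.rpow_one]
        _ ≤ A ^ (1 / m) := Real.rpow_le_rpow (Real.rpow_nonneg h0 _) (le_max_right _ _)
            (by positivity)
    rwa [div_le_iff₀' hk] at h
  refine ⟨A, fun T => ?_⟩
  induction T with
  | zero =>
    intro x _
    rw [Nat.cast_zero, Real.zero_rpow hm.ne', zero_mul]
    exact mul_nonneg (zero_le_one.trans hA1) (hg0 x)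
  | succ T ih =>
    intro x hxV
    by_cases hxD : x ∈ D
    swap
    · rw [killed_of_notMem _ hxD, mul_zero]
      exact mul_nonneg (zero_le_one.trans hA1) (hg0 x)
    have hg : 1 ≤ g x := hg1 x hxD
    have hT1 : (0 : ℝ) < ((T + 1 : ℕ) : ℝ) := by positivity
    rcases le_or_gt (((T + 1 : ℕ) : ℝ) ^ m) (A * g x) with hcase | hcase
    · exact (mul_le_of_le_one_right (by positivity) (killed_le_one hpmf hA2 _ x)).trans hcase
    have hT : 0 < T := by
      rcases Nat.eq_zero_or_pos T with h | h
      · subst h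
        simp only [zero_add, Nat.cast_one, Real.one_rpow] at hcase
        nlinarith
      · exact h
    have hT0 : (0 : ℝ) < (T : ℝ) ^ m := Real.rpow_pos_of_pos (by exact_mod_cast hT) _
    set q : ℝ := 1 / ((T + 1 : ℕ) : ℝ) with hq
    have hq0 : 0 < q := by positivity
    have hq1 : q ≤ 1 := by
      rw [hq, div_le_one hT1]
      push_cast
      linarith [Nat.cast_nonneg (α := ℝ) T]
    have hgq : max 1 m * q ≤ k * g x ^ (-(1 / m)) := by
      have h1 : (A * g x) ^ (1 / m) ≤ ((T + 1 : ℕ) : ℝ) := by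
        calc (A * g x) ^ (1 / m) ≤ (((T + 1 : ℕ) : ℝ) ^ m) ^ (1 / m) :=
              Real.rpow_le_rpow (by positivity) hcase.le (by positivity)
          _ = _ := by rw [← Real.rpow_mul hT1.le, mul_one_div_cancel hm.ne', Real.rpow_one]
      have h2 : 0 < g x ^ (1 / m) := by positivity
      rw [Real.mul_rpow (by positivity) (by positivity)] at h1
      rw [Real.rpow_neg (by positivity), hq, mul_one_div, ← div_eq_mul_inv,
        div_le_div_iff₀ hT1 h2]
      calc max 1 m * g x ^ (1 / m) ≤ k * A ^ (1 / m) * g x ^ (1 / m) := by gcongr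
        _ = k * (A ^ (1 / m) * g x ^ (1 / m)) := by ring
        _ ≤ k * ((T + 1 : ℕ) : ℝ) := by gcongr
    have hbern : ((T + 1 : ℕ) : ℝ) ^ m * (1 - max 1 m * q) ≤ (T : ℝ) ^ m := by
      have h1 : (T : ℝ) = ((T + 1 : ℕ) : ℝ) * (1 - q) := by
        rw [hq]
        field_simp
        push_cast
        ring
      rw [h1, Real.mul_rpow hT1.le (by linarith)]
      refine mul_le_mul_of_nonneg_left ?_ (by positivity)
      calc 1 - max 1 m * q = 1 + max 1 m * (-q) := by ring
        _ ≤ (1 + -q) ^ max 1 m :=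
          one_add_mul_self_le_rpow_one_add (by linarith) (le_max_left _ _)
        _ ≤ (1 - q) ^ m := by
          rcases eq_or_lt_of_le hq1 with h | h
          · rw [h, ← sub_eq_add_neg, sub_self, Real.zero_rpow hm.ne',
              Real.zero_rpow (by positivity)]
          · rw [← sub_eq_add_neg]
            exact Real.rpow_le_rpow_of_exponent_ge (by linarith) (by linarith) (le_max_right _ _)
    have hstep : (T : ℝ) ^ m * killed p b D D (T + 1) x ≤ A * (g x * (1 - max 1 m * q)) := by
      rw [killed_succ_of_mem _ hxD, ← step_const_mul]
      refine (step_mono hpmf (g := fun z => A * g z)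
        fun y _ hy => ih _ (hV x hxV y hy)).trans ?_
      rw [step_const_mul]
      refine mul_le_mul_of_nonneg_left ((hdrift x hxV hxD).trans ?_) (by positivity)
      refine mul_le_mul_of_nonneg_left ?_ (hg0 x)
      linarith
    refine le_of_mul_le_mul_left ?_ hT0
    calc (T : ℝ) ^ m * (((T + 1 : ℕ) : ℝ) ^ m * killed p b D D (T + 1) x)
        = ((T + 1 : ℕ) : ℝ) ^ m * ((T : ℝ) ^ m * killed p b D D (T + 1) x) := by ring
      _ ≤ ((T + 1 : ℕ) : ℝ) ^ m * (A * (g x * (1 - max 1 m * q))) := by gcongr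
      _ = (A * g x) * (((T + 1 : ℕ) : ℝ) ^ m * (1 - max 1 m * q)) := by ring
      _ ≤ (A * g x) * (T : ℝ) ^ m := by gcongr
      _ = (T : ℝ) ^ m * (A * g x) := mul_comm _ _

lemma step_sum_killed (n : ℕ) {x : ℤ × ℤ} (hx : x ∈ D) :
    step p b (fun z => ∑ j ∈ Finset.range n, killed p b D D j z) x =
      (∑ j ∈ Finset.range n, killed p b D D j x) - (1 - killed p b D D n x) := by
  rw [step_sum]
  simp only [← killed_succ_of_mem _ hx]
  have h := Finset.sum_range_succ (fun j => killed p b D D j x) n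
  rw [Finset.sum_range_succ', killed_zero, Set.indicator_of_mem hx, Pi.one_apply] at h
  linarith

lemma killed_add_le (hpmf : IsJumpPMF p) (hA2 : A2 p b) (n j : ℕ) (x z : ℤ × ℤ) :
    killed p b D D (n + j) x ≤
      1 - killed p b Set.univ {z} n x * (1 - killed p b D D j z) := by
  have hz0 := killed_nonneg (b := b) (D := D) (E := D) hpmf j z
  have hz1 := killed_le_one (D := D) (E := D) hpmf hA2 j z
  induction n generalizing x with
  | zero =>
    rw [zero_add, killed_zero]
    by_cases hx : x = z
    · rw [hx, Set.indicator_of_mem (Set.mem_singleton z), Pi.one_apply]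
      linarith
    · rw [Set.indicator_of_notMem (by simpa using hx)]
      linarith [killed_le_one (D := D) (E := D) hpmf hA2 j x]
  | succ n ih =>
    by_cases hx : x ∈ D
    · rw [Nat.succ_add_eq_add_succ, Nat.add_succ, killed_succ_of_mem _ hx,
        killed_succ_of_mem _ (Set.mem_univ x)]
      refine (step_mono hpmf (g := fun y => 1 - killed p b Set.univ {z} n y *
        (1 - killed p b D D j z)) fun y _ _ => ih (x + y)).trans_eq ?_
      have h := step_add (p := p) (b := b) (fun _ => 1)
        (fun y => -(1 - killed p b D D j z) * killed p b Set.univ {z} n y) x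
      rw [step_const hpmf hA2, step_const_mul] at h
      rw [show ∀ q r : ℝ, 1 - q * r = 1 + -r * q by intros; ring, ← h]
      congr 1
      ext y
      ring
    · rw [killed_of_notMem _ hx]
      nlinarith [killed_le_one (D := Set.univ) (E := {z}) hpmf hA2 (n + 1) x,
        killed_nonneg (b := b) (D := Set.univ) (E := {z}) hpmf (n + 1) x]

/-- A path with jumps bounded by `b` cannot change the sign of its second coordinate over
the negative half-line without entering the strip removed from the slit plane. -/
lemma killed_add_killed_le_one (hpmf : IsJumpPMF p) (hA2 : A2 p b) (hb : 0 < b) {s : ℝ}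
    (hs : s = 1 ∨ s = -1) {z : ℤ × ℤ} (hz : s * z.2 ≤ 0) (n : ℕ) {x : ℤ × ℤ}
    (hx1 : (x.1 : ℝ) ≤ -(n * b)) (hx2 : 0 < s * x.2) :
    killed p b (Wset b Real.pi) (Wset b Real.pi) n x + killed p b Set.univ {z} n x ≤ 1 := by
  induction n generalizing x with
  | zero =>
    have hne : x ∉ ({z} : Set (ℤ × ℤ)) := by
      rintro rfl
      linarith
    rw [killed_zero (D := Set.univ), Set.indicator_of_notMem hne, add_zero]
    exact killed_le_one hpmf hA2 _ _
  | succ n ih =>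
    by_cases hx : x ∈ Wset b Real.pi
    · rw [killed_succ_of_mem _ hx, killed_succ_of_mem _ (Set.mem_univ x), ← step_add]
      refine (step_mono hpmf (g := fun _ => 1) fun y hy _ => ?_).trans_eq
        (step_const hpmf hA2 1 x)
      have hy1 := abs_le.1 ((abs_fst_le_znorm y).trans (mem_jumps.1 hy))
      have hy2 := abs_le.1 ((abs_snd_le_znorm y).trans (mem_jumps.1 hy))
      push_cast at hx1
      have hx1' : (x.1 : ℝ) ≤ 0 := by nlinarith [mul_nonneg n.cast_nonneg hb.le]
      have hxb : b < |(x.2 : ℝ)| := by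
        rcases hx with ⟨h, -⟩ | ⟨-, h⟩
        · exact absurd h (lt_irrefl _)
        · exact lt_of_not_ge fun h' => h ⟨hx1', h'⟩
      refine ih ?_ ?_
      · push_cast [Prod.fst_add]
        linarith
      · push_cast [Prod.snd_add]
        rcases hs with rfl | rfl
        · rw [abs_of_pos (by linarith)] at hxb
          linarith
        · rw [abs_of_neg (by linarith)] at hxb
          linarith
    · rw [killed_of_notMem _ hx, zero_add]
      exact killed_le_one hpmf hA2 _ _

section isotropy

variable {V : Set (ℤ × ℤ)} {κ : ℝ} {k n₀ : ℕ}

lemma exists_killed_lt_one_of_add_nsmul (hpmf : IsJumpPMF p) (hA2 : A2 p b) (hκ : 0 < κ)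
    {v : ℤ × ℤ} (hv : ∀ x ∈ V, x + v ∈ V ∧ κ ≤ killed p b Set.univ {x + v} n₀ x)
    {Q : ℤ × ℤ → Prop} (hQ : ∀ x ∈ V, Q x → ∃ N, killed p b D D N x < 1) (m : ℕ)
    {x : ℤ × ℤ} (hx : x ∈ V) (hm : Q (x + m • v)) : ∃ N, killed p b D D N x < 1 := by
  induction m generalizing x with
  | zero => exact hQ x hx (by simpa using hm)
  | succ m ih =>
    obtain ⟨hxv, hκx⟩ := hv x hx
    obtain ⟨N, hN⟩ := ih hxv (by rwa [add_assoc, ← succ_nsmul'])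
    refine ⟨n₀ + N, (killed_add_le hpmf hA2 n₀ N x (x + v)).trans_lt ?_⟩
    nlinarith

lemma exists_add_nsmul_notMem_Wset {α : ℝ} (hα0 : 0 < α) (hαπ : α < Real.pi) (hk : 0 < k)
    (x : ℤ × ℤ) : ∃ m : ℕ, x + m • ((-(k : ℤ), 0) : ℤ × ℤ) ∉ Wset b α := by
  have hsin : 0 < Real.sin α := Real.sin_pos_of_pos_of_lt_pi hα0 hαπ
  obtain ⟨m, hm⟩ := exists_nat_ge (x.1 + |(x.2 : ℝ)| / Real.sin α)
  refine ⟨m, ?_⟩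
  set z := x + m • ((-(k : ℤ), 0) : ℤ × ℤ) with hz
  have hz1 : (z.1 : ℝ) = x.1 - m * k := by
    simp [hz]
    ring
  have hz2 : (z.2 : ℝ) = x.2 := by simp [hz]
  rintro (⟨-, h⟩ | ⟨h, -⟩)
  swap
  · exact hαπ.ne h
  have hk1 : (1 : ℝ) ≤ k := by exact_mod_cast hk
  have hzle : |(z.2 : ℝ)| / Real.sin α ≤ -z.1 := by
    rw [hz1, hz2]
    nlinarith [m.cast_nonneg (α := ℝ)]
  have hz0 : 0 ≤ -(z.1 : ℝ) := (by positivity : 0 ≤ |(z.2 : ℝ)| / Real.sin α).trans hzle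
  rw [div_le_iff₀ hsin] at hzle
  have hsq : (z.2 : ℝ) ^ 2 ≤ (z.1 : ℝ) ^ 2 * Real.sin α ^ 2 := by
    rw [← sq_abs]
    calc |(z.2 : ℝ)| ^ 2 ≤ (-(z.1 : ℝ) * Real.sin α) ^ 2 := by gcongr
      _ = _ := by ring
  have hle : |znorm z * Real.cos α| ≤ -z.1 := by
    refine abs_le_of_sq_le_sq ?_ hz0
    rw [mul_pow, znorm, Real.sq_sqrt (by positivity)]
    nlinarith [Real.sin_sq_add_cos_sq α, sq_nonneg (z.1 : ℝ), Real.cos_sq_le_one α,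
      sq_nonneg (Real.sin α), sq_nonneg (Real.cos α),
      mul_le_mul_of_nonneg_right hsq (sq_nonneg (Real.cos α))]
  linarith [(abs_le.1 hle).1]

lemma exists_killed_lt_one (hpmf : IsJumpPMF p) (hA2 : A2 p b) (hb : 0 < b) (hκ : 0 < κ)
    (hk : 0 < k)
    (hV : ∀ x ∈ V, ∀ y ∈ ({((k : ℤ), (0 : ℤ)), (-(k : ℤ), 0), (0, (k : ℤ)),
      (0, -(k : ℤ))} : Set (ℤ × ℤ)), x + y ∈ V ∧ κ ≤ killed p b Set.univ {x + y} n₀ x)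
    {α : ℝ} (hα0 : 0 < α) (hαπ : α ≤ Real.pi) {x : ℤ × ℤ} (hx : x ∈ V) :
    ∃ N, killed p b (Wset b α) (Wset b α) N x < 1 := by
  have hleft : ∀ x ∈ V, x + (-(k : ℤ), 0) ∈ V ∧
      κ ≤ killed p b Set.univ {x + (-(k : ℤ), 0)} n₀ x := fun x hx => hV x hx _ (by simp)
  have hout : ∀ x ∈ V, x ∉ Wset b α → ∃ N, killed p b (Wset b α) (Wset b α) N x < 1 :=
    fun x _ h => ⟨0, by rw [killed_of_notMem _ h]; exact one_pos⟩
  rcases hαπ.lt_or_eq with hα | rfl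
  · obtain ⟨m, hm⟩ := exists_add_nsmul_notMem_Wset (b := b) hα0 hα hk x
    exact exists_killed_lt_one_of_add_nsmul hpmf hA2 hκ hleft hout m hx hm
  have hcross : ∀ s : ℤ, s = 1 ∨ s = -1 → ∀ x ∈ V, (x.1 : ℝ) ≤ -(n₀ * b) → 0 < s * x.2 →
      ∃ N, killed p b (Wset b Real.pi) (Wset b Real.pi) N x < 1 := by
    intro s hs x hx hx1 hx2
    have hv : ((0, -s * k) : ℤ × ℤ) ∈ ({((k : ℤ), (0 : ℤ)), (-(k : ℤ), 0), (0, (k : ℤ)),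
      (0, -(k : ℤ))} : Set (ℤ × ℤ)) := by
      rcases hs with rfl | rfl <;> simp
    have hs2 : s * s = 1 := by rcases hs with rfl | rfl <;> norm_num
    have hk0 : (0 : ℤ) < k := by exact_mod_cast hk
    refine exists_killed_lt_one_of_add_nsmul hpmf hA2 hκ (fun x hx => hV x hx _ hv)
      (Q := fun x => (x.1 : ℝ) ≤ -(n₀ * b) ∧ 0 < s * x.2 ∧ s * x.2 ≤ k) ?_
      ((s * x.2 - 1) / k).toNat hx ?_
    · rintro x hx ⟨hx1, hx2, hx3⟩
      refine ⟨n₀, ?_⟩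
      have h := killed_add_killed_le_one hpmf hA2 hb (s := s) (by exact_mod_cast hs)
        (z := x + (0, -s * k)) ?_ n₀ hx1 (by exact_mod_cast hx2)
      · linarith [(hV x hx _ hv).2]
      · have : s * (x + (0, -s * k)).2 ≤ 0 := by
          simp only [Prod.snd_add]
          calc s * (x.2 + -s * k) = s * x.2 - s * s * k := by ring
            _ ≤ 0 := by rw [hs2]; linarith
        exact_mod_cast this
    · have h0 : 0 ≤ (s * x.2 - 1) / k := Int.ediv_nonneg (by linarith) hk0.le
      have h1 := Int.mul_ediv_add_emod (s * x.2 - 1) k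
      have h2 := Int.emod_nonneg (s * x.2 - 1) hk0.ne'
      have h3 := Int.emod_lt_of_pos (s * x.2 - 1) hk0
      have h4 : s * (x + ((s * x.2 - 1) / k).toNat • ((0, -s * k) : ℤ × ℤ)).2 =
          s * x.2 - k * ((s * x.2 - 1) / k) := by
        rw [Prod.snd_add, Prod.smul_snd, nsmul_eq_mul, Int.toNat_of_nonneg h0]
        calc _ = s * x.2 - s * s * (k * ((s * x.2 - 1) / k)) := by ring
          _ = _ := by rw [hs2, one_mul]
      refine ⟨by simpa using hx1, ?_, ?_⟩
      · rw [h4]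
        linarith
      · rw [h4]
        linarith
  obtain ⟨m, hm⟩ := exists_nat_ge (x.1 + n₀ * b)
  refine exists_killed_lt_one_of_add_nsmul hpmf hA2 hκ hleft
    (Q := fun x => (x.1 : ℝ) ≤ -(n₀ * b)) ?_ m hx ?_
  · intro x hx hx1
    rcases lt_trichotomy x.2 0 with h | h | h
    · exact hcross (-1) (Or.inr rfl) x hx hx1 (by linarith)
    · refine hout x hx ?_
      rintro (⟨h', -⟩ | ⟨-, h'⟩)
      · exact absurd h' (lt_irrefl _)
      · exact h' ⟨hx1.trans (neg_nonpos.2 (by positivity)), by simpa [h] using hb.le⟩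
    · exact hcross 1 (Or.inl rfl) x hx hx1 (by linarith)
  · have hk1 : (1 : ℝ) ≤ k := by exact_mod_cast hk
    rw [Prod.fst_add, Prod.smul_fst, nsmul_eq_mul]
    push_cast
    nlinarith [m.cast_nonneg (α := ℝ)]

end isotropy

end survival

section lyapunov

variable {p : ℤ × ℤ → ℤ × ℤ → ℝ} {b : ℝ}

lemma exists_uniform_killed_le (hpmf : IsJumpPMF p) (hA2 : A2 p b) {D B : Set (ℤ × ℤ)}
    (hB : B.Finite) (h : ∀ x ∈ B, ∃ N, killed p b D D N x < 1) :
    ∃ N, ∃ δ > 0, ∀ x ∈ B, killed p b D D N x ≤ 1 - δ := by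
  induction B, hB using Set.Finite.induction_on with
  | empty => exact ⟨0, 1, one_pos, by simp⟩
  | @insert a s _ _ ih =>
    obtain ⟨N, δ, hδ, hN⟩ := ih fun x hx => h x (Set.mem_insert_of_mem a hx)
    obtain ⟨M, hM⟩ := h a (Set.mem_insert a s)
    refine ⟨max N M, min δ (1 - killed p b D D M a), lt_min hδ (by linarith), ?_⟩
    rintro x (rfl | hx)
    · have h1 := killed_antitone (D := D) hpmf hA2 x (le_max_right N M)
      simp only at h1
      linarith [min_le_right δ (1 - killed p b D D M x)]
    · have h1 := killed_antitone (D := D) hpmf hA2 x (le_max_left N M)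
      simp only at h1
      linarith [hN x hx, min_le_left δ (1 - killed p b D D M a)]

lemma killed_wedge_tail (hpmf : IsJumpPMF p) (hb : 0 < b) (hA2 : A2 p b) {S V : Set (ℤ × ℤ)}
    (hVS : V ⊆ S) (hV : ∀ x ∈ V, ∀ y, 0 < p x y → x + y ∈ V)
    {κ : ℝ} {k n₀ : ℕ} (hκ : 0 < κ) (hk : 0 < k)
    (hiso : ∀ x ∈ V, ∀ y ∈ ({((k : ℤ), (0 : ℤ)), (-(k : ℤ), 0), (0, (k : ℤ)),
      (0, -(k : ℤ))} : Set (ℤ × ℤ)), x + y ∈ V ∧ κ ≤ killed p b Set.univ {x + y} n₀ x)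
    {σ2 : ℝ} (hσ : 0 < σ2)
    (hsub2 : ∀ ε : ℝ, 0 < ε → ∃ r₁ : ℝ, ∀ x ∈ S, r₁ ≤ znorm x →
      znorm x * muNorm p x ≤ ε ∧ |M11 p x - σ2| ≤ ε ∧ |M22 p x - σ2| ≤ ε ∧ |M12 p x| ≤ ε)
    {α : ℝ} (hα0 : 0 < α) (hαπ : α ≤ Real.pi) {m : ℝ} (hm : 0 < m)
    (hmα : m < Real.pi / (4 * α)) {x : ℤ × ℤ} (hx : x ∈ V) :
    ∃ A, ∀ T : ℕ, (T : ℝ) ^ m * killed p b (Wset b α) (Wset b α) T x ≤ A := by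
  obtain ⟨v, hwv, hvα⟩ : ∃ v, 2 * m < v ∧ v * α < Real.pi / 2 := by
    have h : 2 * m < Real.pi / (2 * α) := by
      have : Real.pi / (2 * α) = 2 * (Real.pi / (4 * α)) := by
        field_simp
        norm_num
      linarith
    obtain ⟨v, h1, h2⟩ := exists_between h
    refine ⟨v, h1, ?_⟩
    rw [lt_div_iff₀ (by positivity)] at h2
    linarith
  have hw : 0 < 2 * m := by positivity
  have hv : 0 < v := hw.trans hwv
  obtain ⟨R₀, -, q, hq, hdrift⟩ := wedgeFun_drift hpmf hb hA2 hσ hsub2 hα0 hαπ hw hwv hvα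
  set D := Wset b α with hD
  set f := wedgeFun b α (2 * m) v with hf
  set R := max R₀ 1 with hR
  have hR1 : 1 ≤ R := le_max_right _ _
  have hf0 : ∀ z, 0 ≤ f z := wedgeFun_nonneg hb hα0 hv.le hvα
  obtain ⟨N, δ, hδ, hN⟩ := exists_uniform_killed_le (D := D) (B := {z | znorm z ≤ R} ∩ V)
    hpmf hA2 ((finite_znorm_le R).inter_of_left V) fun z hz =>
      exists_killed_lt_one hpmf hA2 hb hκ hk hiso hα0 hαπ hz.2
  set ψ : ℤ × ℤ → ℝ := fun z => ∑ j ∈ Finset.range (N + 1), killed p b D D j z with hψ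
  have hψ0 : ∀ z, 0 ≤ ψ z := fun z => Finset.sum_nonneg fun j _ => killed_nonneg hpmf j z
  have hψN : ∀ z, ψ z ≤ N + 1 := fun z => by
    simpa using Finset.sum_le_card_nsmul (Finset.range (N + 1)) _ 1
      fun j _ => killed_le_one (D := D) (E := D) hpmf hA2 j z
  have hψ1 : ∀ z ∈ D, 1 ≤ ψ z := fun z hz => by
    have h := Finset.single_le_sum (f := fun j => killed p b D D j z)
      (fun j _ => killed_nonneg hpmf j z) (Finset.mem_range.2 N.succ_pos)
    simpa only [killed_zero, Set.indicator_of_mem hz, Pi.one_apply] using h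
  set C₁ := (R + b) ^ (2 * m) with hC₁
  set L := max 1 ((C₁ + 1) / δ) with hL
  have hL1 : 1 ≤ L := le_max_left _ _
  have hLδ : C₁ + 1 ≤ L * δ := by
    rw [← div_le_iff₀ hδ]
    exact le_max_right _ _
  set g : ℤ × ℤ → ℝ := fun z => f z + L * ψ z with hg
  have hg1 : ∀ z ∈ D, 1 ≤ g z := fun z hz => by
    have := hf0 z
    have := hψ1 z hz
    simp only [hg]
    nlinarith
  set c₀ := Real.cos (v * α) with hc₀
  have hc₀pos : 0 < c₀ := Real.cos_pos_of_mem_Ioo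
    ⟨by linarith [Real.pi_pos, mul_pos hv hα0], hvα⟩
  set C₂ := R ^ (2 * m) + L * (N + 1) with hC₂
  set C₃ := 1 + L * (N + 1) with hC₃
  have hC₂pos : 0 < C₂ := by positivity
  have hC₃pos : 0 < C₃ := by positivity
  set q' := min (1 / C₂) (q / (C₃ * c₀ ^ (-(1 / m)))) with hq'
  have hq'0 : 0 < q' := by positivity
  have hstepg : ∀ z ∈ D,
      step p b g z = step p b f z + L * (ψ z - (1 - killed p b D D (N + 1) z)) := by
    intro z hz
    rw [hg, step_add, step_const_mul, hψ, step_sum_killed _ hz]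
  suffices hdriftg : ∀ z ∈ V, z ∈ D → step p b g z ≤ g z * (1 - q' * g z ^ (-(1 / m))) by
    obtain ⟨A, hA⟩ := killed_tail (D := D) hpmf hA2 hV
      (fun z => add_nonneg (hf0 z) (mul_nonneg (by linarith) (hψ0 z))) hg1 hm hq'0 hdriftg
    exact ⟨A * g x, fun T => hA T x hx⟩
  intro z hzV hzD
  have hgz := hg1 z hzD
  have hr := znorm_pos hb hzD
  have hψLN : L * ψ z ≤ L * (N + 1) := by
    have := hψN z
    gcongr
  rw [hstepg z hzD, mul_sub L, mul_sub (g z), mul_one]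
  have hkill : 1 - killed p b D D (N + 1) z ≥ 1 - killed p b D D N z := by
    have := killed_antitone (D := D) hpmf hA2 z N.le_succ
    simp only [Nat.succ_eq_add_one] at this
    linarith
  rcases le_or_gt (znorm z) R with hzR | hzR
  · have h1 : step p b f z ≤ C₁ := by
      refine (step_mono hpmf (g := fun _ => C₁) fun y hy _ => ?_).trans_eq
        (step_const hpmf hA2 C₁ z)
      refine (wedgeFun_le _).trans (Real.rpow_le_rpow (znorm_nonneg _) ?_ hw.le)
      linarith [znorm_add_le z y, mem_jumps.1 hy]
    have h2 : L * δ ≤ L * (1 - killed p b D D (N + 1) z) := by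
      have := hN z ⟨hzR, hzV⟩
      gcongr
      linarith
    have h3 : g z ≤ C₂ := by
      have : f z ≤ R ^ (2 * m) :=
        (wedgeFun_le z).trans (Real.rpow_le_rpow (znorm_nonneg _) hzR hw.le)
      simp only [hg, hC₂]
      linarith
    have h4 : g z ^ (-(1 / m)) ≤ 1 :=
      Real.rpow_le_one_of_one_le_of_nonpos hgz (neg_nonpos.2 (by positivity))
    have h5 : g z * (q' * g z ^ (-(1 / m))) ≤ 1 := by
      calc g z * (q' * g z ^ (-(1 / m))) ≤ C₂ * (1 / C₂ * 1) := by
            gcongr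
            exact min_le_left _ _
        _ = 1 := by field_simp
    have h6 : g z = f z + L * ψ z := rfl
    have := hf0 z
    linarith
  · have h1 := hdrift z (hVS hzV) hzD ((le_max_left R₀ 1).trans hzR.le)
    have h2 : 0 ≤ L * (1 - killed p b D D (N + 1) z) := mul_nonneg (by linarith)
      (by linarith [killed_le_one (D := D) (E := D) hpmf hA2 (N + 1) z])
    have hr1 : 1 ≤ znorm z ^ (2 * m) := Real.one_le_rpow (hR1.trans hzR.le) hw.le
    have h3 : g z ≤ C₃ * znorm z ^ (2 * m) := by
      have h : f z ≤ znorm z ^ (2 * m) := wedgeFun_le z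
      have h' : L * (N + 1) ≤ L * (N + 1) * znorm z ^ (2 * m) :=
        le_mul_of_one_le_right (by positivity) hr1
      simp only [hg, hC₃]
      linarith
    have h4 : g z ^ (-(1 / m)) ≤ c₀ ^ (-(1 / m)) / znorm z ^ 2 := by
      have h : c₀ * znorm z ^ (2 * m) ≤ g z := by
        have : c₀ * znorm z ^ (2 * m) ≤ f z := le_wedgeFun hb hα0 hv.le hvα hzD
        have h' : 0 ≤ L * ψ z := mul_nonneg (by linarith) (hψ0 z)
        simp only [hg]
        linarith
      refine (Real.rpow_le_rpow_of_nonpos (by positivity) h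
        (neg_nonpos.2 (by positivity))).trans_eq ?_
      rw [Real.mul_rpow hc₀pos.le (by positivity), ← Real.rpow_mul hr.le,
        show 2 * m * -(1 / m) = -(2 : ℕ) by field_simp; norm_num, Real.rpow_neg hr.le,
        Real.rpow_natCast, ← div_eq_mul_inv]
    have h5 : g z * (q' * g z ^ (-(1 / m))) ≤ q * (znorm z ^ (2 * m) / znorm z ^ 2) := by
      calc g z * (q' * g z ^ (-(1 / m))) ≤ C₃ * znorm z ^ (2 * m) *
            (q / (C₃ * c₀ ^ (-(1 / m))) * (c₀ ^ (-(1 / m)) / znorm z ^ 2)) := by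
            gcongr
            exact min_le_right _ _
        _ = q * (znorm z ^ (2 * m) / znorm z ^ 2) := by field_simp
    have h6 : g z = f z + L * ψ z := rfl
    linarith

end lyapunov

section chain

variable {Ω : Type*} {ξ : ℕ → Ω → ℤ × ℤ} {p : ℤ × ℤ → ℤ × ℤ → ℝ} {b : ℝ}

/-- The σ-algebra generated by the chain up to time `t`. -/
abbrev past (ξ : ℕ → Ω → ℤ × ℤ) (t : ℕ) : MeasurableSpace Ω :=
  ⨆ s ∈ Finset.range (t + 1), MeasurableSpace.comap (ξ s) ⊤

lemma past_mono : Monotone (past ξ) := fun _ _ h =>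
  biSup_mono fun _ hs => Finset.mem_range.2 ((Finset.mem_range.1 hs).trans_le (by omega))

lemma measurableSet_past_eq (t : ℕ) (x : ℤ × ℤ) :
    MeasurableSet[past ξ t] {ω | ξ t ω = x} :=
  (le_biSup (fun s => MeasurableSpace.comap (ξ s) ⊤) (Finset.self_mem_range_succ t)) _
    ⟨{x}, trivial, rfl⟩

variable [MeasurableSpace Ω] {P : Measure Ω}

lemma past_le (hmeas : ∀ t, Measurable (ξ t)) (t : ℕ) :
    past ξ t ≤ (inferInstance : MeasurableSpace Ω) :=
  iSup₂_le fun s _ => by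
    rintro _ ⟨F, -, rfl⟩
    exact hmeas s F.to_countable.measurableSet

lemma measureReal_step (hpmf : IsJumpPMF p) (hMarkov : IsMarkovWith P ξ p) (t : ℕ) (x y : ℤ × ℤ)
    {A : Set Ω} (hA : MeasurableSet[past ξ t] A) :
    P.real (A ∩ {ω | ξ t ω = x} ∩ {ω | ξ (t + 1) ω = x + y}) =
      p x y * P.real (A ∩ {ω | ξ t ω = x}) := by
  rw [measureReal_def, hMarkov t x y A hA, ENNReal.toReal_mul,
    ENNReal.toReal_ofReal (hpmf.1 x y), measureReal_def]

variable [IsProbabilityMeasure P]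

/-- An event on which the chain is at `x` at time `t` splits along its next jump. -/
lemma measureReal_eq_sum_jumps (hmeas : ∀ t, Measurable (ξ t))
    (hMarkov : IsMarkovWith P ξ p) (hA2 : A2 p b) {t : ℕ} {x : ℤ × ℤ} {B : Set Ω}
    (hB : MeasurableSet B) (hBx : B ⊆ {ω | ξ t ω = x}) :
    P.real B = ∑ y ∈ jumps b, P.real (B ∩ {ω | ξ (t + 1) ω = x + y}) := by
  have hm : ∀ y, MeasurableSet {ω | ξ (t + 1) ω = x + y} := fun y =>
    hmeas (t + 1) (measurableSet_singleton _)
  rw [← measureReal_biUnion_finset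
    (fun y _ z _ hyz => Set.disjoint_left.2 fun ω h1 h2 =>
      hyz (add_left_cancel (h1.2.symm.trans h2.2))) fun y _ => hB.inter (hm y)]
  refine measureReal_congr ((Filter.EventuallyLE.antisymm ?_ ?_))
  · have h0 : ∀ y, ¬ znorm y ≤ b → ∀ᵐ ω ∂P, ¬ (ξ t ω = x ∧ ξ (t + 1) ω = x + y) := by
      intro y hy
      have := hMarkov t x y Set.univ MeasurableSet.univ
      rw [hA2 x y (not_le.1 hy), ENNReal.ofReal_zero, zero_mul, Set.univ_inter] at this
      exact measure_eq_zero_iff_ae_notMem.1 this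
    have h1 : ∀ᵐ ω ∂P, ∀ y, ¬ znorm y ≤ b → ¬ (ξ t ω = x ∧ ξ (t + 1) ω = x + y) := by
      rw [ae_all_iff]
      intro y
      by_cases hy : znorm y ≤ b
      · exact Filter.Eventually.of_forall fun _ h => absurd hy h
      · filter_upwards [h0 y hy] with ω hω _ using hω
    filter_upwards [h1] with ω hω hωB
    have hx : ξ (t + 1) ω = x + (ξ (t + 1) ω - x) := by abel
    refine Set.mem_iUnion₂.2 ⟨ξ (t + 1) ω - x, mem_jumps.2 ?_, hωB, hx⟩
    by_contra hc
    exact hω _ hc ⟨hBx hωB, hx⟩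
  · exact Filter.Eventually.of_forall
      (Set.iUnion₂_subset fun _ _ => Set.inter_subset_left : _ ⊆ B)

lemma measureReal_path (hmeas : ∀ t, Measurable (ξ t)) (hpmf : IsJumpPMF p)
    (hMarkov : IsMarkovWith P ξ p) (hA2 : A2 p b) (D E : Set (ℤ × ℤ)) (n t : ℕ) (x : ℤ × ℤ)
    {A : Set Ω} (hA : MeasurableSet[past ξ t] A) :
    P.real (A ∩ {ω | ξ t ω = x} ∩ {ω | (∀ j < n, ξ (t + j) ω ∈ D) ∧ ξ (t + n) ω ∈ E}) =
      killed p b D E n x * P.real (A ∩ {ω | ξ t ω = x}) := by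
  induction n generalizing t x A with
  | zero =>
    rw [killed_zero]
    by_cases hx : x ∈ E
    · rw [Set.indicator_of_mem hx, Pi.one_apply, one_mul]
      congr 1
      ext ω
      simp only [Set.mem_inter_iff, Set.mem_ofPred_eq, not_lt_zero, IsEmpty.forall_iff,
        implies_true, true_and, add_zero, and_iff_left_iff_imp, and_imp]
      rintro - rfl
      exact hx
    · rw [Set.indicator_of_notMem hx, zero_mul]
      refine (congrArg P.real (Set.eq_empty_of_forall_notMem ?_)).trans measureReal_empty
      rintro ω ⟨⟨-, rfl⟩, -, h⟩
      exact hx h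
  | succ n ih =>
    by_cases hx : x ∈ D
    · rw [killed_succ_of_mem n hx]
      have hA' : MeasurableSet[past ξ (t + 1)] (A ∩ {ω | ξ t ω = x}) :=
        past_mono t.le_succ _ (MeasurableSet.inter hA (measurableSet_past_eq t x))
      have hset : A ∩ {ω | ξ t ω = x} ∩
          {ω | (∀ j < n + 1, ξ (t + j) ω ∈ D) ∧ ξ (t + (n + 1)) ω ∈ E} =
          A ∩ {ω | ξ t ω = x} ∩
          {ω | (∀ j < n, ξ (t + 1 + j) ω ∈ D) ∧ ξ (t + 1 + n) ω ∈ E} := by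
        ext ω
        simp only [Set.mem_inter_iff, Set.mem_ofPred_eq]
        refine and_congr_right fun h => ?_
        rw [Nat.forall_lt_succ_left]
        simp only [add_zero, h.2, hx, true_and, add_assoc, add_comm 1]
      rw [hset, measureReal_eq_sum_jumps hmeas hMarkov hA2 (t := t) (x := x) ?_
        (fun ω h => h.1.2), step, Finset.sum_mul]
      · refine Finset.sum_congr rfl fun y _ => ?_
        rw [Set.inter_right_comm, ih (t + 1) (x + y) hA', measureReal_step hpmf hMarkov t x y hA]
        ring
      · refine (past_le hmeas _ _ hA').inter ?_
        have hm : ∀ (s : ℕ) (F : Set (ℤ × ℤ)), MeasurableSet {ω | ξ s ω ∈ F} := fun s F =>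
          hmeas s F.to_countable.measurableSet
        simp only [Set.ofPred_and, Set.ofPred_forall]
        exact (MeasurableSet.iInter fun j => MeasurableSet.iInter fun _ => hm _ D).inter (hm _ E)
    · rw [show killed p b D E (n + 1) x = 0 from Set.indicator_of_notMem hx _, zero_mul]
      refine (congrArg P.real (Set.eq_empty_of_forall_notMem ?_)).trans measureReal_empty
      rintro ω ⟨⟨-, rfl⟩, h, -⟩
      exact hx (by simpa using h 0 n.succ_pos)

/-- The points visited by the chain with positive probability. -/
def visited (P : Measure Ω) (ξ : ℕ → Ω → ℤ × ℤ) : Set (ℤ × ℤ) :=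
  {x | ∃ t, 0 < P.real {ω | ξ t ω = x}}

lemma visited_subset {S : Set (ℤ × ℤ)} (hinS : ∀ t, ∀ᵐ ω ∂P, ξ t ω ∈ S) :
    visited P ξ ⊆ S := by
  rintro x ⟨t, ht⟩
  by_contra hx
  refine ht.ne' ((measureReal_eq_zero_iff).2 (measure_eq_zero_iff_ae_notMem.2 ?_))
  filter_upwards [hinS t] with ω hω h
  exact hx (h ▸ hω)

lemma add_mem_visited (hpmf : IsJumpPMF p) (hMarkov : IsMarkovWith P ξ p) {x : ℤ × ℤ}
    (hx : x ∈ visited P ξ) (y : ℤ × ℤ) (hy : 0 < p x y) : x + y ∈ visited P ξ := by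
  obtain ⟨t, ht⟩ := hx
  have h := measureReal_step hpmf hMarkov t x y MeasurableSet.univ
  rw [Set.univ_inter] at h
  exact ⟨t + 1, (mul_pos hy ht).trans_le
    (h.symm.trans_le (measureReal_mono Set.inter_subset_right))⟩

lemma isotropy_visited (hmeas : ∀ t, Measurable (ξ t)) (hpmf : IsJumpPMF p)
    (hMarkov : IsMarkovWith P ξ p) (hA2 : A2 p b) {S : Set (ℤ × ℤ)}
    (hinS : ∀ t, ∀ᵐ ω ∂P, ξ t ω ∈ S) {κ : ℝ} {k n₀ : ℕ} (hκ : 0 < κ)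
    (hA1 : A1 P S ξ κ k n₀) {x : ℤ × ℤ} (hx : x ∈ visited P ξ) {y : ℤ × ℤ}
    (hy : y ∈ ({((k : ℤ), (0 : ℤ)), (-(k : ℤ), 0), (0, (k : ℤ)), (0, -(k : ℤ))} :
      Set (ℤ × ℤ))) :
    x + y ∈ visited P ξ ∧ κ ≤ killed p b Set.univ {x + y} n₀ x := by
  have hxS := visited_subset hinS hx
  obtain ⟨t, ht⟩ := hx
  have h := ENNReal.toReal_mono (measure_ne_top P _) (hA1 t x hxS y hy)
  rw [ENNReal.toReal_mul, ENNReal.toReal_ofReal hκ.le, ← measureReal_def, ← measureReal_def] at h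
  refine ⟨⟨t + n₀, (mul_pos hκ ht).trans_le
    (h.trans (measureReal_mono Set.inter_subset_right))⟩, ?_⟩
  have h' := measureReal_path hmeas hpmf hMarkov hA2 Set.univ {x + y} n₀ t x
    (A := Set.univ) MeasurableSet.univ
  simp only [Set.univ_inter, Set.mem_univ, implies_true, true_and,
    Set.mem_singleton_iff] at h'
  exact le_of_mul_le_mul_right (h.trans_eq h') ht

end chain

section moments

variable {Ω : Type*}

lemma mem_of_lt_exitTime {ξ : ℕ → Ω → ℤ × ℤ} {D : Set (ℤ × ℤ)} {ω : Ω} {n : ℕ}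
    (h : (n : ℝ≥0∞) < exitTime D ξ ω) {j : ℕ} (hj : j ≤ n) : ξ j ω ∈ D := by
  by_contra hc
  exact absurd (h.trans_le (iInf₂_le j hc)) (not_lt.2 (Nat.cast_le.2 hj))

/-- Dyadic upper bound for a power of an extended nonnegative number. -/
lemma rpow_le_one_add_tsum {s : ℝ} (hs : 0 ≤ s) (τ : ℝ≥0∞) :
    τ ^ s ≤ 1 + ∑' j : ℕ, {j : ℕ | ((2 ^ j : ℕ) : ℝ≥0∞) < τ}.indicator
      (fun j => ((2 ^ (j + 1) : ℕ) : ℝ≥0∞) ^ s) j := by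
  rcases le_or_gt τ 1 with h1 | h1
  · exact (ENNReal.rpow_le_one h1 hs).trans le_self_add
  refine le_trans ?_ le_add_self
  by_cases hτ : τ = ⊤
  · refine le_top.trans_eq (Eq.symm (top_le_iff.1 ?_))
    calc (⊤ : ℝ≥0∞) = ∑' _ : ℕ, 1 := (ENNReal.tsum_const_eq_top_of_ne_zero one_ne_zero).symm
      _ ≤ _ := ENNReal.tsum_le_tsum fun j => by
        rw [Set.indicator_of_mem (by simp [hτ] : j ∈ _)]
        exact (ENNReal.one_rpow s).symm.trans_le
          (ENNReal.rpow_le_rpow (by exact_mod_cast Nat.one_le_two_pow) hs)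
  · have hex : ∃ j : ℕ, τ ≤ ((2 ^ j : ℕ) : ℝ≥0∞) := by
      obtain ⟨n, hn⟩ := ENNReal.exists_nat_gt hτ
      exact ⟨n, hn.le.trans (Nat.cast_le.2 n.lt_two_pow_self.le)⟩
    classical
    obtain ⟨i, hi⟩ : ∃ i, Nat.find hex = i + 1 := by
      refine Nat.exists_eq_succ_of_ne_zero fun h => ?_
      have := Nat.find_spec hex
      rw [h] at this
      simp only [pow_zero, Nat.cast_one] at this
      exact absurd h1 (not_lt.2 this)
    have hmem : i ∈ {j : ℕ | ((2 ^ j : ℕ) : ℝ≥0∞) < τ} :=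
      not_le.1 (Nat.find_min hex (by omega))
    refine le_trans ?_ (ENNReal.le_tsum i)
    rw [Set.indicator_of_mem hmem, ← hi]
    exact ENNReal.rpow_le_rpow (Nat.find_spec hex) hs

lemma lintegral_rpow_lt_top [MeasurableSpace Ω] {μ : Measure Ω} [IsFiniteMeasure μ]
    {τ : Ω → ℝ≥0∞} {F : ℕ → Set Ω}
    (hF : ∀ n, MeasurableSet (F n)) (hτF : ∀ (n : ℕ) ω, (n : ℝ≥0∞) < τ ω → ω ∈ F n)
    {s m A : ℝ} (hs : 0 ≤ s) (hsm : s < m) (hA : ∀ n : ℕ, (n : ℝ) ^ m * μ.real (F n) ≤ A) :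
    ∫⁻ ω, τ ω ^ s ∂μ < ⊤ := by
  set c : ℕ → ℝ≥0∞ := fun j => ((2 ^ (j + 1) : ℕ) : ℝ≥0∞) ^ s with hc
  set r : ℝ := 2 ^ (s - m) with hr
  have hr0 : 0 < r := Real.rpow_pos_of_pos two_pos _
  have hr1 : r < 1 := Real.rpow_lt_one_of_one_lt_of_neg one_lt_two (by linarith)
  have hterm : ∀ j : ℕ, c j * μ (F (2 ^ j)) ≤ ENNReal.ofReal (A * 2 ^ s * r ^ j) := by
    intro j
    have h2 : (0 : ℝ) < ((2 ^ j : ℕ) : ℝ) ^ m := by positivity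
    have hcj : c j = ENNReal.ofReal (((2 ^ (j + 1) : ℕ) : ℝ) ^ s) := by
      rw [← ENNReal.ofReal_rpow_of_nonneg (by positivity) hs, ENNReal.ofReal_natCast]
    have hFj : μ (F (2 ^ j)) = ENNReal.ofReal (μ.real (F (2 ^ j))) :=
      (ofReal_measureReal).symm
    rw [hcj, hFj, ← ENNReal.ofReal_mul (by positivity)]
    refine ENNReal.ofReal_le_ofReal ?_
    have hle : μ.real (F (2 ^ j)) ≤ A / ((2 ^ j : ℕ) : ℝ) ^ m := by
      rw [le_div_iff₀ h2, mul_comm]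
      exact hA _
    refine (mul_le_mul_of_nonneg_left hle (by positivity)).trans_eq ?_
    have e1 : ((2 ^ (j + 1) : ℕ) : ℝ) ^ s = ((2 : ℝ) ^ s) ^ j * 2 ^ s := by
      push_cast
      rw [← Real.rpow_natCast, ← Real.rpow_mul two_pos.le, mul_comm, Real.rpow_mul two_pos.le,
        Real.rpow_natCast, pow_succ]
    have e2 : ((2 ^ j : ℕ) : ℝ) ^ m = ((2 : ℝ) ^ m) ^ j := by
      push_cast
      rw [← Real.rpow_natCast, ← Real.rpow_mul two_pos.le, mul_comm, Real.rpow_mul two_pos.le,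
        Real.rpow_natCast]
    rw [e1, e2, hr, Real.rpow_sub two_pos, div_pow]
    ring
  have hle : ∀ ω, τ ω ^ s ≤ 1 + ∑' j : ℕ, (F (2 ^ j)).indicator (fun _ => c j) ω := by
    intro ω
    refine (rpow_le_one_add_tsum hs (τ ω)).trans ?_
    gcongr with j
    refine Set.indicator_apply_le' (fun h => ?_) fun _ => zero_le
    rw [Set.indicator_of_mem (hτF _ _ h)]
  calc ∫⁻ ω, τ ω ^ s ∂μ ≤ ∫⁻ ω, 1 + ∑' j : ℕ, (F (2 ^ j)).indicator (fun _ => c j) ω ∂μ :=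
        lintegral_mono hle
    _ = μ Set.univ + ∑' j : ℕ, c j * μ (F (2 ^ j)) := by
        rw [lintegral_add_left measurable_const, lintegral_one, lintegral_tsum
          fun j => (measurable_const.indicator (hF _)).aemeasurable]
        simp only [lintegral_indicator_const (hF _)]
    _ ≤ μ Set.univ + ∑' j : ℕ, ENNReal.ofReal (A * 2 ^ s * r ^ j) := by
        gcongr with j
        exact hterm j
    _ < ⊤ := by
        refine ENNReal.add_lt_top.2 ⟨measure_lt_top μ _, ?_⟩
        exact ((summable_geometric_of_lt_one hr0.le hr1).mul_left _).tsum_ofReal_lt_top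

end moments

end WedgeExit

/-- Theorem 2.4(i): under (A1), (A2) and (sub2), for `α ∈ (0,π]`
and `0 ≤ s < π/(4α)`, `E[τ_α^s ∣ ξ₀ = x] < ∞` for every `x ∈ W(α)`. -/
theorem exit_time_moments_subcritical_finite
    {Ω : Type*} [MeasurableSpace Ω] (P : Measure Ω) [IsProbabilityMeasure P]
    (S : Set (ℤ × ℤ)) (hSunb : ∀ R : ℝ, ∃ x ∈ S, R < znorm x)
    (ξ : ℕ → Ω → ℤ × ℤ) (hmeas : ∀ t, Measurable (ξ t))
    (hinS : ∀ t, ∀ᵐ ω ∂P, ξ t ω ∈ S)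
    (p : ℤ × ℤ → ℤ × ℤ → ℝ) (hpmf : IsJumpPMF p)
    (hMarkov : IsMarkovWith P ξ p)
    (κ : ℝ) (k n₀ : ℕ) (hκ : 0 < κ) (hk : 0 < k) (hn₀ : 0 < n₀)
    (hA1 : A1 P S ξ κ k n₀)
    (b : ℝ) (hb : 0 < b) (hA2 : A2 p b)
    (σ2 : ℝ) (hσ : 0 < σ2)
    (hsub2 : ∀ ε : ℝ, 0 < ε → ∃ r₁ : ℝ, ∀ x ∈ S, r₁ ≤ znorm x →
      znorm x * muNorm p x ≤ ε ∧ |M11 p x - σ2| ≤ ε ∧ |M22 p x - σ2| ≤ ε ∧ |M12 p x| ≤ ε)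
    (α : ℝ) (hα0 : 0 < α) (hαπ : α ≤ Real.pi) :
    ∀ s : ℝ, 0 ≤ s → s < Real.pi / (4 * α) → ∀ x ∈ Wset b α,
      ∫⁻ ω in {ω | ξ 0 ω = x}, exitTime (Wset b α) ξ ω ^ s ∂P < ⊤ := by
  intro s hs hsα x hx
  obtain ⟨m, hsm, hmα⟩ := exists_between hsα
  have hm : 0 < m := hs.trans_lt hsm
  rcases (measureReal_nonneg (μ := P) (s := {ω | ξ 0 ω = x})).eq_or_lt with h0 | h0
  · rw [Measure.restrict_eq_zero.2 ((measureReal_eq_zero_iff).1 h0.symm), lintegral_zero_measure]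
    exact ENNReal.zero_lt_top
  obtain ⟨A, hA⟩ := WedgeExit.killed_wedge_tail hpmf hb hA2 (WedgeExit.visited_subset hinS)
    (fun z hz => WedgeExit.add_mem_visited hpmf hMarkov hz) hκ hk
    (fun z hz y hy => WedgeExit.isotropy_visited hmeas hpmf hMarkov hA2 hinS hκ hA1 hz hy)
    hσ hsub2 hα0 hαπ hm hmα (x := x) ⟨0, h0⟩
  have hF : ∀ n : ℕ, MeasurableSet
      {ω | (∀ j < n, ξ (0 + j) ω ∈ Wset b α) ∧ ξ (0 + n) ω ∈ Wset b α} := by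
    intro n
    have hξ : ∀ i, MeasurableSet {ω | ξ i ω ∈ Wset b α} := fun i =>
      hmeas i (Wset b α).to_countable.measurableSet
    simp only [Set.ofPred_and, Set.ofPred_forall]
    exact (MeasurableSet.iInter fun j => MeasurableSet.iInter fun _ => hξ _).inter (hξ _)
  refine WedgeExit.lintegral_rpow_lt_top (m := m) (A := A) hF (fun n ω h => ?_) hs hsm fun n => ?_
  · exact ⟨fun j hj => WedgeExit.mem_of_lt_exitTime h (by omega),
      WedgeExit.mem_of_lt_exitTime h (by omega)⟩
  · have hpath := WedgeExit.measureReal_path hmeas hpmf hMarkov hA2 (Wset b α) (Wset b α) n 0 x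
      (A := Set.univ) MeasurableSet.univ
    rw [Set.univ_inter] at hpath
    rw [measureReal_restrict_apply (hF n), Set.inter_comm, hpath]
    refine le_trans (mul_le_mul_of_nonneg_left (mul_le_of_le_one_right
      (WedgeExit.killed_nonneg hpmf n x) measureReal_le_one) (by positivity)) (hA n)
end

section
/- Suppose (A1), (A2) and (sub2) hold, and let α ∈ (0,π]. If s > π/(4α), then there exists A ∈ (0,∞) such that E[τ_α^s | ξ₀ = x] = ∞ for every x ∈ W(α) with ‖x‖ ≥ A. -/
open MeasureTheory
open scoped ENNReal

theorem one_add_cpow_taylor_two (a : ℂ) : ∃ C : ℝ, 0 < C ∧ ∃ δ : ℝ, 0 < δ ∧ ∀ z : ℂ, ‖z‖ ≤ δ →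
    ‖(1 + z) ^ a - (1 + a * z + a * (a - 1) / 2 * z ^ 2)‖ ≤ C * ‖z‖ ^ 3 := by
  have h := (Complex.one_add_cpow_hasFPowerSeriesAt_zero (a := a)).isBigO_sub_partialSum_pow 3
  obtain ⟨C, hC, h⟩ := h.exists_pos
  have h2 := h.bound
  rw [Metric.eventually_nhds_iff] at h2
  obtain ⟨δ, hδ, h2⟩ := h2
  refine ⟨C, hC, δ / 2, by positivity, fun z hz => ?_⟩
  have h3 := h2 (y := z) (by rw [dist_zero_right]; linarith)
  have hch : Ring.choose a 2 = a * (a - 1) / 2 := by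
    have := Ring.descPochhammer_eq_factorial_smul_choose a 2
    simp [descPochhammer_succ_right, Polynomial.smeval_mul, Polynomial.smeval_sub,
      Polynomial.smeval_X, Nat.factorial] at this
    rw [this]; ring
  have hco (n : ℕ) : (binomialSeries ℂ a).coeff n = Ring.choose a n := by
    rw [FormalMultilinearSeries.coeff, binomialSeries_apply, show (1 : Fin n → ℂ) = fun _ => 1 from rfl,
      List.ofFn_const]
    simp
  simpa [hco, FormalMultilinearSeries.partialSum, Finset.sum_range_succ, hch, pow_two, add_assoc,
    mul_comm, mul_assoc, mul_left_comm] using h3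

theorem norm_one_add_rpow_taylor_two (w : ℝ) :
    ∃ C : ℝ, 0 < C ∧ ∃ δ : ℝ, 0 < δ ∧ ∀ z : ℂ, ‖z‖ ≤ δ →
    |‖1 + z‖ ^ w - (1 + w * z.re + w / 2 * (w / 2 - 1) * (z ^ 2).re + w ^ 2 / 4 * ‖z‖ ^ 2)|
      ≤ C * ‖z‖ ^ 3 := by
  obtain ⟨C, hC, δ, hδ, h⟩ := one_add_cpow_taylor_two ((w / 2 : ℝ) : ℂ)
  refine ⟨27 * C + 5 * |w / 2 * (w / 2 - 1) / 2|, by positivity, min 1 (δ / 3) / 2,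
    by positivity, fun z hz => ?_⟩
  have hz1 : ‖z‖ ≤ 1 / 2 := hz.trans (by linarith [min_le_left 1 (δ / 3)])
  have hz2 : ‖z‖ ≤ δ / 3 := hz.trans (by linarith [min_le_right 1 (δ / 3), lt_min one_pos (by positivity : 0 < δ / 3)])
  have hn := norm_nonneg z
  have hr : |z.re| ≤ ‖z‖ := Complex.abs_re_le_norm z
  set m := ‖z‖ with hm
  set H : ℝ := 2 * z.re + m ^ 2 with hH
  have hsq : m ^ 2 = z.re ^ 2 + z.im ^ 2 := by
    rw [hm, ← Complex.normSq_eq_norm_sq, Complex.normSq_apply]; ring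
  have hq : ‖1 + z‖ ^ 2 = 1 + H := by
    rw [← Complex.normSq_eq_norm_sq, Complex.normSq_apply, hH, hsq]; simp; ring
  have hq0 : 0 ≤ 1 + H := hq ▸ sq_nonneg _
  have hHabs : |H| ≤ 3 * m := by
    rw [abs_le] at *; constructor <;> nlinarith
  have hpow : ‖1 + z‖ ^ w = (1 + H) ^ (w / 2) := by
    rw [← hq, ← Real.rpow_natCast, ← Real.rpow_mul (norm_nonneg _)]
    congr 1; push_cast; ring
  have key := h (H : ℂ) (by rw [Complex.norm_real, Real.norm_eq_abs]; linarith)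
  have e1 : (1 + (H : ℂ)) ^ ((w / 2 : ℝ) : ℂ) - (1 + ((w / 2 : ℝ) : ℂ) * H +
      ((w / 2 : ℝ) : ℂ) * (((w / 2 : ℝ) : ℂ) - 1) / 2 * (H : ℂ) ^ 2) =
      (((1 + H) ^ (w / 2) - (1 + w / 2 * H + w / 2 * (w / 2 - 1) / 2 * H ^ 2) : ℝ) : ℂ) := by
    push_cast [Complex.ofReal_cpow hq0]; ring
  rw [e1, Complex.norm_real, Complex.norm_real, Real.norm_eq_abs, Real.norm_eq_abs, ← hpow] at key
  have hH3 : |H| ^ 3 ≤ 27 * m ^ 3 := by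
    calc |H| ^ 3 ≤ (3 * m) ^ 3 := by gcongr
      _ = _ := by ring
  have e2 : ‖1 + z‖ ^ w - (1 + w * z.re + w / 2 * (w / 2 - 1) * (z ^ 2).re + w ^ 2 / 4 * m ^ 2)
      = (‖1 + z‖ ^ w - (1 + w / 2 * H + w / 2 * (w / 2 - 1) / 2 * H ^ 2))
        + w / 2 * (w / 2 - 1) / 2 * (4 * z.re * m ^ 2 + m ^ 4) := by
    have : (z ^ 2).re = z.re ^ 2 - z.im ^ 2 := by simp [pow_two]
    have him : z.im ^ 2 = m ^ 2 - z.re ^ 2 := by linarith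
    rw [this, him, hH]; ring
  rw [e2]
  have h5 : |4 * z.re * m ^ 2 + m ^ 4| ≤ 5 * m ^ 3 := by
    have h4 : m ^ 4 ≤ m ^ 3 := pow_le_pow_of_le_one hn (by linarith) (by norm_num)
    have h6 : |z.re| * m ^ 2 ≤ m ^ 3 := by
      calc |z.re| * m ^ 2 ≤ m * m ^ 2 := by gcongr
        _ = _ := by ring
    calc _ ≤ |4 * z.re * m ^ 2| + |m ^ 4| := abs_add_le _ _
      _ = 4 * (|z.re| * m ^ 2) + m ^ 4 := by
        rw [abs_mul, abs_mul, abs_of_nonneg (pow_nonneg hn 2), abs_of_nonneg (pow_nonneg hn 4)]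
        norm_num; ring
      _ ≤ _ := by linarith
  refine (abs_add_le _ _).trans ?_
  rw [abs_mul]
  have := mul_le_mul_of_nonneg_left h5 (abs_nonneg (w / 2 * (w / 2 - 1) / 2))
  nlinarith [mul_le_mul_of_nonneg_left hH3 hC.le]

theorem abs_arg_le_arccos {z : ℂ} {c : ℝ} (hz : z ≠ 0) (h : ‖z‖ * c ≤ z.re) :
    |z.arg| ≤ Real.arccos c := by
  have hn : 0 < ‖z‖ := norm_pos_iff.2 hz
  have h1 : Real.cos |z.arg| = z.re / ‖z‖ := by rw [Real.cos_abs, Complex.cos_arg hz]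
  rw [← Real.arccos_cos (abs_nonneg z.arg) (Complex.abs_arg_le_pi z)]
  apply Real.arccos_le_arccos
  rw [h1, le_div_iff₀ hn]; linarith

theorem mul_cpow_of_arg_add {x y : ℂ} (hx : x ≠ 0) (hy : y ≠ 0)
    (h : x.arg + y.arg ∈ Set.Ioc (-Real.pi) Real.pi) (a : ℂ) :
    (x * y) ^ a = x ^ a * y ^ a := by
  rw [Complex.cpow_def_of_ne_zero (mul_ne_zero hx hy), Complex.cpow_def_of_ne_zero hx,
    Complex.cpow_def_of_ne_zero hy, Complex.log_mul hx hy h, ← Complex.exp_add]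
  ring_nf

/-- The function `r ^ w * (cos (w * φ) + η)` in polar coordinates. -/
noncomputable def wedgeFun (w η : ℝ) (z : ℂ) : ℝ := (z ^ (w : ℂ)).re + η * ‖z‖ ^ w

theorem wedgeFun_eq (w η : ℝ) (z : ℂ) :
    wedgeFun w η z = ‖z‖ ^ w * (Real.cos (w * |z.arg|) + η) := by
  have : Real.cos (w * |z.arg|) = Real.cos (z.arg * w) := by
    rcases abs_cases z.arg with ⟨h, -⟩ | ⟨h, -⟩ <;> rw [h]
    · rw [mul_comm]
    · rw [mul_neg, Real.cos_neg, mul_comm]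
  rw [wedgeFun, Complex.cpow_ofReal_re, this]; ring

set_option maxHeartbeats 800000 in
theorem wedgeFun_add_ge (w η b c : ℝ) (hη : 0 ≤ η) (hη1 : η ≤ 1) (hb : 0 < b) (hc : -1 < c) :
    ∃ K : ℝ, 0 < K ∧ ∃ R : ℝ, 0 < R ∧ ∀ z : ℂ, R ≤ ‖z‖ → ‖z‖ * c ≤ z.re →
      ∃ A B : ℂ, ‖A‖ ≤ K * ‖z‖ ^ w / ‖z‖ ∧ ‖B‖ ≤ K * ‖z‖ ^ w / ‖z‖ ^ 2 ∧ ∀ t : ℂ, ‖t‖ ≤ b →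
        wedgeFun w η z + (A * t).re + (B * t ^ 2).re + η * w ^ 2 / 4 * ‖z‖ ^ w / ‖z‖ ^ 2 * ‖t‖ ^ 2
          - K * ‖z‖ ^ w / ‖z‖ ^ 3 ≤ wedgeFun w η (z + t) := by
  obtain ⟨C₁, hC₁, δ₁, hδ₁, h₁⟩ := one_add_cpow_taylor_two (w : ℂ)
  obtain ⟨C₂, hC₂, δ₂, hδ₂, h₂⟩ := norm_one_add_rpow_taylor_two w
  have harg : ∃ δ₃ : ℝ, 0 < δ₃ ∧ ∀ s : ℂ, ‖s‖ < δ₃ →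
      |(1 + s).arg| < Real.pi - Real.arccos c := by
    have hcont : ContinuousAt Complex.arg 1 :=
      Complex.continuousAt_arg Complex.one_mem_slitPlane
    have hpos : 0 < Real.pi - Real.arccos c := by
      have := Real.arccos_lt_arccos (x := -1) (y := min c 1) le_rfl (by simp [hc]) (by simp)
      rw [Real.arccos_neg_one] at this
      have h2 : Real.arccos c ≤ Real.arccos (min c 1) := Real.arccos_le_arccos (by simp)
      linarith
    rw [Metric.continuousAt_iff] at hcont
    obtain ⟨δ, hδ, h⟩ := hcont _ hpos
    refine ⟨δ, hδ, fun s hs => ?_⟩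
    have := h (x := 1 + s) (by simpa [dist_eq_norm] using hs)
    simpa [dist_eq_norm] using this
  obtain ⟨δ₃, hδ₃, h₃⟩ := harg
  set δ := min (min δ₁ δ₂) (min δ₃ 1) / 2 with hδ
  have hδpos : 0 < δ := by positivity
  have hδ1 : δ ≤ δ₁ := by
    have : min (min δ₁ δ₂) (min δ₃ 1) ≤ δ₁ := (min_le_left _ _).trans (min_le_left _ _)
    linarith
  have hδ2 : δ ≤ δ₂ := by
    have : min (min δ₁ δ₂) (min δ₃ 1) ≤ δ₂ := (min_le_left _ _).trans (min_le_right _ _)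
    linarith
  have hδ3 : δ < δ₃ := by
    have : min (min δ₁ δ₂) (min δ₃ 1) ≤ δ₃ := (min_le_right _ _).trans (min_le_left _ _)
    linarith
  have hδ4 : δ < 1 := by
    have : min (min δ₁ δ₂) (min δ₃ 1) ≤ 1 := (min_le_right _ _).trans (min_le_right _ _)
    linarith
  set D := |w / 2 * (w / 2 - 1)| with hD
  set K := 2 * |w| + ‖(w : ℂ) * (w - 1) / 2‖ + D + (C₁ + C₂) * b ^ 3 with hK
  have hDn : 0 ≤ D := abs_nonneg _
  have hE : 0 ≤ (C₁ + C₂) * b ^ 3 := by positivity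
  refine ⟨K, by positivity, b / δ, by positivity, fun z hzR hzc => ?_⟩
  have hzn : 0 < ‖z‖ := lt_of_lt_of_le (by positivity) hzR
  have hz0 : z ≠ 0 := norm_pos_iff.1 hzn
  set W := ‖z‖ ^ w with hW
  have hWpos : 0 < W := Real.rpow_pos_of_pos hzn w
  set Z := z ^ (w : ℂ) with hZ
  have hZn : ‖Z‖ = W := Complex.norm_cpow_real z w
  refine ⟨Z * w / z + η * W * w / z, Z * (w * (w - 1) / 2) / z ^ 2 +
    η * W * (w / 2 * (w / 2 - 1) : ℝ) / z ^ 2, ?_, ?_, fun t ht => ?_⟩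
  · refine (norm_add_le _ _).trans ?_
    simp only [norm_mul, norm_div, hZn, Complex.norm_real, Real.norm_eq_abs, abs_of_nonneg hη,
      abs_of_pos hWpos]
    rw [← add_div]
    gcongr
    have : η * W * |w| ≤ 1 * W * |w| := by gcongr
    have : |w| * W ≥ 0 := by positivity
    nlinarith [norm_nonneg ((w : ℂ) * (w - 1) / 2)]
  · refine (norm_add_le _ _).trans ?_
    rw [norm_div, norm_div, norm_mul, norm_mul, norm_mul, norm_pow, hZn, Complex.norm_real,
      Complex.norm_real, Complex.norm_real, ← add_div]
    simp only [Real.norm_eq_abs, abs_of_nonneg hη, abs_of_pos hWpos]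
    gcongr
    rw [← hD]
    have : η * W * D ≤ 1 * W * D := by gcongr
    have : |w| * W ≥ 0 := by positivity
    nlinarith
  · set s := t / z with hs
    have hts : t = z * s := by rw [hs]; field_simp
    have hsn : ‖s‖ = ‖t‖ / ‖z‖ := norm_div _ _
    have hsδ : ‖s‖ ≤ δ := by
      rw [hsn, div_le_iff₀ hzn]
      rw [div_le_iff₀ hδpos] at hzR; linarith
    have hs1 : 1 + s ≠ 0 := by
      intro h
      have : ‖s‖ = 1 := by rw [show s = -1 by linear_combination h]; simp
      linarith
    have hzt : z + t = z * (1 + s) := by rw [hts]; ring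
    have hargz := abs_arg_le_arccos hz0 hzc
    have hargs := h₃ s (by linarith)
    have hmem : z.arg + (1 + s).arg ∈ Set.Ioc (-Real.pi) Real.pi := by
      rw [abs_le] at hargz; rw [abs_lt] at hargs
      constructor <;> linarith
    have hpow : (z + t) ^ (w : ℂ) = Z * (1 + s) ^ (w : ℂ) := by
      rw [hzt, mul_cpow_of_arg_add hz0 hs1 hmem]
    have hnorm : ‖z + t‖ ^ w = W * ‖1 + s‖ ^ w := by
      rw [hzt, norm_mul, Real.mul_rpow (norm_nonneg _) (norm_nonneg _)]
    have k1 := h₁ s (by linarith)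
    have k2 := h₂ s (by linarith)
    set e := (1 + s) ^ (w : ℂ) - (1 + w * s + w * (w - 1) / 2 * s ^ 2) with he
    have hs3 : ‖s‖ ^ 3 ≤ b ^ 3 / ‖z‖ ^ 3 := by
      rw [hsn, div_pow]; gcongr
    have k3 : -(W * (C₁ * ‖s‖ ^ 3)) ≤ (Z * e).re := by
      have := Complex.abs_re_le_norm (Z * e)
      rw [norm_mul, hZn] at this
      have h4 : W * ‖e‖ ≤ W * (C₁ * ‖s‖ ^ 3) := by gcongr
      linarith [neg_abs_le (Z * e).re]
    have k4 : -(W * (C₂ * ‖s‖ ^ 3)) ≤ η * (W * (‖1 + s‖ ^ w - (1 + w * s.re +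
        w / 2 * (w / 2 - 1) * (s ^ 2).re + w ^ 2 / 4 * ‖s‖ ^ 2))) := by
      rw [abs_le] at k2
      have h5 : -(W * (C₂ * ‖s‖ ^ 3)) ≤ W * (‖1 + s‖ ^ w - (1 + w * s.re +
        w / 2 * (w / 2 - 1) * (s ^ 2).re + w ^ 2 / 4 * ‖s‖ ^ 2)) := by
        rw [← mul_neg]
        exact mul_le_mul_of_nonneg_left k2.1 hWpos.le
      have h6 : 0 ≤ W * (C₂ * ‖s‖ ^ 3) := by positivity
      refine le_trans ?_ (mul_le_mul_of_nonneg_left h5 hη)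
      rw [mul_neg]
      exact neg_le_neg (mul_le_of_le_one_left h6 hη1)
    have k5 : W * (C₁ * ‖s‖ ^ 3) + W * (C₂ * ‖s‖ ^ 3) ≤ K * W / ‖z‖ ^ 3 := by
      calc _ = (C₁ + C₂) * W * ‖s‖ ^ 3 := by ring
        _ ≤ (C₁ + C₂) * W * (b ^ 3 / ‖z‖ ^ 3) := by gcongr
        _ = ((C₁ + C₂) * b ^ 3) * W / ‖z‖ ^ 3 := by ring
        _ ≤ _ := by
          gcongr
          have := norm_nonneg ((w : ℂ) * (w - 1) / 2)
          have := abs_nonneg w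
          linarith
    have r1 : ((Z * w / z + η * W * w / z) * t).re
        = (Z * (w * s)).re + η * (W * (w * s.re)) := by
      have : (Z * w / z + η * W * w / z) * t = Z * (w * s) + ((η * (W * w) : ℝ) : ℂ) * s := by
        rw [hs]; push_cast; ring
      rw [this, Complex.add_re, Complex.re_ofReal_mul]; ring
    have r2 : ((Z * (w * (w - 1) / 2) / z ^ 2 + η * W * (w / 2 * (w / 2 - 1) : ℝ) / z ^ 2)
        * t ^ 2).re = (Z * (w * (w - 1) / 2 * s ^ 2)).re +
          η * (W * (w / 2 * (w / 2 - 1) * (s ^ 2).re)) := by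
      have : (Z * (w * (w - 1) / 2) / z ^ 2 + η * W * (w / 2 * (w / 2 - 1) : ℝ) / z ^ 2)
        * t ^ 2 = Z * (w * (w - 1) / 2 * s ^ 2) +
          ((η * (W * (w / 2 * (w / 2 - 1))) : ℝ) : ℂ) * s ^ 2 := by
        rw [hs]; push_cast; ring
      rw [this, Complex.add_re, Complex.re_ofReal_mul]; ring
    have r3 : η * w ^ 2 / 4 * W / ‖z‖ ^ 2 * ‖t‖ ^ 2 = η * (W * (w ^ 2 / 4 * ‖s‖ ^ 2)) := by
      rw [hsn]; ring
    have r4 : (Z * (1 + s) ^ (w : ℂ)).re = Z.re + (Z * (w * s)).re +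
        (Z * (w * (w - 1) / 2 * s ^ 2)).re + (Z * e).re := by
      rw [← Complex.add_re, ← Complex.add_re, ← Complex.add_re, he]; congr 1; ring
    rw [wedgeFun, wedgeFun, hpow, hnorm, r1, r2, r3, r4]
    linarith

/-- A lattice point as a complex number. -/
def latticePt (x : ℤ × ℤ) : ℂ := ⟨(x.1 : ℝ), (x.2 : ℝ)⟩

theorem latticePt_add (x y : ℤ × ℤ) : latticePt (x + y) = latticePt x + latticePt y := by
  apply Complex.ext <;> simp [latticePt]

/-- One-step laws `p`, supported in the finite set `J` of jumps of size at most `b`, on a closed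
set `T` of states, with drift `o(‖x‖⁻¹)` and covariance converging to `σ2` times the identity. -/
structure IsAsymptoticallyIsotropic (p : ℤ × ℤ → ℤ × ℤ → ℝ) (J : Finset (ℤ × ℤ))
    (T : Set (ℤ × ℤ)) (b σ2 : ℝ) : Prop where
  nonneg : ∀ x y, 0 ≤ p x y
  sum_eq_one : ∀ x, ∑ y ∈ J, p x y = 1
  norm_le : ∀ y ∈ J, ‖latticePt y‖ ≤ b
  closed : ∀ x ∈ T, ∀ y, p x y ≠ 0 → x + y ∈ T
  drift : ∀ ε : ℝ, 0 < ε → ∃ r : ℝ, ∀ x ∈ T, r ≤ ‖latticePt x‖ →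
    ‖latticePt x‖ * ‖∑ y ∈ J, (p x y : ℂ) * latticePt y‖ ≤ ε
  sq : ∀ ε : ℝ, 0 < ε → ∃ r : ℝ, ∀ x ∈ T, r ≤ ‖latticePt x‖ →
    ‖∑ y ∈ J, (p x y : ℂ) * latticePt y ^ 2‖ ≤ ε
  norm_sq : ∀ ε : ℝ, 0 < ε → ∃ r : ℝ, ∀ x ∈ T, r ≤ ‖latticePt x‖ →
    |∑ y ∈ J, p x y * ‖latticePt y‖ ^ 2 - 2 * σ2| ≤ ε

/-- The probability of remaining in `W` for `n` steps. -/
noncomputable def stayProb (p : ℤ × ℤ → ℤ × ℤ → ℝ) (J : Finset (ℤ × ℤ)) (W : Set (ℤ × ℤ)) :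
    ℕ → ℤ × ℤ → ℝ
  | 0, x => by classical exact if x ∈ W then 1 else 0
  | n + 1, x => by classical exact if x ∈ W then ∑ y ∈ J, p x y * stayProb p J W n (x + y) else 0

theorem stayProb_zero_of_mem {p : ℤ × ℤ → ℤ × ℤ → ℝ} {J : Finset (ℤ × ℤ)} {W : Set (ℤ × ℤ)}
    {x : ℤ × ℤ} (hx : x ∈ W) : stayProb p J W 0 x = 1 := by
  simp [stayProb, hx]

theorem stayProb_succ_of_mem {p : ℤ × ℤ → ℤ × ℤ → ℝ} {J : Finset (ℤ × ℤ)} {W : Set (ℤ × ℤ)}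
    {x : ℤ × ℤ} (hx : x ∈ W) (n : ℕ) :
    stayProb p J W (n + 1) x = ∑ y ∈ J, p x y * stayProb p J W n (x + y) := by
  simp [stayProb, hx]

theorem stayProb_of_notMem {p : ℤ × ℤ → ℤ × ℤ → ℝ} {J : Finset (ℤ × ℤ)} {W : Set (ℤ × ℤ)}
    {x : ℤ × ℤ} (hx : x ∉ W) (n : ℕ) : stayProb p J W n x = 0 := by
  cases n <;> simp [stayProb, hx]

theorem stayProb_nonneg {p : ℤ × ℤ → ℤ × ℤ → ℝ} (hp : ∀ x y, 0 ≤ p x y) (J : Finset (ℤ × ℤ))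
    (W : Set (ℤ × ℤ)) (n : ℕ) (x : ℤ × ℤ) : 0 ≤ stayProb p J W n x := by
  induction n generalizing x with
  | zero => rw [stayProb]; split_ifs <;> norm_num
  | succ n ih =>
    by_cases hx : x ∈ W
    · rw [stayProb_succ_of_mem hx]
      exact Finset.sum_nonneg fun y _ => mul_nonneg (hp x y) (ih _)
    · rw [stayProb_of_notMem hx]

theorem sum_mul_affine (J : Finset (ℤ × ℤ)) (q : ℤ × ℤ → ℝ) (hq : ∑ y ∈ J, q y = 1)
    (A B : ℂ) (k e : ℝ) :
    ∑ y ∈ J, q y * (e + (A * latticePt y).re + (B * latticePt y ^ 2).re + k * ‖latticePt y‖ ^ 2) =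
      e + (A * ∑ y ∈ J, (q y : ℂ) * latticePt y).re +
        (B * ∑ y ∈ J, (q y : ℂ) * latticePt y ^ 2).re + k * ∑ y ∈ J, q y * ‖latticePt y‖ ^ 2 := by
  have h (D : ℂ) (f : ℤ × ℤ → ℂ) :
      (D * ∑ y ∈ J, (q y : ℂ) * f y).re = ∑ y ∈ J, q y * (D * f y).re := by
    rw [Finset.mul_sum, Complex.re_sum]
    refine Finset.sum_congr rfl fun y _ => ?_
    rw [mul_left_comm, Complex.re_ofReal_mul]
  rw [h, h, Finset.mul_sum]
  conv_rhs => rw [← mul_one e, ← hq, Finset.mul_sum]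
  rw [← Finset.sum_add_distrib, ← Finset.sum_add_distrib, ← Finset.sum_add_distrib]
  exact Finset.sum_congr rfl fun y _ => by ring

namespace IsAsymptoticallyIsotropic

variable {p : ℤ × ℤ → ℤ × ℤ → ℝ} {J : Finset (ℤ × ℤ)} {T : Set (ℤ × ℤ)} {b σ2 : ℝ}

theorem wedgeFun_le_sum (h : IsAsymptoticallyIsotropic p J T b σ2) (hb : 0 < b) (hσ : 0 < σ2)
    {w η c : ℝ} (hw : w ≠ 0) (hη : 0 < η) (hη1 : η ≤ 1) (hc : -1 < c) :
    ∃ R : ℝ, ∀ x ∈ T, R ≤ ‖latticePt x‖ → ‖latticePt x‖ * c ≤ (latticePt x).re →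
      wedgeFun w η (latticePt x) ≤ ∑ y ∈ J, p x y * wedgeFun w η (latticePt (x + y)) := by
  obtain ⟨K, hK, R₀, hR₀, hg⟩ := wedgeFun_add_ge w η b c hη.le hη1 hb hc
  set q := η * w ^ 2 / 4 with hq
  have hqpos : 0 < q := by positivity
  set ε := q * σ2 / (q + 2 * K) with hε
  have hεpos : 0 < ε := by positivity
  have hεeq : q * ε + 2 * (K * ε) = q * σ2 := by rw [hε]; field_simp
  obtain ⟨r₁, h₁⟩ := h.drift ε hεpos
  obtain ⟨r₂, h₂⟩ := h.sq ε hεpos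
  obtain ⟨r₃, h₃⟩ := h.norm_sq ε hεpos
  refine ⟨max (max R₀ (K / (q * σ2))) (max r₁ (max r₂ r₃)), fun x hx hR hre => ?_⟩
  simp only [max_le_iff] at hR
  obtain ⟨⟨hR0, hRK⟩, hR1, hR2, hR3⟩ := hR
  obtain ⟨A, B, hA, hB, hgx⟩ := hg _ hR0 hre
  set z := latticePt x with hz
  have hzn : 0 < ‖z‖ := hR₀.trans_le hR0
  set W := ‖z‖ ^ w with hW
  have hWpos : 0 < W := Real.rpow_pos_of_pos hzn w
  have e1 : ∑ y ∈ J, p x y * (wedgeFun w η z - K * W / ‖z‖ ^ 3 + (A * latticePt y).re +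
      (B * latticePt y ^ 2).re + q * W / ‖z‖ ^ 2 * ‖latticePt y‖ ^ 2) ≤
      ∑ y ∈ J, p x y * wedgeFun w η (latticePt (x + y)) := by
    refine Finset.sum_le_sum fun y hy => mul_le_mul_of_nonneg_left ?_ (h.nonneg x y)
    rw [latticePt_add]
    have := hgx _ (h.norm_le y hy)
    linarith
  refine le_trans ?_ e1
  rw [sum_mul_affine J (p x) (h.sum_eq_one x)]
  have m1 := h₁ x hx hR1
  have m2 := h₂ x hx hR2
  have m3 := h₃ x hx hR3
  set μ := ∑ y ∈ J, (p x y : ℂ) * latticePt y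
  set m := ∑ y ∈ J, (p x y : ℂ) * latticePt y ^ 2
  set V := ∑ y ∈ J, p x y * ‖latticePt y‖ ^ 2
  have a1 : -(K * ε * (W / ‖z‖ ^ 2)) ≤ (A * μ).re := by
    have t1 : ‖A * μ‖ ≤ K * ε * (W / ‖z‖ ^ 2) := by
      rw [norm_mul]
      calc ‖A‖ * ‖μ‖ ≤ (K * W / ‖z‖) * (ε / ‖z‖) := by
            gcongr
            rw [le_div_iff₀ hzn]; linarith
        _ = _ := by field_simp
    linarith [neg_abs_le (A * μ).re, Complex.abs_re_le_norm (A * μ)]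
  have a2 : -(K * ε * (W / ‖z‖ ^ 2)) ≤ (B * m).re := by
    have t1 : ‖B * m‖ ≤ K * ε * (W / ‖z‖ ^ 2) := by
      rw [norm_mul]
      calc ‖B‖ * ‖m‖ ≤ (K * W / ‖z‖ ^ 2) * ε := by gcongr
        _ = _ := by ring
    linarith [neg_abs_le (B * m).re, Complex.abs_re_le_norm (B * m)]
  have a3 : q * (2 * σ2 - ε) * (W / ‖z‖ ^ 2) ≤ q * W / ‖z‖ ^ 2 * V := by
    rw [abs_le] at m3
    calc _ = q * W / ‖z‖ ^ 2 * (2 * σ2 - ε) := by ring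
      _ ≤ _ := by gcongr; linarith
  have a4 : K * W / ‖z‖ ^ 3 ≤ q * σ2 * (W / ‖z‖ ^ 2) := by
    have : K ≤ q * σ2 * ‖z‖ := by
      rw [div_le_iff₀ (by positivity)] at hRK; linarith
    calc K * W / ‖z‖ ^ 3 ≤ (q * σ2 * ‖z‖) * W / ‖z‖ ^ 3 := by gcongr
      _ = _ := by field_simp
  have a5 : q * (2 * σ2 - ε) * (W / ‖z‖ ^ 2) =
      q * σ2 * (W / ‖z‖ ^ 2) + 2 * (K * ε * (W / ‖z‖ ^ 2)) := by
    have : q * (2 * σ2 - ε) = q * σ2 + 2 * (K * ε) := by linarith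
    rw [this]; ring
  linarith

theorem exists_jump (h : IsAsymptoticallyIsotropic p J T b σ2) (hb : 0 < b) (hσ : 0 < σ2) :
    ∃ c : ℝ, 0 < c ∧ ∃ r : ℝ, ∀ x ∈ T, r ≤ ‖latticePt x‖ → ∀ v : ℂ, ‖v‖ = 1 →
      ∃ y ∈ J, p x y ≠ 0 ∧ c ≤ (v * latticePt y).re := by
  set ε := min 1 (min (σ2 / 8) (σ2 / (8 * b))) with hε
  have hεpos : 0 < ε := by positivity
  have hε1 : ε ≤ σ2 / 8 := (min_le_right _ _).trans (min_le_left _ _)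
  have hε2 : ε * (8 * b) ≤ σ2 := by
    rw [← le_div_iff₀ (by positivity)]
    exact (min_le_right _ _).trans (min_le_right _ _)
  obtain ⟨r₁, h₁⟩ := h.drift ε hεpos
  obtain ⟨r₂, h₂⟩ := h.sq ε hεpos
  obtain ⟨r₃, h₃⟩ := h.norm_sq ε hεpos
  refine ⟨σ2 / (4 * b), by positivity, max 1 (max r₁ (max r₂ r₃)), fun x hx hR v hv => ?_⟩
  simp only [max_le_iff] at hR
  obtain ⟨hR0, hR1, hR2, hR3⟩ := hR
  by_contra! hcon
  set c := σ2 / (4 * b) with hc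
  have hcb : b * c = σ2 / 4 := by rw [hc]; field_simp
  have hcpos : 0 < c := by positivity
  have m1 := h₁ x hx hR1
  have m2 := h₂ x hx hR2
  have m3 := h₃ x hx hR3
  have key : ∑ y ∈ J, p x y * (-(b * c) + ((-((c - b : ℝ) : ℂ) * v) * latticePt y).re +
      ((1 / 2 * v ^ 2) * latticePt y ^ 2).re + 1 / 2 * ‖latticePt y‖ ^ 2) ≤ 0 := by
    refine Finset.sum_nonpos fun y hy => ?_
    by_cases hy0 : p x y = 0
    · simp [hy0]
    · refine mul_nonpos_of_nonneg_of_nonpos (h.nonneg x y) ?_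
      have e1 := hcon y hy hy0
      have e2 : ‖v * latticePt y‖ ≤ b := by rw [norm_mul, hv, one_mul]; exact h.norm_le y hy
      have e3 : ‖latticePt y‖ = ‖v * latticePt y‖ := by rw [norm_mul, hv, one_mul]
      have e4 := (abs_le.1 ((Complex.abs_re_le_norm _).trans e2)).1
      rw [e3, mul_assoc, mul_assoc, ← mul_pow]
      set u := v * latticePt y
      have e5 : ‖u‖ ^ 2 = u.re ^ 2 + u.im ^ 2 := by
        rw [← Complex.normSq_eq_norm_sq, Complex.normSq_apply]; ring
      have e6 : (1 / 2 * u ^ 2).re = 1 / 2 * (u.re ^ 2 - u.im ^ 2) := by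
        have : (1 / 2 * u ^ 2) = ((1 / 2 : ℝ) : ℂ) * u ^ 2 := by push_cast; ring
        rw [this, Complex.re_ofReal_mul]; simp [pow_two]
      have e7 : (-((c - b : ℝ) : ℂ) * u).re = -(c - b) * u.re := by
        rw [← Complex.ofReal_neg, Complex.re_ofReal_mul]
      rw [e5, e6, e7]
      nlinarith
  rw [sum_mul_affine J (p x) (h.sum_eq_one x)] at key
  set μ := ∑ y ∈ J, (p x y : ℂ) * latticePt y
  set m := ∑ y ∈ J, (p x y : ℂ) * latticePt y ^ 2
  set V := ∑ y ∈ J, p x y * ‖latticePt y‖ ^ 2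
  have hμ : ‖μ‖ ≤ ε := by nlinarith [norm_nonneg μ]
  have a1 : -(|c - b| * ε) ≤ ((-((c - b : ℝ) : ℂ) * v) * μ).re := by
    have t1 : ‖(-((c - b : ℝ) : ℂ) * v) * μ‖ ≤ |c - b| * ε := by
      rw [norm_mul, norm_mul, norm_neg, hv, Complex.norm_real, mul_one, Real.norm_eq_abs]
      gcongr
    exact neg_le_of_abs_le ((Complex.abs_re_le_norm _).trans t1)
  have a2 : -(1 / 2 * ε) ≤ ((1 / 2 * v ^ 2) * m).re := by
    have t1 : ‖(1 / 2 * v ^ 2) * m‖ ≤ 1 / 2 * ε := by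
      rw [norm_mul, norm_mul, norm_pow, hv]
      norm_num
      linarith
    exact neg_le_of_abs_le ((Complex.abs_re_le_norm _).trans t1)
  have hbne : |c - b| * ε ≤ 3 / 8 * σ2 := by
    have t : |c - b| ≤ c + b := by rw [abs_le]; constructor <;> linarith
    have t2 : |c - b| * ε ≤ (c + b) * ε := by gcongr
    have t3 : c * ε ≤ σ2 / 4 := by
      have : ε ≤ b ∨ b < ε := le_or_gt _ _
      rcases this with h1 | h1
      · nlinarith
      · exfalso
        have l1 : V ≤ b ^ 2 := by
          calc V ≤ ∑ y ∈ J, p x y * b ^ 2 := by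
                refine Finset.sum_le_sum fun y hy => mul_le_mul_of_nonneg_left ?_ (h.nonneg x y)
                have := h.norm_le y hy
                gcongr
            _ = b ^ 2 := by rw [← Finset.sum_mul, h.sum_eq_one, one_mul]
        rw [abs_le] at m3
        nlinarith
    linarith
  rw [abs_le] at m3
  linarith

theorem one_sub_le_stayProb (h : IsAsymptoticallyIsotropic p J T b σ2) :
    ∃ r : ℝ, ∀ (W : Set (ℤ × ℤ)) (z : ℂ) (ρ : ℝ), 0 < ρ → r ≤ ρ →
      (∀ x ∈ T, ‖latticePt x - z‖ < ρ → x ∈ W ∧ ρ ≤ ‖latticePt x‖) → ∀ (n : ℕ), ∀ x ∈ T,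
        1 - (‖latticePt x - z‖ ^ 2 + (b ^ 2 + 2) * n) / ρ ^ 2 ≤ stayProb p J W n x := by
  obtain ⟨r, hr⟩ := h.drift 1 one_pos
  refine ⟨r, fun W z ρ hρ hrρ hW n => ?_⟩
  induction n with
  | zero =>
    intro x hx
    by_cases hd : ‖latticePt x - z‖ < ρ
    · rw [stayProb_zero_of_mem (hW x hx hd).1]
      have : 0 ≤ (‖latticePt x - z‖ ^ 2 + (b ^ 2 + 2) * (0 : ℕ)) / ρ ^ 2 := by positivity
      linarith
    · refine le_trans ?_ (stayProb_nonneg h.nonneg J W _ x)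
      rw [sub_nonpos, le_div_iff₀ (by positivity)]
      push Not at hd
      have : ρ ^ 2 ≤ ‖latticePt x - z‖ ^ 2 := by gcongr
      push_cast
      linarith
  | succ n ih =>
    intro x hx
    by_cases hd : ‖latticePt x - z‖ < ρ
    · obtain ⟨hxW, hxρ⟩ := hW x hx hd
      rw [stayProb_succ_of_mem hxW]
      set v := latticePt x - z with hv
      have e1 : ∑ y ∈ J, p x y * ((1 - (‖v‖ ^ 2 + (b ^ 2 + 2) * n) / ρ ^ 2) +
          ((-(2 / ρ ^ 2 : ℝ) * starRingEnd ℂ v) * latticePt y).re + ((0 : ℂ) * latticePt y ^ 2).re +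
          (-1 / ρ ^ 2) * ‖latticePt y‖ ^ 2) ≤ ∑ y ∈ J, p x y * stayProb p J W n (x + y) := by
        refine Finset.sum_le_sum fun y hy => ?_
        by_cases hy0 : p x y = 0
        · simp [hy0]
        · refine mul_le_mul_of_nonneg_left ?_ (h.nonneg x y)
          refine le_trans (le_of_eq ?_) (ih (x + y) (h.closed x hx y hy0))
          have : latticePt (x + y) - z = v + latticePt y := by rw [latticePt_add, hv]; ring
          rw [this, zero_mul, Complex.zero_re, mul_assoc, ← Complex.ofReal_neg,
            Complex.re_ofReal_mul, ← Complex.normSq_eq_norm_sq (v + _), Complex.normSq_add,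
            Complex.normSq_eq_norm_sq, Complex.normSq_eq_norm_sq]
          have : (v * starRingEnd ℂ (latticePt y)).re = (starRingEnd ℂ v * latticePt y).re := by
            simp
          rw [this]; field_simp; ring
      refine le_trans ?_ e1
      rw [sum_mul_affine J (p x) (h.sum_eq_one x)]
      have m1 := hr x hx (hrρ.trans hxρ)
      set μ := ∑ y ∈ J, (p x y : ℂ) * latticePt y
      have hV : ∑ y ∈ J, p x y * ‖latticePt y‖ ^ 2 ≤ b ^ 2 := by
        calc _ ≤ ∑ y ∈ J, p x y * b ^ 2 := by
              refine Finset.sum_le_sum fun y hy => mul_le_mul_of_nonneg_left ?_ (h.nonneg x y)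
              have := h.norm_le y hy
              gcongr
          _ = b ^ 2 := by rw [← Finset.sum_mul, h.sum_eq_one, one_mul]
      set V := ∑ y ∈ J, p x y * ‖latticePt y‖ ^ 2
      have hvμ : ‖v‖ * ‖μ‖ ≤ 1 := by
        refine le_trans ?_ m1
        gcongr
        exact hd.le.trans hxρ
      have e2 : -(2 / ρ ^ 2) ≤ ((-(2 / ρ ^ 2 : ℝ) * starRingEnd ℂ v) * μ).re := by
        refine neg_le_of_abs_le ((Complex.abs_re_le_norm _).trans ?_)
        rw [norm_mul, norm_mul, norm_neg, Complex.norm_real, RCLike.norm_conj, mul_assoc,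
          Real.norm_of_nonneg (by positivity)]
        exact mul_le_of_le_one_right (by positivity) hvμ
      have e3 : -(b ^ 2 / ρ ^ 2) ≤ -1 / ρ ^ 2 * V := by
        rw [div_mul_eq_mul_div, ← neg_div]
        gcongr
        linarith
      have e4 : 1 - (‖v‖ ^ 2 + (b ^ 2 + 2) * (n + 1 : ℕ)) / ρ ^ 2 =
          1 - (‖v‖ ^ 2 + (b ^ 2 + 2) * n) / ρ ^ 2 - b ^ 2 / ρ ^ 2 - 2 / ρ ^ 2 := by
        push_cast; ring
      rw [e4, zero_mul, Complex.zero_re]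
      linarith
    · refine le_trans ?_ (stayProb_nonneg h.nonneg J W _ x)
      rw [sub_nonpos, le_div_iff₀ (by positivity)]
      push Not at hd
      have : ρ ^ 2 ≤ ‖latticePt x - z‖ ^ 2 := by gcongr
      have : 0 ≤ (b ^ 2 + 2) * ((n + 1 : ℕ) : ℝ) := by positivity
      linarith

theorem exists_stayProb_ge_of_ball (h : IsAsymptoticallyIsotropic p J T b σ2) (hb : 0 < b)
    (hσ : 0 < σ2) :
    ∃ r D : ℝ, ∀ (W : Set (ℤ × ℤ)) (z : ℂ) (d : ℝ),
      (∀ y, ‖latticePt y - z‖ < d → y ∈ W ∧ r ≤ ‖latticePt y‖) →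
      ∀ x ∈ T, ‖latticePt x - z‖ ≤ d → x ∈ W → r ≤ ‖latticePt x‖ →
        ∃ y ∈ T, ‖latticePt y - z‖ ≤ D ∧ ∃ m : ℕ, ∃ c : ℝ, 0 < c ∧
          ∀ n, c * stayProb p J W n y ≤ stayProb p J W (n + m) x := by
  obtain ⟨c, hc, r, hr⟩ := h.exists_jump hb hσ
  refine ⟨r, b ^ 2 / c, fun W z d hball => ?_⟩
  have main : ∀ k : ℕ, ∀ x ∈ T, ‖latticePt x - z‖ ^ 2 ≤ k * b ^ 2 → ‖latticePt x - z‖ ≤ d →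
      x ∈ W → r ≤ ‖latticePt x‖ → ∃ y ∈ T, ‖latticePt y - z‖ ≤ b ^ 2 / c ∧ ∃ m : ℕ, ∃ c : ℝ,
        0 < c ∧ ∀ n, c * stayProb p J W n y ≤ stayProb p J W (n + m) x := by
    intro k
    induction k with
    | zero =>
      intro x hx hk _ _ _
      refine ⟨x, hx, ?_, 0, 1, one_pos, fun n => by simp⟩
      have : ‖latticePt x - z‖ = 0 := by
        have := sq_nonneg ‖latticePt x - z‖
        push_cast at hk
        exact pow_eq_zero_iff (two_ne_zero) |>.1 (by linarith)
      rw [this]; positivity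
    | succ k ih =>
      intro x hx hk hd hxW hxr
      by_cases hD : ‖latticePt x - z‖ ≤ b ^ 2 / c
      · exact ⟨x, hx, hD, 0, 1, one_pos, fun n => by simp⟩
      push Not at hD
      set v := latticePt x - z with hv
      have hvpos : 0 < ‖v‖ := lt_of_le_of_lt (by positivity) hD
      have hv1 : ‖-(starRingEnd ℂ v / ‖v‖)‖ = 1 := by
        rw [norm_neg, norm_div, RCLike.norm_conj, Complex.norm_real, norm_norm,
          div_self hvpos.ne']
      obtain ⟨y, hyJ, hy0, hyc⟩ := hr x hx hxr _ hv1
      have hdiff : latticePt (x + y) - z = v + latticePt y := by rw [latticePt_add, hv]; ring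
      have hdot : (starRingEnd ℂ v * latticePt y).re ≤ -(c * ‖v‖) := by
        have e : -(starRingEnd ℂ v / ‖v‖) * latticePt y =
            ((-(1 / ‖v‖) : ℝ) : ℂ) * (starRingEnd ℂ v * latticePt y) := by push_cast; ring
        rw [e, Complex.re_ofReal_mul] at hyc
        have := mul_le_mul_of_nonneg_right hyc hvpos.le
        have e2 : -(1 / ‖v‖) * (starRingEnd ℂ v * latticePt y).re * ‖v‖ =
          - (starRingEnd ℂ v * latticePt y).re := by field_simp
        linarith
      have hlt : ‖latticePt (x + y) - z‖ ^ 2 ≤ ‖v‖ ^ 2 - b ^ 2 := by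
        rw [hdiff, ← Complex.normSq_eq_norm_sq (v + _), Complex.normSq_add,
            Complex.normSq_eq_norm_sq, Complex.normSq_eq_norm_sq]
        have e1 : (v * starRingEnd ℂ (latticePt y)).re = (starRingEnd ℂ v * latticePt y).re := by
            simp
        have e2 : ‖latticePt y‖ ^ 2 ≤ b ^ 2 := by
          have := h.norm_le y hyJ
          gcongr
        rw [div_lt_iff₀ hc] at hD
        linarith
      have hlt2 : ‖latticePt (x + y) - z‖ < d := by
        refine lt_of_lt_of_le ?_ hd
        have : ‖latticePt (x + y) - z‖ ^ 2 < ‖v‖ ^ 2 := by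
          have : 0 < b ^ 2 := by positivity
          linarith
        exact lt_of_pow_lt_pow_left₀ 2 hvpos.le this
      obtain ⟨hW', hr'⟩ := hball _ hlt2
      obtain ⟨y', hy'T, hy'D, m, c', hc', hstay⟩ := ih (x + y) (h.closed x hx y hy0)
        (by push_cast at hk; linarith) hlt2.le hW' hr'
      refine ⟨y', hy'T, hy'D, m + 1, p x y * c',
        mul_pos (lt_of_le_of_ne (h.nonneg x y) (Ne.symm hy0)) hc', fun n => ?_⟩
      rw [← add_assoc, stayProb_succ_of_mem hxW]
      refine le_trans ?_ (Finset.single_le_sum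
        (f := fun y => p x y * stayProb p J W (n + m) (x + y))
        (fun y _ => mul_nonneg (h.nonneg x y) (stayProb_nonneg h.nonneg J W _ _)) hyJ)
      rw [mul_assoc]
      exact mul_le_mul_of_nonneg_left (hstay n) (h.nonneg x y)
  intro x hx hd hxW hxr
  obtain ⟨k, hk⟩ := exists_nat_ge (‖latticePt x - z‖ ^ 2 / b ^ 2)
  exact main k x hx (by rwa [div_le_iff₀ (by positivity)] at hk) hd hxW hxr

theorem wedgeFun_sub_le_stayProb (h : IsAsymptoticallyIsotropic p J T b σ2) (hb : 0 < b)
    (hσ : 0 < σ2) {w η a a₁ : ℝ} (hw : 0 < w) (hη : 0 < η) (hη1 : η ≤ 1) (ha : -1 ≤ a)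
    (haa : a < a₁) (ha₁ : a₁ ≤ 1)
    (hneg : ∀ z : ℂ, z ≠ 0 → ‖z‖ * a ≤ z.re → z.re ≤ ‖z‖ * a₁ → wedgeFun w η z ≤ 0)
    {W : Set (ℤ × ℤ)} (hW : ∀ x, b < (latticePt x).re - ‖latticePt x‖ * a → x ∈ W) :
    ∃ R C N₀ δ : ℝ, 0 < δ ∧ ∀ N : ℝ, N₀ ≤ N → ∀ n : ℕ, (n : ℝ) ≤ δ * N ^ 2 → ∀ x ∈ T,
      R ≤ ‖latticePt x‖ → ‖latticePt x‖ * a₁ < (latticePt x).re → ‖latticePt x‖ ≤ 2 * N →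
        (wedgeFun w η (latticePt x) - C) / (4 * (2 * N) ^ w) ≤ stayProb p J W n x := by
  obtain ⟨R₁, hR₁⟩ := h.wedgeFun_le_sum hb hσ hw.ne' hη hη1 (ha.trans_lt haa)
  obtain ⟨r, hr⟩ := h.one_sub_le_stayProb
  have hgap : 0 < a₁ - a := by linarith
  have habs : |a| ≤ 1 := by rw [abs_le]; constructor <;> linarith
  have habs₁ : |a₁| ≤ 1 := by rw [abs_le]; constructor <;> linarith
  set κ := (a₁ - a) / 4 with hκ
  have hκpos : 0 < κ := by positivity
  have hκ2 : κ ≤ 1 / 2 := by rw [hκ]; linarith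
  set R := max (max 1 R₁) (2 * b / (a₁ - a)) with hR
  have hR1 : 1 ≤ R := (le_max_left _ _).trans (le_max_left _ _)
  have hRR : R₁ ≤ R := (le_max_right _ _).trans (le_max_left _ _)
  have hRb : 2 * b / (a₁ - a) ≤ R := le_max_right _ _
  have hle : ∀ z : ℂ, wedgeFun w η z ≤ 2 * ‖z‖ ^ w := by
    intro z
    rw [wedgeFun_eq]
    have := Real.rpow_nonneg (norm_nonneg z) w
    nlinarith [Real.cos_le_one (w * |z.arg|)]
  have hmarg : ∀ u v : ℂ, ∀ t : ℝ, ‖v - u‖ ≤ t →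
      u.re - ‖u‖ * a - 2 * t ≤ v.re - ‖v‖ * a := by
    intro u v t ht
    have e1 := (abs_le.1 ((Complex.abs_re_le_norm (v - u)).trans ht)).1
    rw [Complex.sub_re] at e1
    have e2 : ‖v‖ * a - ‖u‖ * a ≤ t := by
      have : |(‖v‖ - ‖u‖) * a| ≤ t := by
        rw [abs_mul]
        calc |‖v‖ - ‖u‖| * |a| ≤ |‖v‖ - ‖u‖| * 1 := by gcongr
          _ ≤ t := by rw [mul_one]; exact (abs_norm_sub_norm_le v u).trans ht
      linarith [le_abs_self ((‖v‖ - ‖u‖) * a)]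
    linarith
  refine ⟨R, 2 * R ^ w, max (max b (r / κ)) (2 * b / (a₁ - a) + 1), κ ^ 2 / (2 * (b ^ 2 + 2)),
    by positivity, fun N hN n => ?_⟩
  simp only [max_le_iff] at hN
  obtain ⟨⟨hNb, hNr⟩, hNa⟩ := hN
  have hNpos : 0 < N := hb.trans_le hNb
  have hden : 0 < 4 * (2 * N) ^ w := by positivity
  have hRw : 0 ≤ 2 * R ^ w := by positivity
  have hnon : ∀ n x, wedgeFun w η (latticePt x) ≤ 2 * R ^ w →
      (wedgeFun w η (latticePt x) - 2 * R ^ w) / (4 * (2 * N) ^ w) ≤ stayProb p J W n x := by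
    intro n x hx
    refine le_trans ?_ (stayProb_nonneg h.nonneg J W n x)
    exact div_nonpos_of_nonpos_of_nonneg (by linarith) hden.le
  have hinW : ∀ x, R ≤ ‖latticePt x‖ → ‖latticePt x‖ * a₁ < (latticePt x).re →
      2 * b < (latticePt x).re - ‖latticePt x‖ * a := by
    intro x h1 h2
    have := hRb.trans h1
    rw [div_le_iff₀ hgap] at this
    linarith
  have hhalf : ∀ x, ‖latticePt x‖ ≤ 2 * N →
      (wedgeFun w η (latticePt x) - 2 * R ^ w) / (4 * (2 * N) ^ w) ≤ 1 / 2 := by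
    intro x hx
    rw [div_le_iff₀ hden]
    have : ‖latticePt x‖ ^ w ≤ (2 * N) ^ w := by gcongr
    linarith [hle (latticePt x)]
  have hfar : ∀ n : ℕ, (n : ℝ) ≤ κ ^ 2 / (2 * (b ^ 2 + 2)) * N ^ 2 → ∀ x ∈ T,
      N ≤ ‖latticePt x‖ → ‖latticePt x‖ * a₁ < (latticePt x).re →
      1 / 2 ≤ stayProb p J W n x := by
    intro n hn x hx hxN hxa
    have := hr W (latticePt x) (κ * N) (by positivity)
      (by rw [div_le_iff₀ hκpos] at hNr; linarith) ?_ n x hx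
    · refine le_trans ?_ this
      rw [sub_self, norm_zero]
      have e : (b ^ 2 + 2) * (n : ℝ) ≤ 1 / 2 * (κ * N) ^ 2 := by
        calc _ ≤ (b ^ 2 + 2) * (κ ^ 2 / (2 * (b ^ 2 + 2)) * N ^ 2) := by gcongr
          _ = _ := by field_simp
      have e2 : (0 ^ 2 + (b ^ 2 + 2) * (n : ℝ)) / (κ * N) ^ 2 ≤ 1 / 2 := by
        rw [div_le_iff₀ (by positivity)]; linarith
      linarith
    · intro y _ hy
      constructor
      · apply hW
        have e1 := hmarg _ _ _ hy.le
        have e2 : 2 * b / (a₁ - a) < N := by linarith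
        rw [div_lt_iff₀ hgap] at e2
        have e3 : N * (a₁ - a) ≤ ‖latticePt x‖ * (a₁ - a) := by gcongr
        have e4 : κ * N = N * (a₁ - a) / 4 := by rw [hκ]; ring
        linarith
      · have e1 := norm_sub_norm_le (latticePt x) (latticePt y)
        rw [norm_sub_rev] at e1
        nlinarith
  induction n with
  | zero =>
    intro _ x hx hxR hxa hxN
    rw [stayProb_zero_of_mem (hW x (by linarith [hinW x hxR hxa]))]
    linarith [hhalf x hxN]
  | succ n ih =>
    intro hn x hx hxR hxa hxN
    by_cases hNx : N ≤ ‖latticePt x‖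
    · exact (hhalf x hxN).trans (hfar _ hn x hx hNx hxa)
    push Not at hNx
    have hin := hinW x hxR hxa
    rw [stayProb_succ_of_mem (hW x (by linarith))]
    have hn' : (n : ℝ) ≤ κ ^ 2 / (2 * (b ^ 2 + 2)) * N ^ 2 := by push_cast at hn; linarith
    have e1 : ∑ y ∈ J, p x y * ((wedgeFun w η (latticePt (x + y)) - 2 * R ^ w) /
        (4 * (2 * N) ^ w)) ≤ ∑ y ∈ J, p x y * stayProb p J W n (x + y) := by
      refine Finset.sum_le_sum fun y hy => ?_
      by_cases hy0 : p x y = 0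
      · simp [hy0]
      refine mul_le_mul_of_nonneg_left ?_ (h.nonneg x y)
      have hyb := h.norm_le y hy
      have hxy : latticePt (x + y) - latticePt x = latticePt y := by rw [latticePt_add]; ring
      by_cases h1 : R ≤ ‖latticePt (x + y)‖
      · by_cases h2 : ‖latticePt (x + y)‖ * a₁ < (latticePt (x + y)).re
        · refine ih hn' (x + y) (h.closed x hx y hy0) h1 h2 ?_
          rw [latticePt_add]
          refine (norm_add_le _ _).trans ?_
          linarith
        · push Not at h2
          apply hnon
          refine (hneg _ (norm_pos_iff.1 (by linarith)) ?_ h2).trans hRw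
          have := hmarg (latticePt x) (latticePt (x + y)) b (by rw [hxy]; exact hyb)
          linarith
      · push Not at h1
        apply hnon
        refine (hle _).trans ?_
        gcongr
    refine le_trans ?_ e1
    have e2 := hR₁ x hx (hRR.trans hxR) hxa.le
    have e3 : ∑ y ∈ J, p x y * ((wedgeFun w η (latticePt (x + y)) - 2 * R ^ w) /
        (4 * (2 * N) ^ w)) = (∑ y ∈ J, p x y * wedgeFun w η (latticePt (x + y)) - 2 * R ^ w) /
        (4 * (2 * N) ^ w) := by
      rw [sub_div, Finset.sum_div]
      conv_rhs => rw [← mul_one (2 * R ^ w / _), ← h.sum_eq_one x, Finset.mul_sum]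
      rw [← Finset.sum_sub_distrib]
      exact Finset.sum_congr rfl fun y _ => by ring
    rw [e3]
    gcongr

end IsAsymptoticallyIsotropic

theorem norm_latticePt (x : ℤ × ℤ) : ‖latticePt x‖ = znorm x := by
  rw [Complex.norm_def, Complex.normSq_apply, znorm, latticePt, pow_two, pow_two]

theorem mem_Wset_of_lt {b α : ℝ} (hα : α ≤ Real.pi) (hb : 0 < b) {x : ℤ × ℤ}
    (h : b < (latticePt x).re - ‖latticePt x‖ * Real.cos α) : x ∈ Wset b α := by
  rcases hα.lt_or_eq with hα | rfl
  · refine Or.inl ⟨hα, ?_⟩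
    rw [norm_latticePt] at h
    have : (latticePt x).re = x.1 := rfl
    linarith
  · refine Or.inr ⟨rfl, fun ⟨h1, h2⟩ => ?_⟩
    have h3 := Complex.norm_le_abs_re_add_abs_im (latticePt x)
    have h4 : (latticePt x).re = x.1 := rfl
    have h5 : (latticePt x).im = x.2 := rfl
    rw [Real.cos_pi] at h
    rw [h4] at h h3
    rw [h5, abs_of_nonpos h1] at h3
    linarith

theorem abs_arg_lt_iff {α : ℝ} (hα0 : 0 ≤ α) (hα : α ≤ Real.pi) {z : ℂ} (hz : z ≠ 0) :
    |z.arg| < α ↔ ‖z‖ * Real.cos α < z.re := by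
  have hn : 0 < ‖z‖ := norm_pos_iff.2 hz
  have h1 : z.re = ‖z‖ * Real.cos |z.arg| := by
    rw [Real.cos_abs, Complex.cos_arg hz]; field_simp
  rw [h1, mul_lt_mul_iff_right₀ hn]
  exact (Real.strictAntiOn_cos.lt_iff_gt ⟨hα0, hα⟩
    ⟨abs_nonneg _, Complex.abs_arg_le_pi z⟩).symm

theorem abs_arg_le_iff {α : ℝ} (hα0 : 0 ≤ α) (hα : α ≤ Real.pi) {z : ℂ} (hz : z ≠ 0) :
    |z.arg| ≤ α ↔ ‖z‖ * Real.cos α ≤ z.re := by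
  have hn : 0 < ‖z‖ := norm_pos_iff.2 hz
  have h1 : z.re = ‖z‖ * Real.cos |z.arg| := by
    rw [Real.cos_abs, Complex.cos_arg hz]; field_simp
  rw [h1, mul_le_mul_iff_right₀ hn]
  exact (Real.strictAntiOn_cos.le_iff_ge ⟨hα0, hα⟩
    ⟨abs_nonneg _, Complex.abs_arg_le_pi z⟩).symm

theorem arg_mem_Ioo_of_im_pos {ζ : ℂ} (hre : 0 < ζ.re) (him : 0 < ζ.im) :
    0 < ζ.arg ∧ ζ.arg ≤ ζ.im / ζ.re := by
  have h1 : 0 ≤ ζ.arg := Complex.arg_nonneg_iff.2 him.le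
  have h2 : ζ.arg < Real.pi / 2 := by
    have hz : ζ ≠ 0 := fun h => by simp [h] at hre
    have := (Complex.abs_arg_lt_pi_div_two_iff).2 (Or.inl hre)
    exact lt_of_le_of_lt (le_abs_self _) this
  refine ⟨lt_of_le_of_ne h1 fun h => ?_, ?_⟩
  · have := Complex.arg_eq_zero_iff.1 h.symm
    linarith [this.2]
  · rw [← Complex.tan_arg]
    exact Real.le_tan h1 h2

theorem exists_interior_ball_of_arg_nonneg {α : ℝ} (hα0 : 0 < α) (hα : α < Real.pi) {u : ℂ} (hu : u ≠ 0)
    (h0 : 0 ≤ u.arg) (hu1 : u.arg < α) :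
    ∃ z : ℂ, ‖u‖ ≤ 2 * ‖z‖ ∧ |z.arg| ≤ α - Real.arctan (α / 8) ∧ z ≠ 0 ∧
      ∀ y : ℂ, ‖y - z‖ < ‖u - z‖ → |y.arg| < α ∧ y ≠ 0 ∧ ‖u‖ ≤ 4 * ‖y‖ := by
  set t := α / 8 with ht
  have hpi := Real.pi_lt_four
  have htpos : 0 < t := by positivity
  have ht1 : t < 1 / 2 := by rw [ht]; linarith
  have hun : 0 < ‖u‖ := norm_pos_iff.2 hu
  have key : ∀ ζ : ℂ, 1 / 2 ≤ ζ.re → ζ.im < 0 → -ζ.im ≤ 2 * t → |(u * ζ).arg| ≤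
      max (u.arg + ζ.arg) (α / 2) ∧ ζ.arg < 0 := by
    intro ζ h1 h2 h3
    have hζ : ζ ≠ 0 := fun h => by simp [h] at h2
    have hc := arg_mem_Ioo_of_im_pos (ζ := (starRingEnd ℂ) ζ) (by simp; linarith) (by simpa using h2)
    have hne : ζ.arg ≠ Real.pi := fun h => by
      have := (Complex.arg_eq_pi_iff.1 h).2; linarith
    rw [Complex.arg_conj, if_neg hne, Complex.conj_im, Complex.conj_re] at hc
    have h4 : -ζ.im / ζ.re ≤ α / 2 := by
      rw [div_le_iff₀ (by linarith)]
      have : α / 2 * (1 / 2) ≤ α / 2 * ζ.re := by gcongr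
      rw [ht] at h3
      linarith
    have h5 : (u * ζ).arg = u.arg + ζ.arg :=
      Complex.arg_mul hu hζ ⟨by linarith, by linarith⟩
    rw [h5]
    refine ⟨?_, by linarith⟩
    rw [abs_le]
    constructor
    · linarith [le_max_right (u.arg + ζ.arg) (α / 2)]
    · exact le_max_left _ _
  set ζ₀ : ℂ := ⟨1, -t⟩ with hζ₀
  have hζn : 1 ≤ ‖ζ₀‖ := by simpa [hζ₀] using Complex.re_le_norm ζ₀
  have hζne : ζ₀ ≠ 0 := fun h => by rw [h] at hζn; simp at hζn; linarith
  have hζarg : ζ₀.arg = -Real.arctan t := by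
    have h1 : |ζ₀.arg| < Real.pi / 2 :=
      (Complex.abs_arg_lt_pi_div_two_iff).2 (Or.inl (by simp [hζ₀]))
    rw [← Real.arctan_neg, ← Real.arctan_tan (abs_lt.1 h1).1 (abs_lt.1 h1).2, Complex.tan_arg]
    simp [hζ₀]
  have hat : Real.arctan t ≤ t := by
    have := Real.arctan_nonneg.2 htpos.le
    have h2 := Real.le_tan this (Real.arctan_lt_pi_div_two t)
    rwa [Real.tan_arctan] at h2
  have hdist : ‖u - u * ζ₀‖ = ‖u‖ * t := by
    have : u - u * ζ₀ = u * (t * Complex.I) := by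
      apply Complex.ext <;> simp [hζ₀]
    rw [this]
    simp [abs_of_pos htpos]
  refine ⟨u * ζ₀, ?_, ?_, mul_ne_zero hu hζne, fun y hy => ?_⟩
  · rw [norm_mul]; nlinarith
  · refine (key ζ₀ (by simp [hζ₀]; norm_num) (by simpa [hζ₀] using htpos) (by simp [hζ₀]; linarith)).1.trans ?_
    rw [hζarg]
    apply max_le <;> linarith
  · obtain ⟨ζ, rfl⟩ : ∃ ζ, y = u * ζ := ⟨y / u, by field_simp⟩
    rw [hdist, ← mul_sub, norm_mul, mul_lt_mul_iff_right₀ hun] at hy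
    have h1 := (Complex.abs_re_le_norm _).trans_lt hy
    have h2 := (Complex.abs_im_le_norm _).trans_lt hy
    rw [abs_lt] at h1 h2
    simp [hζ₀] at h1 h2
    have hk := key ζ (by linarith) (by linarith) (by linarith)
    have h3 : 1 / 4 ≤ ‖ζ‖ := by linarith [Complex.re_le_norm ζ]
    refine ⟨hk.1.trans_lt (max_lt ?_ ?_), mul_ne_zero hu fun h => ?_, ?_⟩
    · linarith
    · linarith
    · rw [h] at h3; norm_num at h3
    · rw [norm_mul]; nlinarith

theorem exists_interior_ball {α : ℝ} (hα0 : 0 < α) (hα : α < Real.pi) {u : ℂ}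
    (hu : u ≠ 0) (hu1 : |u.arg| < α) :
    ∃ z : ℂ, ‖u‖ ≤ 2 * ‖z‖ ∧ |z.arg| ≤ α - Real.arctan (α / 8) ∧ z ≠ 0 ∧
      ∀ y : ℂ, ‖y - z‖ < ‖u - z‖ → |y.arg| < α ∧ y ≠ 0 ∧ ‖u‖ ≤ 4 * ‖y‖ := by
  rcases le_or_gt 0 u.arg with h0 | h0
  · exact exists_interior_ball_of_arg_nonneg hα0 hα hu h0 (abs_lt.1 hu1).2
  · have hconj (v : ℂ) : |((starRingEnd ℂ) v).arg| = |v.arg| := by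
      rw [Complex.arg_conj]; split_ifs with h
      · rw [h]
      · exact abs_neg _
    have hcn (v w : ℂ) : ‖v - (starRingEnd ℂ) w‖ = ‖(starRingEnd ℂ) v - w‖ := by
      rw [← RCLike.norm_conj (K := ℂ)]; simp
    have hua : ((starRingEnd ℂ) u).arg = -u.arg := by
      rw [Complex.arg_conj, if_neg (by linarith [Real.pi_pos])]
    obtain ⟨z, hz1, hz2, hz3, hz4⟩ := exists_interior_ball_of_arg_nonneg hα0 hα
      (u := (starRingEnd ℂ) u) (by simpa using hu) (by linarith)
      (by rw [hua]; linarith [(abs_lt.1 hu1).1])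
    refine ⟨(starRingEnd ℂ) z, ?_, ?_, by simpa using hz3, fun y hy => ?_⟩
    · simpa using hz1
    · rwa [hconj]
    · rw [hcn, hcn] at hy
      have := hz4 _ hy
      simpa [hconj] using this

/-- In the plane slit along a thickened half-line, a point of the left half-plane can be
reached from a ball centred away from the slit. -/
theorem exists_slit_ball {u : ℂ} (hre : u.re ≤ 0) (s : ℝ) (hs : s = 1 ∨ s = -1) (him : 0 < s * u.im) :
    ∃ z : ℂ, ‖u‖ ≤ 2 * ‖z‖ ∧ ‖z‖ * (-(9 / 10)) ≤ z.re ∧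
      ∀ y : ℂ, ‖y - z‖ < ‖u - z‖ → s * u.im < s * y.im ∧ ‖u‖ ≤ 4 * ‖y‖ := by
  set r := ‖u‖ with hr
  have hs2 : s * s = 1 := by rcases hs with h | h <;> rw [h] <;> norm_num
  have hrsq : r ^ 2 = u.re ^ 2 + u.im ^ 2 := by
    rw [hr, ← Complex.normSq_eq_norm_sq, Complex.normSq_apply]; ring
  have hrpos : 0 < r := by
    apply norm_pos_iff.2; rintro rfl; simp at him
  set z : ℂ := ⟨u.re, u.im + s * r⟩ with hz
  have hzsq : ‖z‖ ^ 2 = 2 * r ^ 2 + 2 * (s * u.im) * r := by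
    rw [← Complex.normSq_eq_norm_sq, Complex.normSq_apply, hz]
    linear_combination (-1) * hrsq + r ^ 2 * hs2
  have hzn : 5 / 4 * r ≤ ‖z‖ := by
    rw [← sq_le_sq₀ (by positivity) (norm_nonneg _)]
    nlinarith [mul_pos him hrpos]
  have hdist : ‖u - z‖ = r := by
    rw [← sq_eq_sq₀ (norm_nonneg _) hrpos.le, ← Complex.normSq_eq_norm_sq, Complex.normSq_apply, hz]
    simp only [Complex.sub_re, Complex.sub_im]
    linear_combination r ^ 2 * hs2
  refine ⟨z, by linarith, ?_, fun y hy => ?_⟩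
  · have h1 : r ≤ 9 / 10 * ‖z‖ := by
      rw [← sq_le_sq₀ hrpos.le (by positivity)]
      nlinarith [mul_pos him hrpos]
    have h2 := (abs_le.1 (Complex.abs_re_le_norm u)).1
    change _ ≤ u.re
    linarith
  · rw [hdist] at hy
    have h1 := (Complex.abs_im_le_norm (y - z)).trans_lt hy
    have h2 := norm_sub_norm_le z y
    rw [norm_sub_rev] at h2
    refine ⟨?_, by linarith⟩
    rw [Complex.sub_im, abs_lt] at h1
    have h3 : z.im = u.im + s * r := rfl
    rw [h3] at h1
    rcases hs with rfl | rfl <;> linarith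

/-- Every point of the wedge lies on the boundary of a disc in the wedge, centred in a smaller
wedge and bounded away from the origin. -/
theorem exists_ball_subset_Wset {b α : ℝ} (hα0 : 0 < α) (hα : α ≤ Real.pi) (hb : 0 < b) :
    ∃ β, 0 < β ∧ β < α ∧ ∀ x ∈ Wset b α, ∃ z : ℂ, ‖latticePt x‖ ≤ 2 * ‖z‖ ∧
      ‖z‖ * Real.cos β ≤ z.re ∧
      ∀ y, ‖latticePt y - z‖ < ‖latticePt x - z‖ →
        y ∈ Wset b α ∧ ‖latticePt x‖ ≤ 4 * ‖latticePt y‖ := by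
  rcases hα.lt_or_eq with hα' | rfl
  · have hat : Real.arctan (α / 8) < α := by
      have := Real.arctan_nonneg.2 (by positivity : 0 ≤ α / 8)
      have h2 := Real.le_tan this (Real.arctan_lt_pi_div_two _)
      rw [Real.tan_arctan] at h2
      linarith
    have hat0 := Real.arctan_pos.2 (by positivity : 0 < α / 8)
    have hmem (x : ℤ × ℤ) : x ∈ Wset b α ↔ ‖latticePt x‖ * Real.cos α < (latticePt x).re := by
      rw [norm_latticePt]
      exact ⟨fun h => h.elim And.right fun h => absurd h.1 hα'.ne, fun h => Or.inl ⟨hα', h⟩⟩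
    refine ⟨α - Real.arctan (α / 8), by linarith, by linarith, fun x hx => ?_⟩
    rw [hmem] at hx
    have hx0 : latticePt x ≠ 0 := fun h => by rw [h] at hx; simp at hx
    rw [← abs_arg_lt_iff hα0.le hα hx0] at hx
    obtain ⟨z, h1, h2, h3, h4⟩ := exists_interior_ball hα0 hα' hx0 hx
    refine ⟨z, h1, (abs_arg_le_iff (by linarith) (by linarith) h3).1 h2, fun y hy => ?_⟩
    obtain ⟨h5, h6, h7⟩ := h4 _ hy
    exact ⟨(hmem y).2 ((abs_arg_lt_iff hα0.le hα h6).1 h5), h7⟩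
  · have hmem (x : ℤ × ℤ) : x ∈ Wset b Real.pi ↔
        ¬ ((latticePt x).re ≤ 0 ∧ |(latticePt x).im| ≤ b) :=
      ⟨fun h => h.elim (fun h => absurd h.1 (lt_irrefl _)) And.right, fun h => Or.inr ⟨rfl, h⟩⟩
    have hcos : Real.cos (Real.arccos (-(9 / 10))) = -(9 / 10) :=
      Real.cos_arccos (by norm_num) (by norm_num)
    refine ⟨Real.arccos (-(9 / 10)), Real.arccos_pos.2 (by norm_num), ?_, fun x hx => ?_⟩
    · rw [← Real.arccos_neg_one]
      exact Real.arccos_lt_arccos le_rfl (by norm_num) (by norm_num)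
    rw [hcos]
    rw [hmem] at hx
    by_cases hre : (latticePt x).re ≤ 0
    · have him : b < |(latticePt x).im| := by
        by_contra! h
        exact hx ⟨hre, h⟩
      obtain ⟨s, hs, hsu⟩ : ∃ s : ℝ, (s = 1 ∨ s = -1) ∧ s * (latticePt x).im = |(latticePt x).im| := by
        rcases abs_cases (latticePt x).im with ⟨h, -⟩ | ⟨h, -⟩
        · exact ⟨1, Or.inl rfl, by rw [h, one_mul]⟩
        · exact ⟨-1, Or.inr rfl, by rw [h, neg_one_mul]⟩
      obtain ⟨z, h1, h2, h3⟩ := exists_slit_ball hre s hs (by linarith)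
      refine ⟨z, h1, h2, fun y hy => ?_⟩
      obtain ⟨h4, h5⟩ := h3 _ hy
      refine ⟨(hmem y).2 fun h => ?_, h5⟩
      have h6 : s * (latticePt y).im ≤ |(latticePt y).im| := by
        rcases hs with rfl | rfl
        · rw [one_mul]; exact le_abs_self _
        · rw [neg_one_mul]; exact neg_le_abs _
      linarith [h.2]
    · refine ⟨latticePt x, by linarith [norm_nonneg (latticePt x)], ?_, fun y hy => ?_⟩
      · linarith [norm_nonneg (latticePt x)]
      · rw [sub_self, norm_zero] at hy
        exact absurd hy (norm_nonneg _).not_gt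

theorem exists_nat_le_rpow_mul {s w δ c N₀ : ℝ} {m : ℕ} (hs : 0 < s) (hw : w < 2 * s)
    (hδ : 0 < δ) (hc : 0 < c) (f : ℕ → ℝ)
    (h : ∀ N, N₀ ≤ N → ∀ n : ℕ, (n : ℝ) ≤ δ * N ^ 2 → c / (2 * N) ^ w ≤ f (n + m)) (B : ℝ) :
    ∃ n : ℕ, B ≤ (n : ℝ) ^ s * f n := by
  have hlim : Filter.Tendsto (fun N : ℝ => c * (δ / 2) ^ s / 2 ^ w * N ^ (2 * s - w))
      Filter.atTop Filter.atTop :=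
    (tendsto_rpow_atTop (by linarith)).const_mul_atTop (by positivity)
  have hlim2 : Filter.Tendsto (fun N : ℝ => δ * N ^ 2) Filter.atTop Filter.atTop :=
    (Filter.tendsto_pow_atTop two_ne_zero).const_mul_atTop hδ
  obtain ⟨N, hN₀, hN1, hNδ, hNB⟩ := ((Filter.eventually_ge_atTop N₀).and
    ((Filter.eventually_ge_atTop 1).and ((hlim2.eventually_ge_atTop 1).and
      (hlim.eventually_ge_atTop B)))).exists
  have hNpos : 0 < N := by linarith
  have h1 := Nat.floor_le (by positivity : 0 ≤ δ * N ^ 2)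
  have h2 := Nat.lt_floor_add_one (δ * N ^ 2)
  have h3 : (1 : ℝ) ≤ ⌊δ * N ^ 2⌋₊ := by
    exact_mod_cast Nat.le_floor (by exact_mod_cast hNδ)
  have h4 := h N hN₀ _ h1
  refine ⟨⌊δ * N ^ 2⌋₊ + m, hNB.trans ?_⟩
  have h5 : δ / 2 * N ^ 2 ≤ ((⌊δ * N ^ 2⌋₊ + m : ℕ) : ℝ) := by
    push_cast
    have : (0 : ℝ) ≤ m := m.cast_nonneg
    linarith
  have h6 : (δ / 2 * N ^ 2) ^ s ≤ ((⌊δ * N ^ 2⌋₊ + m : ℕ) : ℝ) ^ s :=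
    Real.rpow_le_rpow (by positivity) h5 hs.le
  calc c * (δ / 2) ^ s / 2 ^ w * N ^ (2 * s - w)
      = (δ / 2 * N ^ 2) ^ s * (c / (2 * N) ^ w) := by
        rw [Real.mul_rpow (by positivity) (by positivity), Real.mul_rpow (by positivity) hNpos.le,
          Real.rpow_sub hNpos, Real.rpow_mul hNpos.le, Real.rpow_two]
        field_simp
    _ ≤ _ := by gcongr

theorem exists_wedge_exponents {α β s : ℝ} (hα0 : 0 < α) (hβ0 : 0 < β) (hβ : β < α)
    (hs : Real.pi / (4 * α) < s) :
    ∃ w α₁ α₂, 0 < w ∧ w < 2 * s ∧ w * α ≤ Real.pi ∧ β < α₂ ∧ α₂ < α₁ ∧ α₁ < α ∧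
      Real.pi / 2 < w * α₁ := by
  have hpi := Real.pi_pos
  obtain ⟨w, hw1, hw2⟩ : ∃ w, Real.pi / (2 * α) < w ∧ w < min (2 * s) (Real.pi / α) := by
    apply exists_between
    apply lt_min
    · have : Real.pi / (2 * α) = 2 * (Real.pi / (4 * α)) := by field_simp; norm_num
      linarith
    · rw [div_lt_div_iff_of_pos_left hpi (by positivity) hα0]; linarith
  have hw0 : 0 < w := lt_trans (by positivity) hw1
  have hw3 : w < Real.pi / α := hw2.trans_le (min_le_right _ _)
  rw [lt_div_iff₀ hα0] at hw3
  rw [div_lt_iff₀ (by positivity)] at hw1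
  obtain ⟨α₂, h1, h2⟩ := exists_between hβ
  obtain ⟨α₁, h3, h4⟩ : ∃ α₁, max α₂ (Real.pi / (2 * w)) < α₁ ∧ α₁ < α := by
    apply exists_between (max_lt h2 _)
    rw [div_lt_iff₀ (by positivity)]; linarith
  refine ⟨w, α₁, α₂, hw0, hw2.trans_le (min_le_left _ _), hw3.le, h1,
    (le_max_left _ _).trans_lt h3, h4, ?_⟩
  have := (le_max_right _ _).trans_lt h3
  rw [div_lt_iff₀ (by positivity)] at this
  linarith

theorem IsAsymptoticallyIsotropic.exists_le_rpow_mul_stayProb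
    {p : ℤ × ℤ → ℤ × ℤ → ℝ} {J : Finset (ℤ × ℤ)} {T : Set (ℤ × ℤ)} {b σ2 : ℝ}
    (h : IsAsymptoticallyIsotropic p J T b σ2) (hb : 0 < b) (hσ : 0 < σ2) {α s : ℝ}
    (hα0 : 0 < α) (hα : α ≤ Real.pi) (hs : Real.pi / (4 * α) < s) :
    ∃ A : ℝ, 0 < A ∧ ∀ x ∈ T, x ∈ Wset b α → A ≤ ‖latticePt x‖ → ∀ B : ℝ,
      ∃ n : ℕ, B ≤ (n : ℝ) ^ s * stayProb p J (Wset b α) n x := by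
  have hpi := Real.pi_pos
  have hs0 : 0 < s := lt_trans (by positivity) hs
  obtain ⟨β, hβ0, hβα, hball⟩ := exists_ball_subset_Wset hα0 hα hb
  obtain ⟨w, α₁, α₂, hw0, hws, hwα, h2, h21, h1, hw1⟩ := exists_wedge_exponents hα0 hβ0 hβα hs
  have hcos {u v : ℝ} (hu : 0 ≤ u) (huv : u < v) (hv : v ≤ Real.pi) : Real.cos v < Real.cos u :=
    Real.strictAntiOn_cos ⟨hu, huv.le.trans hv⟩ ⟨hu.trans huv.le, hv⟩ huv
  have hη0 : 0 < -Real.cos (w * α₁) := by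
    rw [neg_pos]
    apply Real.cos_neg_of_pi_div_two_lt_of_lt hw1
    nlinarith
  obtain ⟨r, D, hpath⟩ := h.exists_stayProb_ge_of_ball hb hσ
  obtain ⟨R, C, N₀, δ, hδ, hsub⟩ := h.wedgeFun_sub_le_stayProb hb hσ (w := w)
    (η := -Real.cos (w * α₁)) (a := Real.cos α) (a₁ := Real.cos α₁) hw0 hη0
    (by linarith [Real.neg_one_le_cos (w * α₁)]) (Real.neg_one_le_cos α)
    (hcos (by linarith) h1 hα) (Real.cos_le_one α₁)
    (by
      intro z hz hz1 hz2
      rw [wedgeFun_eq]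
      have h3 : α₁ ≤ |z.arg| := by
        by_contra! h3
        rw [abs_arg_lt_iff (by linarith) (by linarith) hz] at h3
        linarith
      have h4 := (abs_arg_le_iff hα0.le hα hz).2 hz1
      have h5 : Real.cos (w * |z.arg|) ≤ Real.cos (w * α₁) := by
        apply Real.cos_le_cos_of_nonneg_of_le_pi
        · nlinarith
        · nlinarith
        · gcongr
      have h6 : 0 ≤ ‖z‖ ^ w := by positivity
      nlinarith)
    (W := Wset b α) (fun x hx => mem_Wset_of_lt hα hb hx)
  have hgap : 0 < Real.cos (w * α₂) - Real.cos (w * α₁) := by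
    have := hcos (u := w * α₂) (v := w * α₁) (by nlinarith) (by gcongr) (by nlinarith)
    linarith
  have hgap' : 0 < Real.cos β - Real.cos α₂ := by
    have := hcos hβ0.le h2 (by linarith)
    linarith
  obtain ⟨L, hL⟩ : ∃ L : ℝ, ∀ t, L ≤ t →
      C + 4 ≤ (Real.cos (w * α₂) - Real.cos (w * α₁)) * t ^ w := by
    have := ((tendsto_rpow_atTop hw0).const_mul_atTop hgap).eventually_ge_atTop (C + 4)
    exact Filter.eventually_atTop.1 this
  have hA : ∃ A : ℝ, 0 < A ∧ 4 * r ≤ A ∧ r ≤ A ∧ L + D ≤ A / 2 ∧ R + D ≤ A / 2 ∧ 1 + D ≤ A / 2 ∧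
      2 * D ≤ A / 2 * (Real.cos β - Real.cos α₂) := by
    have hlim : Filter.Tendsto (fun A : ℝ => A / 2) Filter.atTop Filter.atTop :=
      Filter.tendsto_id.atTop_div_const two_pos
    exact ((Filter.eventually_gt_atTop 0).and ((Filter.eventually_ge_atTop _).and
      ((Filter.eventually_ge_atTop _).and ((hlim.eventually_ge_atTop _).and
      ((hlim.eventually_ge_atTop _).and ((hlim.eventually_ge_atTop _).and
      ((hlim.atTop_mul_const hgap').eventually_ge_atTop _))))))).exists
  obtain ⟨A, hA0, hA1, hA2, hA3, hA4, hA5, hA6⟩ := hA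
  refine ⟨A, hA0, fun x hxT hxW hxA => ?_⟩
  obtain ⟨z, hz1, hz2, hz3⟩ := hball x hxW
  obtain ⟨y, hyT, hyD, m, c, hc, hy⟩ := hpath (Wset b α) z ‖latticePt x - z‖
    (fun y hy => ⟨(hz3 y hy).1, by linarith [(hz3 y hy).2]⟩) x hxT le_rfl hxW (by linarith)
  have hyz : ‖z‖ - D ≤ ‖latticePt y‖ := by
    have := norm_sub_norm_le z (latticePt y)
    rw [norm_sub_rev] at this
    linarith
  have hyz' : ‖latticePt y‖ ≤ ‖z‖ + D := by
    have := norm_sub_norm_le (latticePt y) z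
    linarith
  have hD : 0 ≤ D := (norm_nonneg _).trans hyD
  have hyn : 1 ≤ ‖latticePt y‖ := by linarith
  have hyne : latticePt y ≠ 0 := norm_pos_iff.1 (by linarith)
  have hyre : ‖latticePt y‖ * Real.cos α₂ ≤ (latticePt y).re := by
    have h3 := (abs_le.1 ((Complex.abs_re_le_norm (latticePt y - z)).trans hyD)).1
    rw [Complex.sub_re] at h3
    have h4 : (‖latticePt y‖ - ‖z‖) * Real.cos α₂ ≤ D * 1 := by
      refine (le_abs_self _).trans ?_
      rw [abs_mul]
      exact mul_le_mul (abs_le.2 ⟨by linarith, by linarith⟩) (Real.abs_cos_le_one _)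
        (abs_nonneg _) hD
    have h5 : A / 2 * (Real.cos β - Real.cos α₂) ≤ ‖z‖ * (Real.cos β - Real.cos α₂) := by
      gcongr; linarith
    linarith
  have hyre' : ‖latticePt y‖ * Real.cos α₁ < (latticePt y).re := by
    have := hcos (u := α₂) (v := α₁) (by linarith) h21 (by linarith)
    nlinarith
  have hval : C + 4 ≤ wedgeFun w (-Real.cos (w * α₁)) (latticePt y) := by
    refine (hL ‖latticePt y‖ (by linarith)).trans ?_
    rw [wedgeFun_eq, mul_comm]
    gcongr
    have h3 := (abs_arg_le_iff (by linarith) (by linarith) hyne).2 hyre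
    have h4 : Real.cos (w * α₂) ≤ Real.cos (w * |(latticePt y).arg|) := by
      apply Real.cos_le_cos_of_nonneg_of_le_pi
      · positivity
      · nlinarith
      · gcongr
    linarith
  refine exists_nat_le_rpow_mul (m := m) (c := c) (N₀ := max N₀ ‖latticePt y‖) hs0 hws hδ hc _
    fun N hN n hn => ?_
  have hN1 := (le_max_left _ _).trans hN
  have hN2 := (le_max_right _ _).trans hN
  have hN0 : 0 < N := by linarith
  refine le_trans ?_ (hy n)
  rw [div_eq_mul_one_div]
  gcongr
  refine le_trans ?_ (hsub N hN1 n hn y hyT (by linarith) hyre' (by linarith))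
  rw [div_le_div_iff₀ (by positivity) (by positivity)]
  have : 0 < (2 * N) ^ w := by positivity
  nlinarith

theorem exists_finset_mem_iff_znorm_le (b : ℝ) : ∃ J : Finset (ℤ × ℤ), ∀ y, y ∈ J ↔ znorm y ≤ b := by
  have hfin : {y : ℤ × ℤ | znorm y ≤ b}.Finite := by
    refine ((Set.finite_Icc (-⌈b⌉) ⌈b⌉).prod (Set.finite_Icc (-⌈b⌉) ⌈b⌉)).subset fun y hy => ?_
    have hy' : ‖latticePt y‖ ≤ ⌈b⌉ := (norm_latticePt y).trans_le (hy.out.trans (Int.le_ceil b))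
    have h1 := abs_le.1 ((Complex.abs_re_le_norm _).trans hy')
    have h2 := abs_le.1 ((Complex.abs_im_le_norm _).trans hy')
    simp only [latticePt] at h1 h2
    exact ⟨⟨by exact_mod_cast h1.1, by exact_mod_cast h1.2⟩,
      ⟨by exact_mod_cast h2.1, by exact_mod_cast h2.2⟩⟩
  exact ⟨hfin.toFinset, fun y => by simp⟩

theorem isAsymptoticallyIsotropic_of_moments {p : ℤ × ℤ → ℤ × ℤ → ℝ} {b σ2 : ℝ}
    {J : Finset (ℤ × ℤ)} {T : Set (ℤ × ℤ)} (hpmf : IsJumpPMF p) (hA2 : A2 p b)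
    (hJ : ∀ y, y ∈ J ↔ znorm y ≤ b) (hT : ∀ x ∈ T, ∀ y, p x y ≠ 0 → x + y ∈ T)
    (hsub2 : ∀ ε : ℝ, 0 < ε → ∃ r₁ : ℝ, ∀ x ∈ T, r₁ ≤ znorm x →
      znorm x * muNorm p x ≤ ε ∧ |M11 p x - σ2| ≤ ε ∧ |M22 p x - σ2| ≤ ε ∧ |M12 p x| ≤ ε) :
    IsAsymptoticallyIsotropic p J T b σ2 := by
  have hsum (x : ℤ × ℤ) (f : ℤ × ℤ → ℝ) : ∑' y, p x y * f y = ∑ y ∈ J, p x y * f y := by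
    refine tsum_eq_sum fun y hy => ?_
    rw [hJ, not_le] at hy
    rw [hA2 x y hy, zero_mul]
  have hsqre (x : ℤ × ℤ) :
      (∑ y ∈ J, (p x y : ℂ) * latticePt y ^ 2).re = M11 p x - M22 p x := by
    rw [M11, M22, hsum, hsum, Complex.re_sum, ← Finset.sum_sub_distrib]
    refine Finset.sum_congr rfl fun y _ => ?_
    simp [latticePt, pow_two]
    ring
  have hsqim (x : ℤ × ℤ) :
      (∑ y ∈ J, (p x y : ℂ) * latticePt y ^ 2).im = 2 * M12 p x := by
    rw [M12, hsum, Complex.im_sum, Finset.mul_sum]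
    refine Finset.sum_congr rfl fun y _ => ?_
    simp [latticePt, pow_two]
    ring
  refine ⟨hpmf.1, fun x => ?_, fun y hy => ?_, hT, fun ε hε => ?_, fun ε hε => ?_, fun ε hε => ?_⟩
  · have := hsum x fun _ => 1
    simp only [mul_one] at this
    rw [← this]
    exact (hpmf.2 x).tsum_eq
  · rw [norm_latticePt]
    exact (hJ y).1 hy
  · obtain ⟨r, hr⟩ := hsub2 ε hε
    refine ⟨r, fun x hx hxr => ?_⟩
    rw [norm_latticePt] at hxr ⊢
    convert (hr x hx hxr).1 using 2
    rw [Complex.norm_def, Complex.normSq_apply, muNorm, pow_two, pow_two, mu1, mu2, hsum, hsum,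
      Complex.re_sum, Complex.im_sum]
    simp [latticePt]
  · obtain ⟨r, hr⟩ := hsub2 (ε / 4) (by positivity)
    refine ⟨r, fun x hx hxr => ?_⟩
    rw [norm_latticePt] at hxr
    obtain ⟨-, h1, h2, h3⟩ := hr x hx hxr
    refine (Complex.norm_le_abs_re_add_abs_im _).trans ?_
    rw [hsqre, hsqim, abs_mul, abs_two]
    have := abs_sub_le (M11 p x) σ2 (M22 p x)
    rw [abs_sub_comm σ2] at this
    linarith
  · obtain ⟨r, hr⟩ := hsub2 (ε / 2) (by positivity)
    refine ⟨r, fun x hx hxr => ?_⟩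
    rw [norm_latticePt] at hxr
    obtain ⟨-, h1, h2, -⟩ := hr x hx hxr
    have h3 : ∑ y ∈ J, p x y * ‖latticePt y‖ ^ 2 = M11 p x + M22 p x := by
      rw [M11, M22, hsum, hsum, ← Finset.sum_add_distrib]
      refine Finset.sum_congr rfl fun y _ => ?_
      rw [← Complex.normSq_eq_norm_sq, Complex.normSq_apply, latticePt]
      ring
    rw [h3, show M11 p x + M22 p x - 2 * σ2 = (M11 p x - σ2) + (M22 p x - σ2) by ring]
    exact (abs_add_le _ _).trans (by linarith)

theorem natCast_le_exitTime {Ω : Type*} {ξ : ℕ → Ω → ℤ × ℤ} {W : Set (ℤ × ℤ)} {ω : Ω} {n : ℕ}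
    (h : ∀ t, t ≤ n → ξ t ω ∈ W) :
    (n : ℝ≥0∞) ≤ exitTime W ξ ω :=
  le_iInf₂ fun t ht => by
    by_contra! hlt
    exact ht (h t (by exact_mod_cast hlt.le))

section walk

variable {Ω : Type*} [MeasurableSpace Ω] {P : Measure Ω} {ξ : ℕ → Ω → ℤ × ℤ}
  {p : ℤ × ℤ → ℤ × ℤ → ℝ}


theorem measurableSet_forall_mem (hmeas : ∀ t, Measurable (ξ t)) (W : Set (ℤ × ℤ)) (k l : ℕ) :
    MeasurableSet {ω | ∀ t, k ≤ t → t ≤ l → ξ t ω ∈ W} := by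
  simp only [Set.ofPred_forall]
  exact MeasurableSet.iInter fun t => MeasurableSet.iInter fun _ => MeasurableSet.iInter fun _ =>
    hmeas t W.to_countable.measurableSet

/-- Conditionally on the past up to time `m` and on `ξ m = x`, the walk stays in `W` for `n` more
steps with probability at least `stayProb p J W n x`. -/
theorem IsMarkovWith.ofReal_stayProb_mul_measure_le (hMarkov : IsMarkovWith P ξ p)
    (hmeas : ∀ t, Measurable (ξ t)) (hp : ∀ x y, 0 ≤ p x y) (J : Finset (ℤ × ℤ))
    (W : Set (ℤ × ℤ)) (n : ℕ) : ∀ (m : ℕ) (x : ℤ × ℤ) (A : Set Ω),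
      MeasurableSet[⨆ s ∈ Finset.range (m + 1), MeasurableSpace.comap (ξ s) ⊤] A →
      ENNReal.ofReal (stayProb p J W n x) * P (A ∩ {ω | ξ m ω = x}) ≤
        P (A ∩ {ω | ξ m ω = x} ∩ {ω | ∀ t, m ≤ t → t ≤ m + n → ξ t ω ∈ W}) := by
  induction n with
  | zero =>
    intro m x A hA
    by_cases hx : x ∈ W
    · rw [stayProb_zero_of_mem hx, ENNReal.ofReal_one, one_mul]
      refine measure_mono fun ω hω => ⟨hω, fun t h1 h2 => ?_⟩
      rw [show t = m by omega, hω.2]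
      exact hx
    · rw [stayProb_of_notMem hx]; simp
  | succ n ih =>
    intro m x A hA
    by_cases hx : x ∈ W
    swap
    · rw [stayProb_of_notMem hx]; simp
    have hle (t : ℕ) : (⨆ s ∈ Finset.range (t + 1), MeasurableSpace.comap (ξ s) ⊤) ≤
        ‹MeasurableSpace Ω› := by
      refine iSup₂_le fun s _ => ?_
      rintro _ ⟨u, -, rfl⟩
      exact hmeas s u.to_countable.measurableSet
    have hmono : (⨆ s ∈ Finset.range (m + 1), MeasurableSpace.comap (ξ s) ⊤) ≤
        ⨆ s ∈ Finset.range (m + 1 + 1), MeasurableSpace.comap (ξ s) ⊤ :=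
      biSup_mono fun s hs => Finset.mem_range.2 ((Finset.mem_range.1 hs).trans (Nat.lt_succ_self _))
    have hB : MeasurableSet[⨆ s ∈ Finset.range (m + 1), MeasurableSpace.comap (ξ s) ⊤]
        (A ∩ {ω | ξ m ω = x}) := by
      refine hA.inter (le_iSup₂_of_le (f := fun s (_ : s ∈ Finset.range (m + 1)) =>
        MeasurableSpace.comap (ξ s) ⊤) m (by simp) le_rfl _ ⟨{x}, trivial, rfl⟩)
    set B := A ∩ {ω | ξ m ω = x} with hBdef
    rw [stayProb_succ_of_mem hx, ENNReal.ofReal_sum_of_nonneg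
      fun y _ => mul_nonneg (hp x y) (stayProb_nonneg hp J W n _), Finset.sum_mul]
    calc ∑ y ∈ J, ENNReal.ofReal (p x y * stayProb p J W n (x + y)) * P B
        ≤ ∑ y ∈ J, P (B ∩ {ω | ξ (m + 1) ω = x + y} ∩
            {ω | ∀ t, m + 1 ≤ t → t ≤ m + 1 + n → ξ t ω ∈ W}) := by
          refine Finset.sum_le_sum fun y _ => ?_
          refine le_trans (le_of_eq ?_) (ih (m + 1) (x + y) B (hmono _ hB))
          rw [hMarkov m x y A hA, ENNReal.ofReal_mul (hp x y)]
          ring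
      _ = P (⋃ y ∈ J, (B ∩ {ω | ξ (m + 1) ω = x + y} ∩
            {ω | ∀ t, m + 1 ≤ t → t ≤ m + 1 + n → ξ t ω ∈ W})) := by
          refine (measure_biUnion_finset (fun y _ y' _ hne => ?_) fun y _ => ?_).symm
          · refine Set.disjoint_left.2 fun ω h1 h2 => hne ?_
            exact add_left_cancel (h1.1.2.out.symm.trans h2.1.2.out)
          · exact ((hle m _ hB).inter (hmeas _ (measurableSet_singleton _))).inter
              (measurableSet_forall_mem hmeas W _ _)
      _ ≤ _ := by
          refine measure_mono (Set.iUnion₂_subset fun y _ ω hω => ⟨hω.1.1, fun t h1 h2 => ?_⟩)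
          rcases h1.eq_or_lt with rfl | h1
          · rw [hω.1.1.2.out]; exact hx
          · exact hω.2 t h1 (by omega)

theorem IsMarkovWith.measure_ne_zero_of_ne_zero (hMarkov : IsMarkovWith P ξ p)
    (hp : ∀ x y, 0 ≤ p x y) {x y : ℤ × ℤ} {t : ℕ} (hx : P {ω | ξ t ω = x} ≠ 0) (hy : p x y ≠ 0) :
    P {ω | ξ (t + 1) ω = x + y} ≠ 0 := by
  intro h0
  have h1 := hMarkov t x y Set.univ MeasurableSet.univ
  rw [Set.univ_inter, measure_mono_null Set.inter_subset_right h0, eq_comm, mul_eq_zero,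
    ENNReal.ofReal_eq_zero] at h1
  exact h1.elim (fun h => hy (h.antisymm (hp x y))) hx

theorem IsMarkovWith.le_lintegral_exitTime (hMarkov : IsMarkovWith P ξ p)
    (hmeas : ∀ t, Measurable (ξ t)) (hp : ∀ x y, 0 ≤ p x y) (J : Finset (ℤ × ℤ))
    (W : Set (ℤ × ℤ)) {s : ℝ} (hs : 0 ≤ s) (n : ℕ) (x : ℤ × ℤ) :
    ENNReal.ofReal ((n : ℝ) ^ s * stayProb p J W n x) * P {ω | ξ 0 ω = x} ≤
      ∫⁻ ω in {ω | ξ 0 ω = x}, exitTime W ξ ω ^ s ∂P := by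
  have h1 := hMarkov.ofReal_stayProb_mul_measure_le hmeas hp J W n 0 x Set.univ MeasurableSet.univ
  rw [Set.univ_inter] at h1
  set E := {ω | ∀ t, 0 ≤ t → t ≤ 0 + n → ξ t ω ∈ W}
  have hE : MeasurableSet E := measurableSet_forall_mem hmeas W _ _
  calc _ = (n : ℝ≥0∞) ^ s * (ENNReal.ofReal (stayProb p J W n x) * P {ω | ξ 0 ω = x}) := by
        rw [ENNReal.ofReal_mul (by positivity), ← mul_assoc,
          ← ENNReal.ofReal_rpow_of_nonneg n.cast_nonneg hs, ENNReal.ofReal_natCast]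
    _ ≤ (n : ℝ≥0∞) ^ s * P ({ω | ξ 0 ω = x} ∩ E) := by gcongr
    _ = ∫⁻ _ in {ω | ξ 0 ω = x} ∩ E, (n : ℝ≥0∞) ^ s ∂P := by
        rw [setLIntegral_const]
    _ ≤ ∫⁻ ω in {ω | ξ 0 ω = x} ∩ E, exitTime W ξ ω ^ s ∂P := by
        refine setLIntegral_mono' ((hmeas 0 (measurableSet_singleton x)).inter hE) fun ω hω => ?_
        exact ENNReal.rpow_le_rpow
          (natCast_le_exitTime fun t ht => hω.2 t (Nat.zero_le _) (by omega)) hs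
    _ ≤ _ := lintegral_mono_set Set.inter_subset_left

end walk

/-- Theorem 2.4(ii): under (A1), (A2) and (sub2), for `α ∈ (0,π]`
and `s > π/(4α)`, there is `A ∈ (0,∞)` such that `E[τ_α^s ∣ ξ₀ = x] = ∞` for every
`x ∈ W(α)` with `‖x‖ ≥ A`. -/
theorem exit_time_moments_subcritical_infinite
    {Ω : Type*} [MeasurableSpace Ω] (P : Measure Ω) [IsProbabilityMeasure P]
    (S : Set (ℤ × ℤ)) (hSunb : ∀ R : ℝ, ∃ x ∈ S, R < znorm x)
    (ξ : ℕ → Ω → ℤ × ℤ) (hmeas : ∀ t, Measurable (ξ t))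
    (hinS : ∀ t, ∀ᵐ ω ∂P, ξ t ω ∈ S)
    (p : ℤ × ℤ → ℤ × ℤ → ℝ) (hpmf : IsJumpPMF p)
    (hMarkov : IsMarkovWith P ξ p)
    (κ : ℝ) (k n₀ : ℕ) (hκ : 0 < κ) (hk : 0 < k) (hn₀ : 0 < n₀)
    (hA1 : A1 P S ξ κ k n₀)
    (b : ℝ) (hb : 0 < b) (hA2 : A2 p b)
    (σ2 : ℝ) (hσ : 0 < σ2)
    (hsub2 : ∀ ε : ℝ, 0 < ε → ∃ r₁ : ℝ, ∀ x ∈ S, r₁ ≤ znorm x →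
      znorm x * muNorm p x ≤ ε ∧ |M11 p x - σ2| ≤ ε ∧ |M22 p x - σ2| ≤ ε ∧ |M12 p x| ≤ ε)
    (α : ℝ) (hα0 : 0 < α) (hαπ : α ≤ Real.pi) :
    ∀ s : ℝ, Real.pi / (4 * α) < s → ∃ A : ℝ, 0 < A ∧
      ∀ x ∈ Wset b α, A ≤ znorm x → P {ω | ξ 0 ω = x} ≠ 0 →
        ∫⁻ ω in {ω | ξ 0 ω = x}, exitTime (Wset b α) ξ ω ^ s ∂P = ⊤ := by
  intro s hs
  have hs0 : 0 < s := lt_trans (by positivity) hs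
  obtain ⟨J, hJ⟩ := exists_finset_mem_iff_znorm_le b
  set T : Set (ℤ × ℤ) := {x | ∃ t, P {ω | ξ t ω = x} ≠ 0} with hT
  have hTS : T ⊆ S := by
    rintro x ⟨t, ht⟩
    by_contra hxS
    refine ht (measure_mono_null (fun ω hω => ?_) (ae_iff.1 (hinS t)))
    rw [Set.mem_ofPred_eq, hω.out]
    exact hxS
  have h : IsAsymptoticallyIsotropic p J T b σ2 := by
    refine isAsymptoticallyIsotropic_of_moments hpmf hA2 hJ ?_ fun ε hε => ?_
    · rintro x ⟨t, ht⟩ y hy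
      exact ⟨t + 1, hMarkov.measure_ne_zero_of_ne_zero hpmf.1 ht hy⟩
    · obtain ⟨r, hr⟩ := hsub2 ε hε
      exact ⟨r, fun x hx => hr x (hTS hx)⟩
  obtain ⟨A, hA, hgrow⟩ := h.exists_le_rpow_mul_stayProb hb hσ hα0 hαπ hs
  refine ⟨A, hA, fun x hxW hxA hx0 => ?_⟩
  rw [← norm_latticePt] at hxA
  refine ENNReal.eq_top_of_forall_nnreal_le fun B => ?_
  have hq : P {ω | ξ 0 ω = x} ≠ ⊤ := measure_ne_top _ _
  have hqpos := ENNReal.toReal_pos hx0 hq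
  obtain ⟨n, hn⟩ := hgrow x ⟨0, hx0⟩ hxW hxA (B / (P {ω | ξ 0 ω = x}).toReal)
  refine le_trans ?_ (hMarkov.le_lintegral_exitTime hmeas hpmf.1 J _ hs0.le n x)
  rw [div_le_iff₀ hqpos] at hn
  calc (B : ℝ≥0∞) = ENNReal.ofReal B := (ENNReal.ofReal_coe_nnreal).symm
    _ ≤ ENNReal.ofReal ((n : ℝ) ^ s * stayProb p J (Wset b α) n x *
          (P {ω | ξ 0 ω = x}).toReal) := ENNReal.ofReal_le_ofReal hn
    _ = _ := by rw [ENNReal.ofReal_mul' hqpos.le, ENNReal.ofReal_toReal hq]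
end
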